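/- arXiv:2205.08800 — 2 statements merged into one kernel-verified Lean document; each statement's English description precedes it below -/
import Mathlib

section
/- Fix N ≥ 1 and κ = 16/3, so that 2/κ = 3/8, 8/κ = 3/2, 4/κ = 3/4, q(κ) = 2, 2h(κ) = 1/8, and c(κ) = √(2π)/Γ(1/4)². Then for all x = (x_1,…,x_{2N}) ∈ 𝔛_{2N}: G^{(N)}(x_1,…,x_{2N}) = ∏_{r=1}^{N} (x_{2r}−x_{2r−1})^{−1/8} · ( ∑_{σ∈{±1}^N} ∏_{1≤s<t≤N} χ(x_{2s−1}, x_{2t−1}, x_{2t}, x_{2s})^{σ_s σ_t/4} )^{1/2}. That is, at κ = 16/3 the Coulomb gas integral G^{(N)} for the completely unnested link pattern coincides with the explicit FK-Ising partition function F_{⌢⌢}. -/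
open Filter Topology MeasureTheory

noncomputable section

/-- The conformal weight `h(κ) = (6-κ)/(2κ)`. -/
def hexp (κ : ℝ) : ℝ := (6 - κ) / (2 * κ)

/-- The cluster weight `q(κ) = 4 cos²(4π/κ)`. -/
def qexp (κ : ℝ) : ℝ := 4 * Real.cos (4 * Real.pi / κ) ^ 2

/-- The normalizing constant `c(κ) = √(q(κ)) Γ(2-8/κ) / Γ(1-4/κ)²`. -/
def cgConst (κ : ℝ) : ℝ :=
  Real.sqrt (qexp κ) * Real.Gamma (2 - 8 / κ) / Real.Gamma (1 - 4 / κ) ^ 2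

/-- The index of `x_{2r-1}` (1-indexed), i.e. `2r` (0-indexed). -/
def idxA (N : ℕ) (r : Fin N) : Fin (2 * N) := ⟨2 * r.val, by have := r.isLt; omega⟩

/-- The index of `x_{2r}` (1-indexed), i.e. `2r+1` (0-indexed). -/
def idxB (N : ℕ) (r : Fin N) : Fin (2 * N) := ⟨2 * r.val + 1, by have := r.isLt; omega⟩

/-- The Coulomb gas integrand
`∏_{r<s} (u_s-u_r)^{8/κ} ∏_{r,i} |u_r - x_i|^{-4/κ}`. -/
def cgIntegrand (κ : ℝ) (N : ℕ) (x : Fin (2 * N) → ℝ) (u : Fin N → ℝ) : ℝ :=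
  (∏ r : Fin N, ∏ s : Fin N, if r < s then (u s - u r) ^ (8 / κ) else 1) *
    ∏ r : Fin N, ∏ i : Fin (2 * N), |u r - x i| ^ (-(4 / κ))

/-- The integration domain: the open box `∏_r (x_{2r-1}, x_{2r})`. -/
def cgBox (N : ℕ) (x : Fin (2 * N) → ℝ) : Set (Fin N → ℝ) :=
  Set.univ.pi fun r => Set.Ioo (x (idxA N r)) (x (idxB N r))

/-- The Coulomb gas integral `G^{(N)}` associated to the completely unnested
link pattern `⌢⌢^{(N)} = {{1,2},…,{2N-1,2N}}`. -/
def cgG (κ : ℝ) (N : ℕ) (x : Fin (2 * N) → ℝ) : ℝ :=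
  cgConst κ ^ N
    * (∏ i : Fin (2 * N), ∏ k : Fin (2 * N), if i < k then (x k - x i) ^ (2 / κ) else 1)
    * ∫ u in cgBox N x, cgIntegrand κ N x u

/-- The cross-ratio `χ(y₁,y₂,y₃,y₄)` of four reals. -/
def crossRatioR (y₁ y₂ y₃ y₄ : ℝ) : ℝ :=
  (|y₂ - y₁| * |y₄ - y₃|) / (|y₃ - y₁| * |y₄ - y₂|)

/-- The sign `±1` associated to a boolean. -/
def sgn (s : Bool) : ℝ := if s then 1 else -1

/-- The quantity `Y^{(N)}(x)`. -/
def Ynn (N : ℕ) (x : Fin (2 * N) → ℝ) : ℝ :=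
  (∑ σ : Fin N → Bool, ∏ s : Fin N, ∏ t : Fin N,
      if s < t then
        crossRatioR (x (idxA N s)) (x (idxA N t)) (x (idxB N t)) (x (idxB N s))
          ^ (sgn (σ s) * sgn (σ t) / 4)
      else 1) ^ ((1 : ℝ) / 2)

/-! ### Parametric integrals over a compact set -/

theorem hasFDerivAt_integral_of_isCompact {𝕜 E W G α : Type*} [RCLike 𝕜]
    [NormedAddCommGroup E] [NormedSpace 𝕜 E] [NormedAddCommGroup W] [NormedSpace 𝕜 W]
    [NormedAddCommGroup G] [NormedSpace ℝ G] [NormedSpace 𝕜 G] [SMulCommClass ℝ 𝕜 G]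
    [TopologicalSpace α] [MeasurableSpace α] [BorelSpace α] [T2Space α]
    [SecondCountableTopology α]
    {μ : Measure α} [IsFiniteMeasure μ] {K : Set α} (hK : IsCompact K) (hμ : μ.restrict K = μ)
    {ι : α → W} (hι : Continuous ι) {F : E × W → G} {H : Set E} (hH : IsOpen H)
    (hF : ∀ x ∈ H, ∀ a ∈ K, ContDiffAt 𝕜 1 F (x, ι a)) {x₀ : E} (hx₀ : x₀ ∈ H) :
    HasFDerivAt (fun x => ∫ a, F (x, ι a) ∂μ)
      (∫ a, (fderiv 𝕜 F (x₀, ι a)).comp (ContinuousLinearMap.inl 𝕜 E W) ∂μ) x₀ := by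
  have hmK : MeasurableSet K := hK.measurableSet
  have hcont : ∀ x ∈ H, ContinuousOn (fun a => F (x, ι a)) K := fun x hx a ha =>
    (((hF x hx a ha).continuousAt).comp
      (f := fun a => (x, ι a)) (by fun_prop)).continuousWithinAt
  have hfd : ∀ x ∈ H, ∀ a ∈ K, ContinuousAt
      (fun p : E × W => (fderiv 𝕜 F p).comp (ContinuousLinearMap.inl 𝕜 E W)) (x, ι a) :=
    fun x hx a ha => by
      have : ContinuousAt (fderiv 𝕜 F) (x, ι a) :=
        ((hF x hx a ha).fderiv_right (m := 0) (by norm_num)).continuousAt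
      exact this.clm_comp continuousAt_const
  have hcont' : ContinuousOn
      (fun a => (fderiv 𝕜 F (x₀, ι a)).comp (ContinuousLinearMap.inl 𝕜 E W)) K := fun a ha =>
    ((hfd x₀ hx₀ a ha).comp (f := fun a => (x₀, ι a)) (by fun_prop)).continuousWithinAt
  obtain ⟨C, hC⟩ := hK.exists_bound_of_continuousOn hcont'
  have hnear : ∀ᶠ x in 𝓝 x₀, ∀ a ∈ K,
      ‖(fderiv 𝕜 F (x, ι a)).comp (ContinuousLinearMap.inl 𝕜 E W)‖ ≤ C + 1 := by
    apply hK.eventually_forall_of_forall_eventually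
    intro a ha
    have h1 : ContinuousAt (fun z : E × α =>
        ‖(fderiv 𝕜 F (z.1, ι z.2)).comp (ContinuousLinearMap.inl 𝕜 E W)‖) (x₀, a) :=
      ((hfd x₀ hx₀ a ha).comp (f := fun z : E × α => (z.1, ι z.2)) (x := (x₀, a))
        (by fun_prop)).norm
    have h2 := h1.eventually (gt_mem_nhds (lt_of_le_of_lt (hC a ha) (lt_add_one C)))
    exact h2.mono fun z hz => le_of_lt hz
  have hset := hnear.and (hH.mem_nhds hx₀)
  have hae : ∀ᵐ a ∂μ, a ∈ K := by
    rw [← hμ]; exact ae_restrict_mem hmK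
  refine hasFDerivAt_integral_of_dominated_of_fderiv_le (bound := fun _ => C + 1)
    (F := fun x a => F (x, ι a))
    (F' := fun x a => (fderiv 𝕜 F (x, ι a)).comp (ContinuousLinearMap.inl 𝕜 E W))
    hset ?_ ?_ ?_ ?_ (integrable_const _) ?_
  · filter_upwards [hH.mem_nhds hx₀] with x hx
    rw [← hμ]
    exact (hcont x hx).aestronglyMeasurable_of_isCompact hK hmK
  · rw [← hμ]
    exact (hcont x₀ hx₀).integrableOn_compact hK
  · rw [← hμ]
    exact hcont'.aestronglyMeasurable_of_isCompact hK hmK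
  · filter_upwards [hae] with a ha x hx using hx.1 a ha
  · filter_upwards [hae] with a ha x hx
    have h1 := ((hF x hx.2 a ha).differentiableAt (by norm_num)).hasFDerivAt
    have h2 : HasFDerivAt (fun x : E => (x, ι a)) (ContinuousLinearMap.inl 𝕜 E W) x :=
      hasFDerivAt_prodMk_left x (ι a)
    exact h1.comp x h2

theorem contDiffOn_integral_of_isCompact {𝕜 α W : Type*} {E G : Type} [RCLike 𝕜]
    [NormedAddCommGroup E] [NormedSpace 𝕜 E] [NormedAddCommGroup W] [NormedSpace 𝕜 W]
    [NormedAddCommGroup G] [NormedSpace ℝ G] [NormedSpace 𝕜 G] [SMulCommClass ℝ 𝕜 G]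
    [TopologicalSpace α] [MeasurableSpace α] [BorelSpace α] [T2Space α]
    [SecondCountableTopology α]
    {μ : Measure α} [IsFiniteMeasure μ] {K : Set α} (hK : IsCompact K) (hμ : μ.restrict K = μ)
    {ι : α → W} (hι : Continuous ι) {H : Set E} (hH : IsOpen H) (n : ℕ) {F : E × W → G}
    (hF : ∀ x ∈ H, ∀ a ∈ K, ContDiffAt 𝕜 n F (x, ι a)) :
    ContDiffOn 𝕜 n (fun x => ∫ a, F (x, ι a) ∂μ) H := by
  induction n generalizing G with
  | zero =>
    have hmK : MeasurableSet K := hK.measurableSet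
    rw [Nat.cast_zero, contDiffOn_zero]
    intro x₀ hx₀
    apply ContinuousAt.continuousWithinAt
    have hc : ∀ x ∈ H, ∀ a ∈ K, ContinuousAt F (x, ι a) := fun x hx a ha =>
      (hF x hx a ha).continuousAt
    have hcont : ∀ x ∈ H, ContinuousOn (fun a => F (x, ι a)) K := fun x hx a ha =>
      ((hc x hx a ha).comp (f := fun a => (x, ι a)) (by fun_prop)).continuousWithinAt
    have hae : ∀ᵐ a ∂μ, a ∈ K := by
      rw [← hμ]; exact ae_restrict_mem hmK
    obtain ⟨C, hC⟩ := hK.exists_bound_of_continuousOn (hcont x₀ hx₀)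
    have hnear : ∀ᶠ x in 𝓝 x₀, ∀ a ∈ K, ‖F (x, ι a)‖ ≤ C + 1 := by
      apply hK.eventually_forall_of_forall_eventually
      intro a ha
      have h1 : ContinuousAt (fun z : E × α => ‖F (z.1, ι z.2)‖) (x₀, a) :=
        ((hc x₀ hx₀ a ha).comp (f := fun z : E × α => (z.1, ι z.2)) (x := (x₀, a))
          (by fun_prop)).norm
      exact (h1.eventually (gt_mem_nhds (lt_of_le_of_lt (hC a ha) (lt_add_one C)))).mono
        fun z hz => le_of_lt hz
    refine continuousAt_of_dominated (bound := fun _ => C + 1) ?_ ?_ (integrable_const _) ?_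
    · filter_upwards [hH.mem_nhds hx₀] with x hx
      rw [← hμ]
      exact (hcont x hx).aestronglyMeasurable_of_isCompact hK hmK
    · filter_upwards [hnear] with x hx
      filter_upwards [hae] with a ha using hx a ha
    · filter_upwards [hae] with a ha
      exact (hc x₀ hx₀ a ha).comp (f := fun x => (x, ι a)) (by fun_prop)
  | succ n ih =>
    have h1 : ∀ x ∈ H, ∀ a ∈ K, ContDiffAt 𝕜 1 F (x, ι a) := fun x hx a ha =>
      (hF x hx a ha).of_le (by norm_cast; omega)
    have hder := fun x (hx : x ∈ H) => hasFDerivAt_integral_of_isCompact hK hμ hι hH h1 hx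
    rw [Nat.cast_add, Nat.cast_one, contDiffOn_succ_iff_fderiv_of_isOpen hH]
    refine ⟨fun x hx => (hder x hx).differentiableAt.differentiableWithinAt, by simp, ?_⟩
    have := ih (F := fun p => (fderiv 𝕜 F p).comp (ContinuousLinearMap.inl 𝕜 E W))
      (fun x hx a ha => by
        have h2 : ContDiffAt 𝕜 n (fderiv 𝕜 F) (x, ι a) :=
          (hF x hx a ha).fderiv_right (by norm_cast)
        exact h2.clm_comp contDiffAt_const)
    exact this.congr fun x hx => (hder x hx).fderiv

/-! ### The arcsine-type beta law and its integration by parts formula -/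

/-- The beta law with both parameters equal to `1/4`. -/
def betaQ : Measure ℝ := ProbabilityTheory.betaMeasure (1 / 4) (1 / 4)

instance : IsProbabilityMeasure betaQ :=
  ProbabilityTheory.isProbabilityMeasureBeta (by norm_num) (by norm_num)

theorem integral_betaQ (φ : ℝ → ℝ) :
    ∫ w, φ w ∂betaQ = ∫ w in Set.Ioo (0 : ℝ) 1,
      (1 / ProbabilityTheory.beta (1 / 4) (1 / 4)) * w ^ (-(3 / 4) : ℝ) *
        (1 - w) ^ (-(3 / 4) : ℝ) * φ w := by
  unfold betaQ ProbabilityTheory.betaMeasure ProbabilityTheory.betaPDF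
  rw [integral_withDensity_eq_integral_toReal_smul (by fun_prop) (by simp),
    ← integral_indicator measurableSet_Ioo]
  congr 1
  ext w
  by_cases hw : w ∈ Set.Ioo (0 : ℝ) 1
  · have hpos := ProbabilityTheory.betaPDFReal_pos (α := 1 / 4) (β := 1 / 4) hw.1 hw.2
      (by norm_num) (by norm_num)
    rw [Set.indicator_of_mem hw, ENNReal.toReal_ofReal hpos.le, ProbabilityTheory.betaPDFReal,
      if_pos (show 0 < w ∧ w < 1 from hw), smul_eq_mul]
    norm_num
  · rw [Set.indicator_of_notMem hw, ProbabilityTheory.betaPDFReal,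
      if_neg (show ¬(0 < w ∧ w < 1) from hw)]
    simp

theorem betaQ_restrict_Icc : betaQ.restrict (Set.Icc 0 1) = betaQ := by
  apply Measure.restrict_eq_self_of_ae_mem
  rw [ae_iff]
  unfold betaQ ProbabilityTheory.betaMeasure
  have hm : MeasurableSet {a : ℝ | a ∉ Set.Icc (0 : ℝ) 1} := measurableSet_Icc.compl
  rw [withDensity_apply _ hm]
  apply setLIntegral_eq_zero hm
  intro w hw
  simp only [Set.mem_ofPred_eq, Set.mem_Icc, not_and_or, not_le] at hw
  rcases hw with hw | hw
  · exact ProbabilityTheory.betaPDF_eq_zero_of_nonpos hw.le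
  · exact ProbabilityTheory.betaPDF_eq_zero_of_one_le hw.le

theorem integral_betaQ_stein {φ φ' : ℝ → ℝ} (hφ : ∀ w ∈ Set.Icc (0 : ℝ) 1, HasDerivAt φ (φ' w) w)
    (hφ' : ContinuousOn φ' (Set.Icc 0 1)) :
    ∫ w, (w * (1 - w) * φ' w + 1 / 4 * (1 - 2 * w) * φ w) ∂betaQ = 0 := by
  have hφc : ContinuousOn φ (Set.Icc 0 1) := fun w hw => (hφ w hw).continuousAt.continuousWithinAt
  rw [integral_betaQ]
  set c := 1 / ProbabilityTheory.beta (1 / 4) (1 / 4)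
  set ψ : ℝ → ℝ := fun w => w * (1 - w) * φ' w + 1 / 4 * (1 - 2 * w) * φ w with hψ
  have hψc : ContinuousOn ψ (Set.Icc 0 1) := by fun_prop
  have hint : IntervalIntegrable
      (fun w => c * w ^ (-(3 / 4) : ℝ) * (1 - w) ^ (-(3 / 4) : ℝ) * ψ w) volume 0 1 := by
    have h1 : IntegrableOn ψ (Set.Icc 0 1) betaQ := by
      have := hψc.integrableOn_compact (μ := betaQ) isCompact_Icc
      exact this
    rw [IntegrableOn, betaQ_restrict_Icc, betaQ, ProbabilityTheory.betaMeasure] at h1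
    unfold ProbabilityTheory.betaPDF at h1
    rw [integrable_withDensity_iff (by fun_prop) (by simp)] at h1
    rw [intervalIntegrable_iff_integrableOn_Ioo_of_le zero_le_one]
    refine (h1.integrableOn (s := Set.Ioo 0 1)).congr_fun (fun w hw => ?_) measurableSet_Ioo
    have hpos := ProbabilityTheory.betaPDFReal_pos (α := 1 / 4) (β := 1 / 4) hw.1 hw.2
      (by norm_num) (by norm_num)
    simp only
    rw [ENNReal.toReal_ofReal hpos.le, ProbabilityTheory.betaPDFReal,
      if_pos (show 0 < w ∧ w < 1 from hw)]
    norm_num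
    ring
  have key := intervalIntegral.integral_eq_sub_of_hasDerivAt_of_le (a := 0) (b := 1) zero_le_one
    (f := fun w => c * w ^ (1 / 4 : ℝ) * (1 - w) ^ (1 / 4 : ℝ) * φ w)
    (f' := fun w => c * w ^ (-(3 / 4) : ℝ) * (1 - w) ^ (-(3 / 4) : ℝ) * ψ w) ?_ ?_ hint
  · rw [intervalIntegral.integral_of_le zero_le_one, integral_Ioc_eq_integral_Ioo] at key
    rw [key]
    norm_num
  · have h1 : Continuous fun w : ℝ => w ^ (1 / 4 : ℝ) :=
      Real.continuous_rpow_const (by norm_num)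
    have h2 : Continuous fun w : ℝ => (1 - w) ^ (1 / 4 : ℝ) :=
      h1.comp (by fun_prop : Continuous fun w : ℝ => 1 - w)
    fun_prop
  · intro w hw
    have h0 : w ≠ 0 := hw.1.ne'
    have h1 : 1 - w ≠ 0 := (sub_pos.2 hw.2).ne'
    have d1 : HasDerivAt (fun w : ℝ => w ^ (1 / 4 : ℝ)) _ w :=
      Real.hasDerivAt_rpow_const (Or.inl h0)
    have d2 : HasDerivAt (fun w : ℝ => (1 - w) ^ (1 / 4 : ℝ)) _ w :=
      ((hasDerivAt_id w).const_sub 1).rpow_const (Or.inl h1)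
    have d := ((d1.const_mul c).mul d2).mul (hφ w (Set.Ioo_subset_Icc_self hw))
    refine d.congr_deriv ?_
    have e1 : w ^ (1 / 4 : ℝ) = w * w ^ (-(3 / 4) : ℝ) := by
      rw [← Real.rpow_one_add' hw.1.le (by norm_num)]; norm_num
    have e2 : (1 - w) ^ (1 / 4 : ℝ) = (1 - w) * (1 - w) ^ (-(3 / 4) : ℝ) := by
      rw [← Real.rpow_one_add' (sub_pos.2 hw.2).le (by norm_num)]; norm_num
    simp only [hψ, id, Pi.mul_apply]
    rw [e1, e2, show (1 / 4 : ℝ) - 1 = -(3 / 4) by norm_num]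
    ring

/-- The product of `n` copies of `betaQ`. -/
def betaQPi (n : ℕ) : Measure (Fin n → ℝ) := Measure.pi fun _ => betaQ

instance (n : ℕ) : IsProbabilityMeasure (betaQPi n) := by unfold betaQPi; infer_instance

/-- The closed unit cube. -/
def unitCube (n : ℕ) : Set (Fin n → ℝ) := Set.univ.pi fun _ => Set.Icc (0 : ℝ) 1

theorem isCompact_unitCube (n : ℕ) : IsCompact (unitCube n) :=
  isCompact_univ_pi fun _ => isCompact_Icc

theorem betaQPi_restrict (n : ℕ) : (betaQPi n).restrict (unitCube n) = betaQPi n := by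
  unfold betaQPi unitCube
  rw [Measure.restrict_pi_pi]
  simp_rw [betaQ_restrict_Icc]

theorem ae_mem_unitCube (n : ℕ) : ∀ᵐ w ∂betaQPi n, w ∈ unitCube n := by
  rw [← betaQPi_restrict]
  exact ae_restrict_mem (isCompact_unitCube n).measurableSet

theorem integrable_betaQPi {n : ℕ} {f : (Fin n → ℝ) → ℝ} (hf : ContinuousOn f (unitCube n)) :
    Integrable f (betaQPi n) := by
  rw [← betaQPi_restrict]
  exact hf.integrableOn_compact (isCompact_unitCube n)

theorem integral_betaQPi_tail {n : ℕ} (f : (Fin n → ℝ) → ℝ) :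
    ∫ w, f (Fin.tail w) ∂betaQPi (n + 1) = ∫ w, f w ∂betaQPi n := by
  have hmp := measurePreserving_piFinSuccAbove (fun _ : Fin (n + 1) => betaQ) 0
  have h2 : MeasurePreserving (fun w : Fin (n + 1) → ℝ => Fin.tail w)
      (betaQPi (n + 1)) (betaQPi n) := by
    have := (measurePreserving_snd (μ := betaQ) (ν := betaQPi n)).comp hmp
    exact this
  have h3 : (betaQPi (n + 1)).map (fun w : Fin (n + 1) → ℝ => Fin.tail w) = betaQPi n := h2.map_eq
  by_cases hf : AEStronglyMeasurable f (betaQPi n)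
  · rw [← h3] at hf ⊢
    exact (integral_map h2.measurable.aemeasurable hf).symm
  · have hf' : ¬ AEStronglyMeasurable (fun w => f (Fin.tail w)) (betaQPi (n + 1)) := by
      intro h
      apply hf
      have hsec : f = fun w' => (∫ s, f w' ∂betaQ) := by simp
      have h4 := (hmp.symm.aestronglyMeasurable_comp_iff
        (MeasurableEquiv.measurableEmbedding _)).2 h
      have h5 : AEStronglyMeasurable (fun p : ℝ × (Fin n → ℝ) => f p.2)
          (betaQ.prod (betaQPi n)) := by
        have e : (fun p : ℝ × (Fin n → ℝ) => f p.2) = (fun w => f (Fin.tail w)) ∘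
            (MeasurableEquiv.piFinSuccAbove (fun _ : Fin (n + 1) => ℝ) 0).symm := by
          ext p
          simp [MeasurableEquiv.piFinSuccAbove_symm_apply, Fin.insertNthEquiv]
        rw [e]
        exact h4
      rw [hsec]
      exact h5.prod_swap.integral_prod_right'
    rw [integral_non_aestronglyMeasurable hf, integral_non_aestronglyMeasurable hf']

theorem integral_betaQPi_stein {n : ℕ} (r : Fin n) {φ φ' : (Fin n → ℝ) → ℝ}
    (hd : ∀ w ∈ unitCube n, HasDerivAt (fun s => φ (Function.update w r s)) (φ' w) (w r))
    (hφ : ContinuousOn φ (unitCube n)) (hφ' : ContinuousOn φ' (unitCube n)) :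
    ∫ w, (w r * (1 - w r) * φ' w + 1 / 4 * (1 - 2 * w r) * φ w) ∂betaQPi n = 0 := by
  obtain ⟨m, rfl⟩ : ∃ m, n = m + 1 := ⟨n - 1, by have := r.isLt; omega⟩
  have hmp := (measurePreserving_piFinSuccAbove (fun _ : Fin (m + 1) => betaQ) r).symm
  have hint : Integrable (fun w => w r * (1 - w r) * φ' w + 1 / 4 * (1 - 2 * w r) * φ w)
      (betaQPi (m + 1)) := by
    apply integrable_betaQPi
    fun_prop
  unfold betaQPi at hint ⊢
  rw [← hmp.integral_comp']
  rw [← hmp.integrable_comp_emb (MeasurableEquiv.measurableEmbedding _)] at hint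
  refine (integral_prod_symm _ hint).trans ?_
  apply integral_eq_zero_of_ae
  filter_upwards [ae_mem_unitCube m] with w' hw'
  have hmem : ∀ s ∈ Set.Icc (0 : ℝ) 1, r.insertNth (α := fun _ => ℝ) s w' ∈ unitCube (m + 1) := by
    intro s hs j _
    refine Fin.succAboveCases r ?_ (fun i => ?_) j
    · simpa using hs
    · simpa using hw' i trivial
  have := integral_betaQ_stein (φ := fun s => φ (r.insertNth (α := fun _ => ℝ) s w'))
    (φ' := fun s => φ' (r.insertNth (α := fun _ => ℝ) s w')) ?_ ?_
  · simpa [MeasurableEquiv.piFinSuccAbove_symm_apply, Fin.insertNthEquiv] using this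
  · intro s hs
    have h1 := hd _ (hmem s hs)
    simpa using h1
  · exact hφ'.comp (Continuous.continuousOn (by fun_prop)) (fun s hs => hmem s hs)

/-! ### Configurations of screened charges -/

/-- The charges carried by the three points of a pair: two endpoints and a screening charge. -/
def chg : Fin 3 → ℤ := ![1, 1, -2]

/-- The two endpoints of every pair together with the screening charge at relative position
`w r` between them. -/
def conf {𝕜 : Type*} [RCLike 𝕜] {N : ℕ} (a b w : Fin N → 𝕜) (r : Fin N) : Fin 3 → 𝕜 :=
  ![a r, b r, b r + (a r - b r) * w r]

/-- The logarithmic interaction energy between distinct pairs. -/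
def pairSum {𝕜 : Type*} [RCLike 𝕜] (lg : 𝕜 → 𝕜) {N : ℕ} (z : Fin N → Fin 3 → 𝕜) : 𝕜 :=
  ∑ r, ∑ s, if r < s then ∑ i, ∑ j, (chg i : 𝕜) * chg j * lg (z s j - z r i) else 0

theorem pairSum_succ {𝕜 : Type*} [RCLike 𝕜] (lg : 𝕜 → 𝕜) {n : ℕ}
    (z : Fin (n + 1) → Fin 3 → 𝕜) :
    pairSum lg z = (∑ s : Fin n, ∑ j, (chg j : 𝕜) *
      (lg (z s.succ j - z 0 0) + lg (z s.succ j - z 0 1) - 2 * lg (z s.succ j - z 0 2))) +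
      pairSum lg fun r => z r.succ := by
  unfold pairSum
  rw [Fin.sum_univ_succ]
  congr 1
  · rw [Fin.sum_univ_succ]
    simp only [lt_irrefl, if_false, zero_add, Fin.succ_pos, if_true]
    refine Finset.sum_congr rfl fun s _ => ?_
    rw [Finset.sum_comm]
    refine Finset.sum_congr rfl fun j _ => ?_
    simp [Fin.sum_univ_three, chg]
    ring
  · refine Finset.sum_congr rfl fun r _ => ?_
    rw [Fin.sum_univ_succ]
    simp

theorem ContDiffAt.pairSum {𝕜 : Type*} [RCLike 𝕜] {P : Type*} [NormedAddCommGroup P]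
    [NormedSpace 𝕜 P] {k : WithTop ℕ∞} {lg : 𝕜 → 𝕜} {N : ℕ} {z : P → Fin N → Fin 3 → 𝕜} {p : P}
    (hz : ∀ r i, ContDiffAt 𝕜 k (fun p => z p r i) p)
    (hlg : ∀ r s, r < s → ∀ i j, ContDiffAt 𝕜 k lg (z p s j - z p r i)) :
    ContDiffAt 𝕜 k (fun p => _root_.pairSum lg (z p)) p := by
  unfold _root_.pairSum
  refine ContDiffAt.sum fun r _ => ContDiffAt.sum fun s _ => ?_
  by_cases h : r < s
  · simp only [h, if_true]
    refine ContDiffAt.sum fun i _ => ContDiffAt.sum fun j _ => contDiffAt_const.mul ?_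
    exact (hlg r s h i j).comp p ((hz s j).sub (hz r i))
  · simp only [h, if_false]
    exact contDiffAt_const

/-- The pairs `(a r, b r)` are nonempty and follow each other from left to right. -/
def pairOrdered {n : ℕ} (a b : Fin n → ℝ) : Prop :=
  (∀ r, a r < b r) ∧ ∀ r s, r < s → b r < a s

theorem conf_mem {n : ℕ} {a b w : Fin n → ℝ} (h : pairOrdered a b) (hw : w ∈ unitCube n)
    (r : Fin n) (i : Fin 3) : conf a b w r i ∈ Set.Icc (a r) (b r) := by
  have h0 := h.1 r
  have hwr := hw r trivial
  simp only [Set.mem_Icc] at hwr ⊢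
  fin_cases i
  · simpa [conf] using h0.le
  · simpa [conf] using h0.le
  · change a r ≤ b r + (a r - b r) * w r ∧ b r + (a r - b r) * w r ≤ b r
    constructor <;> nlinarith

theorem conf_lt_conf {n : ℕ} {a b w : Fin n → ℝ} (h : pairOrdered a b) (hw : w ∈ unitCube n)
    {r s : Fin n} (hrs : r < s) (i j : Fin 3) : conf a b w r i < conf a b w s j :=
  ((conf_mem h hw r i).2.trans_lt (h.2 r s hrs)).trans_le (conf_mem h hw s j).1

/-- The normalized Coulomb gas integral. -/
def cgNorm {N : ℕ} (a b : Fin N → ℝ) : ℝ :=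
  ∫ w, Real.exp (3 / 8 * pairSum Real.log (conf a b w)) ∂betaQPi N

/-- The space of configurations of `n` pairs. -/
abbrev PairSpace (n : ℕ) : Type := (Fin n → ℝ) × (Fin n → ℝ)

/-- Configurations of `n` ordered pairs to the right of `0` and of the moving point `t`. -/
def region (n : ℕ) : Set (ℝ × PairSpace n) :=
  {p | pairOrdered p.2.1 p.2.2 ∧ ∀ r, 0 < p.2.1 r ∧ p.1 < p.2.1 r}

theorem isOpen_region (n : ℕ) : IsOpen (region n) := by
  have : region n = (⋂ r, {p : ℝ × PairSpace n | p.2.1 r < p.2.2 r}) ∩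
      (⋂ r, ⋂ s, ⋂ (_ : r < s), {p : ℝ × PairSpace n | p.2.2 r < p.2.1 s}) ∩
      (⋂ r, {p : ℝ × PairSpace n | 0 < p.2.1 r} ∩ {p : ℝ × PairSpace n | p.1 < p.2.1 r}) := by
    ext p
    simp [region, pairOrdered]
  rw [this]
  refine ((isOpen_iInter_of_finite fun r => isOpen_lt (by fun_prop) (by fun_prop)).inter
    (isOpen_iInter_of_finite fun r => isOpen_iInter_of_finite fun s =>
      isOpen_iInter_of_finite fun _ => isOpen_lt (by fun_prop) (by fun_prop))).inter
    (isOpen_iInter_of_finite fun r => (isOpen_lt (by fun_prop) (by fun_prop)).inter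
      (isOpen_lt (by fun_prop) (by fun_prop)))

/-- The first pair `(t, 0)` is adjoined on the left of the pairs `(a r, b r)`. -/
def confCons {𝕜 : Type*} [RCLike 𝕜] {n : ℕ} (t : 𝕜) (a b : Fin n → 𝕜) (w : Fin (n + 1) → 𝕜) :
    Fin (n + 1) → Fin 3 → 𝕜 :=
  conf (Fin.cons t a) (Fin.cons 0 b) w

theorem confCons_zero {𝕜 : Type*} [RCLike 𝕜] {n : ℕ} (t : 𝕜) (a b : Fin n → 𝕜)
    (w : Fin (n + 1) → 𝕜) : confCons t a b w 0 = ![t, 0, t * w 0] := by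
  simp [confCons, conf]

theorem confCons_succ {𝕜 : Type*} [RCLike 𝕜] {n : ℕ} (t : 𝕜) (a b : Fin n → 𝕜)
    (w : Fin (n + 1) → 𝕜) (r : Fin n) :
    confCons t a b w r.succ = conf a b (Fin.tail w) r := by
  simp [confCons, conf, Fin.tail]

theorem tail_mem_unitCube {n : ℕ} {w : Fin (n + 1) → ℝ} (hw : w ∈ unitCube (n + 1)) :
    Fin.tail w ∈ unitCube n := fun i _ => hw i.succ trivial

theorem conf_pos {n : ℕ} {p : ℝ × PairSpace n} (hp : p ∈ region n) {w : Fin n → ℝ}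
    (hw : w ∈ unitCube n) (r : Fin n) (i : Fin 3) : 0 < conf p.2.1 p.2.2 w r i :=
  (hp.2 r).1.trans_le (conf_mem hp.1 hw r i).1

theorem lt_conf {n : ℕ} {p : ℝ × PairSpace n} (hp : p ∈ region n) {w : Fin n → ℝ}
    (hw : w ∈ unitCube n) (r : Fin n) (i : Fin 3) : p.1 < conf p.2.1 p.2.2 w r i :=
  (hp.2 r).2.trans_le (conf_mem hp.1 hw r i).1

theorem mul_lt_of_mem_Icc {t z s : ℝ} (h0 : 0 < z) (ht : t < z) (hs : s ∈ Set.Icc (0 : ℝ) 1) :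
    t * s < z := by
  rcases le_total t 0 with h | h
  · exact (mul_nonpos_of_nonpos_of_nonneg h hs.1).trans_lt h0
  · exact (mul_le_of_le_one_right h hs.2).trans_lt ht

theorem confCons_lt {n : ℕ} {p : ℝ × PairSpace n} (hp : p ∈ region n) {w : Fin (n + 1) → ℝ}
    (hw : w ∈ unitCube (n + 1)) {r s : Fin (n + 1)} (hrs : r < s) (i j : Fin 3) :
    confCons p.1 p.2.1 p.2.2 w r i < confCons p.1 p.2.1 p.2.2 w s j := by
  have hw' := tail_mem_unitCube hw
  obtain ⟨s, rfl⟩ := Fin.exists_succ_eq.2 (Fin.ne_zero_of_lt hrs)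
  rw [confCons_succ]
  refine Fin.cases (fun hrs => ?_) (fun r hrs => ?_) r hrs
  · have h0 := conf_pos hp hw' s j
    have ht := lt_conf hp hw' s j
    rw [confCons_zero]
    fin_cases i
    · exact ht
    · exact h0
    · exact mul_lt_of_mem_Icc h0 ht (hw 0 trivial)
  · rw [confCons_succ]
    exact conf_lt_conf hp.1 hw' (Fin.succ_lt_succ_iff.1 hrs) i j

theorem contDiff_confCons {𝕜 : Type*} [RCLike 𝕜] {n : ℕ} {k : WithTop ℕ∞} {P : Type*}
    [NormedAddCommGroup P] [NormedSpace 𝕜 P] {t : P → 𝕜} {a b : P → Fin n → 𝕜}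
    {w : P → Fin (n + 1) → 𝕜} (ht : ContDiff 𝕜 k t) (ha : ContDiff 𝕜 k a) (hb : ContDiff 𝕜 k b)
    (hw : ContDiff 𝕜 k w) (r : Fin (n + 1)) (i : Fin 3) :
    ContDiff 𝕜 k fun p => confCons (t p) (a p) (b p) (w p) r i := by
  rw [contDiff_pi] at ha hb hw
  refine Fin.cases ?_ (fun r => ?_) r
  · simp only [confCons_zero]
    have h0 := hw 0
    fin_cases i
    · exact ht
    · exact contDiff_const
    · exact ht.mul h0
  · simp only [confCons_succ]
    have h1 := ha r
    have h2 := hb r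
    have h3 := hw r.succ
    fin_cases i
    · exact h1
    · exact h2
    · exact h2.add ((h1.sub h2).mul h3)

/-- The interaction energy as a function of the endpoints and of the screening charges. -/
def energy {n : ℕ} (P : (ℝ × PairSpace n) × (Fin (n + 1) → ℝ)) : ℝ :=
  pairSum Real.log (confCons P.1.1 P.1.2.1 P.1.2.2 P.2)

/-- The integrand of the normalized Coulomb gas integral. -/
def gas {n : ℕ} (P : (ℝ × PairSpace n) × (Fin (n + 1) → ℝ)) : ℝ :=
  Real.exp (3 / 8 * energy P)

theorem contDiffAt_energy {n : ℕ} {k : WithTop ℕ∞} {p : ℝ × PairSpace n} (hp : p ∈ region n)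
    {w : Fin (n + 1) → ℝ} (hw : w ∈ unitCube (n + 1)) : ContDiffAt ℝ k energy (p, w) := by
  unfold energy
  refine ContDiffAt.pairSum (fun r i => ?_) fun r s hrs i j => ?_
  · exact (contDiff_confCons (by fun_prop) (by fun_prop) (by fun_prop) (by fun_prop) r i).contDiffAt
  · exact Real.contDiffAt_log.2 (sub_pos.2 (confCons_lt hp hw hrs i j)).ne'

theorem contDiffAt_gas {n : ℕ} {k : WithTop ℕ∞} {p : ℝ × PairSpace n} (hp : p ∈ region n)
    {w : Fin (n + 1) → ℝ} (hw : w ∈ unitCube (n + 1)) : ContDiffAt ℝ k gas (p, w) :=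
  (contDiffAt_const.mul (contDiffAt_energy hp hw)).exp

/-- The normalized Coulomb gas integral with first pair `(t, 0)`. -/
def gasInt {n : ℕ} (p : ℝ × PairSpace n) : ℝ := ∫ w, gas (p, w) ∂betaQPi (n + 1)

theorem contDiffOn_gasInt {n : ℕ} (k : ℕ) : ContDiffOn ℝ k (gasInt (n := n)) (region n) :=
  contDiffOn_integral_of_isCompact (isCompact_unitCube _) (betaQPi_restrict _) continuous_id
    (isOpen_region n) k fun _ hp _ hw => contDiffAt_gas hp hw

theorem fderiv_integral_betaQPi {n : ℕ} {F : (ℝ × PairSpace n) × (Fin (n + 1) → ℝ) → ℝ}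
    (hF : ∀ p ∈ region n, ∀ w ∈ unitCube (n + 1), ContDiffAt ℝ 1 F (p, w))
    {p : ℝ × PairSpace n} (hp : p ∈ region n) (v : ℝ × PairSpace n) :
    fderiv ℝ (fun p => ∫ w, F (p, w) ∂betaQPi (n + 1)) p v =
      ∫ w, fderiv ℝ F (p, w) (v, 0) ∂betaQPi (n + 1) := by
  have h := hasFDerivAt_integral_of_isCompact (isCompact_unitCube _) (betaQPi_restrict _)
    continuous_id (isOpen_region n) hF hp
  simp only [id] at h
  rw [h.fderiv, ContinuousLinearMap.integral_apply]
  · simp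
  · rw [← betaQPi_restrict]
    refine ContinuousOn.integrableOn_compact (isCompact_unitCube _) (fun w hw => ?_)
    have : ContinuousAt (fderiv ℝ F) (p, w) :=
      ((hF p hp w hw).fderiv_right (m := 0) (by norm_num)).continuousAt
    exact ((this.comp (f := fun w => (p, w)) (by fun_prop)).clm_comp
      continuousAt_const).continuousWithinAt

/-! ### Derivatives of the interaction energy -/

/-- The sum of a function of the points of a configuration, weighted by the charges. -/
def chargeSum {n : ℕ} (φ : Fin n → Fin 3 → ℝ) : ℝ := ∑ s, ∑ j, (chg j : ℝ) * φ s j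

theorem chargeSum_add {n : ℕ} (φ ψ : Fin n → Fin 3 → ℝ) :
    chargeSum (fun s j => φ s j + ψ s j) = chargeSum φ + chargeSum ψ := by
  simp only [chargeSum, mul_add, Finset.sum_add_distrib]

theorem chargeSum_mul {n : ℕ} (k : ℝ) (φ : Fin n → Fin 3 → ℝ) :
    chargeSum (fun s j => k * φ s j) = k * chargeSum φ := by
  simp only [chargeSum, Finset.mul_sum]
  refine Finset.sum_congr rfl fun s _ => Finset.sum_congr rfl fun j _ => by ring

theorem HasDerivAt.chargeSum {n : ℕ} {φ : ℝ → Fin n → Fin 3 → ℝ} {φ' : Fin n → Fin 3 → ℝ} {e : ℝ}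
    (h : ∀ s j, HasDerivAt (fun ε => φ ε s j) (φ' s j) e) :
    HasDerivAt (fun ε => chargeSum (φ ε)) (_root_.chargeSum φ') e := by
  unfold _root_.chargeSum
  exact HasDerivAt.fun_sum fun s _ => HasDerivAt.fun_sum fun j _ => (h s j).const_mul _

theorem ContDiffAt.chargeSum {n : ℕ} {P : Type*} [NormedAddCommGroup P] [NormedSpace ℝ P]
    {k : WithTop ℕ∞} {φ : P → Fin n → Fin 3 → ℝ} {p : P}
    (h : ∀ s j, ContDiffAt ℝ k (fun p => φ p s j) p) :
    ContDiffAt ℝ k (fun p => _root_.chargeSum (φ p)) p := by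
  unfold _root_.chargeSum
  exact ContDiffAt.sum fun s _ => ContDiffAt.sum fun j _ => contDiffAt_const.mul (h s j)

theorem HasDerivAt.pairSum_log {N : ℕ} {z : ℝ → Fin N → Fin 3 → ℝ} {z' : Fin N → Fin 3 → ℝ} {e : ℝ}
    (hz : ∀ r i, HasDerivAt (fun ε => z ε r i) (z' r i) e)
    (hne : ∀ r s, r < s → ∀ i j, z e s j - z e r i ≠ 0) :
    HasDerivAt (fun ε => pairSum Real.log (z ε))
      (∑ r, ∑ s, if r < s then ∑ i, ∑ j, (chg i : ℝ) * chg j *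
        ((z' s j - z' r i) / (z e s j - z e r i)) else 0) e := by
  unfold pairSum
  refine HasDerivAt.fun_sum fun r _ => HasDerivAt.fun_sum fun s _ => ?_
  by_cases h : r < s
  · simp only [h, if_true]
    exact HasDerivAt.fun_sum fun i _ => HasDerivAt.fun_sum fun j _ =>
      (((hz s j).sub (hz r i)).log (hne r s h i j)).const_mul _
  · simp only [h, if_false]
    exact hasDerivAt_const _ _

theorem energy_eq {n : ℕ} (P : (ℝ × PairSpace n) × (Fin (n + 1) → ℝ)) :
    energy P = chargeSum (fun s j =>
      Real.log (conf P.1.2.1 P.1.2.2 (Fin.tail P.2) s j - P.1.1) +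
        Real.log (conf P.1.2.1 P.1.2.2 (Fin.tail P.2) s j) -
        2 * Real.log (conf P.1.2.1 P.1.2.2 (Fin.tail P.2) s j - P.1.1 * P.2 0)) +
      pairSum Real.log (conf P.1.2.1 P.1.2.2 (Fin.tail P.2)) := by
  simp [energy, pairSum_succ, confCons_zero, confCons_succ, chargeSum]

/-- The velocity of the points of a configuration. -/
def confVel {n : ℕ} (P d : (ℝ × PairSpace n) × (Fin (n + 1) → ℝ)) (r : Fin n) : Fin 3 → ℝ :=
  ![d.1.2.1 r, d.1.2.2 r, d.1.2.2 r + ((d.1.2.1 r - d.1.2.2 r) * P.2 r.succ +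
    (P.1.2.1 r - P.1.2.2 r) * d.2 r.succ)]

theorem hasDerivAt_conf {n : ℕ} (P d : (ℝ × PairSpace n) × (Fin (n + 1) → ℝ)) (r : Fin n)
    (i : Fin 3) : HasDerivAt (fun ε : ℝ => conf (P + ε • d).1.2.1 (P + ε • d).1.2.2
      (Fin.tail (P + ε • d).2) r i) (confVel P d r i) 0 := by
  have h : ∀ x y : ℝ, HasDerivAt (fun ε : ℝ => x + ε * y) y 0 := fun x y => by
    simpa using ((hasDerivAt_id (0 : ℝ)).mul_const y).const_add x
  have ha := h (P.1.2.1 r) (d.1.2.1 r)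
  have hb := h (P.1.2.2 r) (d.1.2.2 r)
  have hw := h (P.2 r.succ) (d.2 r.succ)
  fin_cases i
  · exact ha
  · exact hb
  · exact (hb.add ((ha.sub hb).mul hw)).congr_deriv (by simp [confVel])

theorem fderiv_energy {n : ℕ} {p : ℝ × PairSpace n} (hp : p ∈ region n)
    {w : Fin (n + 1) → ℝ} (hw : w ∈ unitCube (n + 1))
    (d : (ℝ × PairSpace n) × (Fin (n + 1) → ℝ)) :
    fderiv ℝ energy (p, w) d = chargeSum (fun s j =>
      (confVel (p, w) d s j - d.1.1) / (conf p.2.1 p.2.2 (Fin.tail w) s j - p.1) +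
        confVel (p, w) d s j / (conf p.2.1 p.2.2 (Fin.tail w) s j) -
        2 * ((confVel (p, w) d s j - (d.1.1 * w 0 + p.1 * d.2 0)) /
          (conf p.2.1 p.2.2 (Fin.tail w) s j - p.1 * w 0))) +
      ∑ r, ∑ s, if r < s then ∑ i, ∑ j, (chg i : ℝ) * chg j *
        ((confVel (p, w) d s j - confVel (p, w) d r i) /
          (conf p.2.1 p.2.2 (Fin.tail w) s j - conf p.2.1 p.2.2 (Fin.tail w) r i)) else 0 := by
  have hw' := tail_mem_unitCube hw
  have h1 := (((contDiffAt_energy (k := 1) hp hw).differentiableAt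
    (by norm_num)).hasFDerivAt.hasLineDerivAt d)
  refine h1.unique ?_
  have h : ∀ x y : ℝ, HasDerivAt (fun ε : ℝ => x + ε * y) y 0 := fun x y => by
    simpa using ((hasDerivAt_id (0 : ℝ)).mul_const y).const_add x
  have ht := h p.1 d.1.1
  have hw0 := h (w 0) (d.2 0)
  have hz := fun r i => hasDerivAt_conf (p, w) d r i
  have e0 : (p, w) + (0 : ℝ) • d = (p, w) := by simp
  unfold HasLineDerivAt
  simp only [energy_eq]
  have key := fun s j => (((hz s j).sub ht).log
      (by simpa using (sub_pos.2 (lt_conf hp hw' s j)).ne')).add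
      ((hz s j).log (by rw [e0]; simpa using (conf_pos hp hw' s j).ne')) |>.sub
      ((((hz s j).sub (ht.mul hw0)).log (by
        simpa using (sub_pos.2 (mul_lt_of_mem_Icc (conf_pos hp hw' s j) (lt_conf hp hw' s j)
          (hw 0 trivial))).ne')).const_mul 2)
  have key2 := HasDerivAt.pairSum_log hz (fun r s hrs i j => by
    rw [e0]; exact (sub_pos.2 (conf_lt_conf hp.1 hw' hrs i j)).ne')
  refine ((HasDerivAt.chargeSum key).add key2).congr_deriv ?_
  simp

/-- The reciprocal distance of a point of the configuration to the moving point `t`. -/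
def recT {n : ℕ} (P : (ℝ × PairSpace n) × (Fin (n + 1) → ℝ)) (s : Fin n) (j : Fin 3) : ℝ :=
  (conf P.1.2.1 P.1.2.2 (Fin.tail P.2) s j - P.1.1)⁻¹

/-- The reciprocal distance of a point of the configuration to the screening charge of the first
pair. -/
def recU {n : ℕ} (P : (ℝ × PairSpace n) × (Fin (n + 1) → ℝ)) (s : Fin n) (j : Fin 3) : ℝ :=
  (conf P.1.2.1 P.1.2.2 (Fin.tail P.2) s j - P.1.1 * P.2 0)⁻¹

/-- Charge-weighted mixed power sums of reciprocal distances. -/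
def moment {n : ℕ} (k l : ℕ) (P : (ℝ × PairSpace n) × (Fin (n + 1) → ℝ)) : ℝ :=
  chargeSum fun s j => recT P s j ^ k * recU P s j ^ l

section Point

variable {n : ℕ} {p : ℝ × PairSpace n} {w : Fin (n + 1) → ℝ}

theorem recT_ne (hp : p ∈ region n) (hw : w ∈ unitCube (n + 1)) (s : Fin n) (j : Fin 3) :
    conf p.2.1 p.2.2 (Fin.tail w) s j - p.1 ≠ 0 :=
  (sub_pos.2 (lt_conf hp (tail_mem_unitCube hw) s j)).ne'

theorem recU_ne (hp : p ∈ region n) (hw : w ∈ unitCube (n + 1)) (s : Fin n) (j : Fin 3) :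
    conf p.2.1 p.2.2 (Fin.tail w) s j - p.1 * w 0 ≠ 0 :=
  (sub_pos.2 (mul_lt_of_mem_Icc (conf_pos hp (tail_mem_unitCube hw) s j)
    (lt_conf hp (tail_mem_unitCube hw) s j) (hw 0 trivial))).ne'

theorem contDiff_conf {n : ℕ} {k : WithTop ℕ∞} (s : Fin n) (j : Fin 3) :
    ContDiff ℝ k fun P : (ℝ × PairSpace n) × (Fin (n + 1) → ℝ) =>
      conf P.1.2.1 P.1.2.2 (Fin.tail P.2) s j := by
  have := contDiff_confCons (k := k) (t := fun P : (ℝ × PairSpace n) × (Fin (n + 1) → ℝ) => P.1.1)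
    (a := fun P => P.1.2.1) (b := fun P => P.1.2.2) (w := fun P => P.2)
    (by fun_prop) (by fun_prop) (by fun_prop) (by fun_prop) s.succ j
  simpa only [confCons_succ] using this

theorem contDiffAt_recT {k : WithTop ℕ∞} (hp : p ∈ region n) (hw : w ∈ unitCube (n + 1))
    (s : Fin n) (j : Fin 3) : ContDiffAt ℝ k (fun P => recT P s j) (p, w) :=
  ((contDiff_conf s j).contDiffAt.sub (by fun_prop)).inv (recT_ne hp hw s j)

theorem contDiffAt_recU {k : WithTop ℕ∞} (hp : p ∈ region n) (hw : w ∈ unitCube (n + 1))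
    (s : Fin n) (j : Fin 3) : ContDiffAt ℝ k (fun P => recU P s j) (p, w) :=
  ((contDiff_conf s j).contDiffAt.sub (by fun_prop)).inv (recU_ne hp hw s j)

theorem contDiffAt_moment {m : WithTop ℕ∞} (k l : ℕ) (hp : p ∈ region n)
    (hw : w ∈ unitCube (n + 1)) : ContDiffAt ℝ m (moment k l) (p, w) :=
  ContDiffAt.chargeSum fun s j =>
    ((contDiffAt_recT hp hw s j).pow k).mul ((contDiffAt_recU hp hw s j).pow l)

theorem moment_sub_moment (k l : ℕ) (hp : p ∈ region n) (hw : w ∈ unitCube (n + 1)) :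
    moment (k + 1) l (p, w) = moment k (l + 1) (p, w) +
      p.1 * (1 - w 0) * moment (k + 1) (l + 1) (p, w) := by
  unfold moment
  rw [← chargeSum_mul, ← chargeSum_add]
  congr 1
  ext s j
  have h1 := recT_ne hp hw s j
  have h2 := recU_ne hp hw s j
  have h : recT (p, w) s j = recU (p, w) s j +
      p.1 * (1 - w 0) * (recT (p, w) s j * recU (p, w) s j) := by
    simp only [recT, recU]
    field_simp
    ring
  calc _ = recT (p, w) s j * (recT (p, w) s j ^ k * recU (p, w) s j ^ l) := by ring
    _ = (recU (p, w) s j + p.1 * (1 - w 0) * (recT (p, w) s j * recU (p, w) s j)) *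
      (recT (p, w) s j ^ k * recU (p, w) s j ^ l) := by rw [← h]
    _ = _ := by ring

theorem confVel_eq_zero {d : (ℝ × PairSpace n) × (Fin (n + 1) → ℝ)} (h1 : d.1.2 = 0)
    (h2 : ∀ r : Fin n, d.2 r.succ = 0) (s : Fin n) (j : Fin 3) : confVel (p, w) d s j = 0 := by
  fin_cases j <;> simp [confVel, h1, h2]

theorem fderiv_moment (k l : ℕ) (hp : p ∈ region n) (hw : w ∈ unitCube (n + 1))
    {d : (ℝ × PairSpace n) × (Fin (n + 1) → ℝ)} (h1 : d.1.2 = 0)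
    (h2 : ∀ r : Fin n, d.2 r.succ = 0) :
    fderiv ℝ (moment k l) (p, w) d = k * d.1.1 * moment (k + 1) l (p, w) +
      l * (d.1.1 * w 0 + p.1 * d.2 0) * moment k (l + 1) (p, w) := by
  have hl := (((contDiffAt_moment (m := 1) k l hp hw).differentiableAt
    (by norm_num)).hasFDerivAt.hasLineDerivAt d)
  refine hl.unique ?_
  have h : ∀ x y : ℝ, HasDerivAt (fun ε : ℝ => x + ε * y) y 0 := fun x y => by
    simpa using ((hasDerivAt_id (0 : ℝ)).mul_const y).const_add x
  have ht := h p.1 d.1.1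
  have hw0 := h (w 0) (d.2 0)
  have hz := fun r i => (hasDerivAt_conf (p, w) d r i).congr_deriv (confVel_eq_zero h1 h2 r i)
  have hT : ∀ s j, HasDerivAt (fun ε : ℝ => recT ((p, w) + ε • d) s j)
      (d.1.1 * recT (p, w) s j ^ 2) 0 := fun s j => by
    refine (((hz s j).sub ht).inv (by simpa using recT_ne hp hw s j)).congr_deriv ?_
    simp [recT, div_eq_mul_inv]
  have hU : ∀ s j, HasDerivAt (fun ε : ℝ => recU ((p, w) + ε • d) s j)
      ((d.1.1 * w 0 + p.1 * d.2 0) * recU (p, w) s j ^ 2) 0 := fun s j => by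
    refine (((hz s j).sub (ht.mul hw0)).inv (by simpa using recU_ne hp hw s j)).congr_deriv ?_
    simp [recU, div_eq_mul_inv]
  have hpow : ∀ (m : ℕ) (x : ℝ), m * x ^ (m - 1) * x ^ 2 = m * x ^ (m + 1) := by
    intro m x
    rcases m with _ | m
    · simp
    · simp only [Nat.add_sub_cancel]; ring
  have e0 : (p, w) + (0 : ℝ) • d = (p, w) := by simp
  unfold HasLineDerivAt moment
  refine (HasDerivAt.chargeSum fun s j => ((hT s j).pow k).mul ((hU s j).pow l)).congr_deriv ?_
  rw [← chargeSum_mul, ← chargeSum_mul, ← chargeSum_add]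
  congr 1
  ext s j
  simp only [Pi.pow_apply, e0]
  linear_combination d.1.1 * recU (p, w) s j ^ l * hpow k (recT (p, w) s j) +
    (d.1.1 * w 0 + p.1 * d.2 0) * recT (p, w) s j ^ k * hpow l (recU (p, w) s j)

theorem fderiv_gas (hp : p ∈ region n) (hw : w ∈ unitCube (n + 1))
    (d : (ℝ × PairSpace n) × (Fin (n + 1) → ℝ)) :
    fderiv ℝ gas (p, w) d = 3 / 8 * fderiv ℝ energy (p, w) d * gas (p, w) := by
  have h := ((contDiffAt_energy (k := 1) hp hw).differentiableAt (by norm_num)).hasFDerivAt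
  have h2 := (h.const_mul (3 / 8)).exp
  unfold gas
  rw [h2.fderiv]
  simp
  ring

theorem fderiv_energy_of_eq_zero (hp : p ∈ region n) (hw : w ∈ unitCube (n + 1))
    {d : (ℝ × PairSpace n) × (Fin (n + 1) → ℝ)} (h1 : d.1.2 = 0)
    (h2 : ∀ r : Fin n, d.2 r.succ = 0) :
    fderiv ℝ energy (p, w) d = -(d.1.1 * moment 1 0 (p, w)) +
      2 * (d.1.1 * w 0 + p.1 * d.2 0) * moment 0 1 (p, w) := by
  rw [fderiv_energy hp hw]
  simp only [confVel_eq_zero h1 h2]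
  simp only [sub_self, zero_div, mul_zero, Finset.sum_const_zero, ite_self, add_zero]
  rw [← neg_mul]
  unfold moment
  rw [← chargeSum_mul, ← chargeSum_mul, ← chargeSum_add]
  congr 1
  ext s j
  simp only [recT, recU, pow_zero, pow_one, div_eq_mul_inv]
  ring

/-- The total charge-weighted reciprocal distance of a pair. -/
def pairRec (P : (ℝ × PairSpace n) × (Fin (n + 1) → ℝ)) (s : Fin n) : ℝ :=
  ∑ j, (chg j : ℝ) * recT P s j

/-- The vector field along which the endpoints are transported. -/
def drift (p : ℝ × PairSpace n) : PairSpace n :=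
  (fun r => p.2.1 r / (p.2.1 r - p.1), fun r => p.2.2 r / (p.2.2 r - p.1))

/-- The weight in the integration by parts over the screening charge of a pair. -/
def screenWeight (r : Fin n) (P : (ℝ × PairSpace n) × (Fin (n + 1) → ℝ)) : ℝ :=
  2 * P.1.1 * (P.1.2.1 r - P.1.2.2 r) * recT P r 0 * recT P r 1 * recT P r 2

/-- The velocity of the screening charges. -/
def screenVel (P : (ℝ × PairSpace n) × (Fin (n + 1) → ℝ)) : Fin (n + 1) → ℝ :=
  Fin.cons 0 fun r => -(1 / 2) * (P.2 r.succ * (1 - P.2 r.succ)) * screenWeight r P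

theorem confVel_drift (hp : p ∈ region n) (hw : w ∈ unitCube (n + 1)) (s : Fin n) (j : Fin 3) :
    confVel (p, w) ((0, drift p), screenVel (p, w)) s j = 1 + p.1 * recT (p, w) s j := by
  have h0 := recT_ne hp hw s 0
  have h1 := recT_ne hp hw s 1
  have h2 := recT_ne hp hw s 2
  simp only [conf, Matrix.cons_val, Fin.tail] at h0 h1 h2
  fin_cases j
  · simp only [confVel, drift, recT, conf, Fin.zero_eta, Matrix.cons_val]
    field_simp
    ring
  · simp only [confVel, drift, recT, conf, Fin.mk_one, Matrix.cons_val]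
    field_simp
    ring
  · simp only [confVel, drift, recT, conf, Fin.reduceFinMk, Matrix.cons_val, screenVel,
      screenWeight, Fin.cons_succ, Fin.tail]
    generalize hD : p.2.2 s + (p.2.1 s - p.2.2 s) * w s.succ - p.1 = D at h2 ⊢
    field_simp
    simp only [← hD]
    ring

theorem fderiv_energy_drift (hp : p ∈ region n) (hw : w ∈ unitCube (n + 1)) :
    fderiv ℝ energy (p, w) ((0, drift p), screenVel (p, w)) =
      p.1 * moment 2 0 (p, w) - 2 * p.1 * w 0 * moment 1 1 (p, w) -
        p.1 * ∑ r, ∑ s, if r < s then pairRec (p, w) r * pairRec (p, w) s else 0 := by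
  rw [fderiv_energy hp hw]
  simp only [confVel_drift hp hw]
  rw [sub_eq_add_neg, ← mul_neg]
  congr 1
  · rw [sub_eq_add_neg, ← neg_mul]
    unfold moment
    rw [← chargeSum_mul, ← chargeSum_mul, ← chargeSum_add]
    congr 1
    ext s j
    have h1 := recT_ne hp hw s j
    have h2 := recU_ne hp hw s j
    have h3 := (conf_pos hp (tail_mem_unitCube hw) s j).ne'
    simp only [recT, recU, screenVel, Fin.cons_zero]
    field_simp
    ring
  · rw [← Finset.sum_neg_distrib, Finset.mul_sum]
    refine Finset.sum_congr rfl fun r _ => ?_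
    rw [← Finset.sum_neg_distrib, Finset.mul_sum]
    refine Finset.sum_congr rfl fun s _ => ?_
    split_ifs with hrs
    · simp only [pairRec, Finset.sum_mul_sum]
      rw [← Finset.sum_neg_distrib, Finset.mul_sum]
      refine Finset.sum_congr rfl fun i _ => ?_
      rw [← Finset.sum_neg_distrib, Finset.mul_sum]
      refine Finset.sum_congr rfl fun j _ => ?_
      have h1 := recT_ne hp hw s j
      have h2 := recT_ne hp hw r i
      have h3 := (sub_pos.2 (conf_lt_conf hp.1 (tail_mem_unitCube hw) hrs i j)).ne'
      simp only [recT]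
      field_simp
      ring
    · simp

/-- The integrated weight of the integration by parts over the screening charge of a pair. -/
def screenBracket (P : (ℝ × PairSpace n) × (Fin (n + 1) → ℝ)) (r : Fin n) : ℝ :=
  P.1.1 * (3 / 8 * pairRec P r ^ 2 - 1 / 8 * (recT P r 0 - recT P r 1) ^ 2 -
    1 / 4 * ∑ j, (chg j : ℝ) * recT P r j ^ 2)

theorem contDiffAt_screenWeight {k : WithTop ℕ∞} (r : Fin n) (hp : p ∈ region n)
    (hw : w ∈ unitCube (n + 1)) : ContDiffAt ℝ k (screenWeight r) (p, w) := by
  have h0 := contDiffAt_recT (k := k) hp hw r 0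
  have h1 := contDiffAt_recT (k := k) hp hw r 1
  have h2 := contDiffAt_recT (k := k) hp hw r 2
  unfold screenWeight
  fun_prop

theorem fderiv_screenWeight (r : Fin n) (hp : p ∈ region n) (hw : w ∈ unitCube (n + 1)) :
    fderiv ℝ (screenWeight r) (p, w) (0, Pi.single r.succ 1) =
      -(2 * p.1 * (p.2.1 r - p.2.2 r) ^ 2 * recT (p, w) r 0 * recT (p, w) r 1 *
        recT (p, w) r 2 ^ 2) := by
  have hl := (((contDiffAt_screenWeight (k := 1) r hp hw).differentiableAt
    (by norm_num)).hasFDerivAt.hasLineDerivAt (0, Pi.single r.succ 1))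
  refine hl.unique ?_
  have h2 := recT_ne hp hw r 2
  have hv : confVel (p, w) (0, Pi.single r.succ 1) r 2 = p.2.1 r - p.2.2 r := by
    simp [confVel]
  have hz := (hasDerivAt_conf (p, w) (0, Pi.single r.succ 1) r 2).congr_deriv hv
  have hT : HasDerivAt (fun ε : ℝ => recT ((p, w) + ε • (0, Pi.single r.succ 1)) r 2)
      (-((p.2.1 r - p.2.2 r) * recT (p, w) r 2 ^ 2)) 0 := by
    refine (((hz.sub (hasDerivAt_const 0 p.1)).inv (by simpa using h2)).congr_deriv
      ?_).congr_of_eventuallyEq ?_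
    · simp [recT, div_eq_mul_inv]
      ring
    · refine Filter.Eventually.of_forall fun ε => ?_
      simp [recT]
  have e := hT.const_mul (2 * p.1 * (p.2.1 r - p.2.2 r) * recT (p, w) r 0 * recT (p, w) r 1)
  refine (e.congr_deriv (by ring)).congr_of_eventuallyEq (Filter.Eventually.of_forall fun ε => ?_)
  simp [screenWeight, recT, conf]

theorem screenBracket_eq (r : Fin n) (hp : p ∈ region n) (hw : w ∈ unitCube (n + 1)) :
    w r.succ * (1 - w r.succ) * fderiv ℝ (screenWeight r) (p, w) (0, Pi.single r.succ 1) +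
      1 / 4 * (1 - 2 * w r.succ) * screenWeight r (p, w) = screenBracket (p, w) r := by
  rw [fderiv_screenWeight r hp hw]
  have h0 := recT_ne hp hw r 0
  have h1 := recT_ne hp hw r 1
  have h2 := recT_ne hp hw r 2
  simp only [conf, Matrix.cons_val, Fin.tail] at h0 h1 h2
  simp only [screenBracket, screenWeight, pairRec, Fin.sum_univ_three, recT, conf, chg,
    Matrix.cons_val, Fin.tail]
  generalize hD : p.2.2 r + (p.2.1 r - p.2.2 r) * w r.succ - p.1 = D at h2 ⊢
  push_cast
  field_simp
  simp only [← hD]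
  ring

theorem sum_pairRec_mul : ∑ r, ∑ s, (if r < s then pairRec (p, w) r * pairRec (p, w) s else 0) =
    1 / 2 * (moment 1 0 (p, w) ^ 2 - ∑ r, pairRec (p, w) r ^ 2) := by
  have h1 : moment 1 0 (p, w) = ∑ r, pairRec (p, w) r := by
    simp [moment, chargeSum, pairRec]
  have h2 : (∑ r, ∑ s, (if r < s then pairRec (p, w) r * pairRec (p, w) s else 0)) =
      ∑ r, ∑ s, (if s < r then pairRec (p, w) r * pairRec (p, w) s else 0) := by
    rw [Finset.sum_comm]
    refine Finset.sum_congr rfl fun r _ => Finset.sum_congr rfl fun s _ => ?_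
    rw [mul_comm]
  have h3 : (∑ r, pairRec (p, w) r ^ 2) =
      ∑ r, ∑ s, (if r = s then pairRec (p, w) r * pairRec (p, w) s else 0) := by
    refine Finset.sum_congr rfl fun r _ => ?_
    simp [sq]
  have h4 : moment 1 0 (p, w) ^ 2 =
      ∑ r, ∑ s, (if r < s then pairRec (p, w) r * pairRec (p, w) s else 0) +
      ∑ r, ∑ s, (if s < r then pairRec (p, w) r * pairRec (p, w) s else 0) +
      ∑ r, ∑ s, (if r = s then pairRec (p, w) r * pairRec (p, w) s else 0) := by
    rw [h1, sq, Finset.sum_mul_sum, ← Finset.sum_add_distrib, ← Finset.sum_add_distrib]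
    refine Finset.sum_congr rfl fun r _ => ?_
    rw [← Finset.sum_add_distrib, ← Finset.sum_add_distrib]
    refine Finset.sum_congr rfl fun s _ => ?_
    rcases lt_trichotomy r s with h | h | h
    · simp [h, h.not_gt, h.ne]
    · simp [h]
    · simp [h, h.not_gt, h.ne']
  linarith

end Point

/-! ### The differential equation for the Coulomb gas integral -/

theorem integral_betaQPi_stein_fderiv {n : ℕ} (r : Fin n) {φ : (Fin n → ℝ) → ℝ}
    (hφ : ∀ w ∈ unitCube n, ContDiffAt ℝ 1 φ w) :
    ∫ w, (w r * (1 - w r) * fderiv ℝ φ w (Pi.single r 1) + 1 / 4 * (1 - 2 * w r) * φ w)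
      ∂betaQPi n = 0 := by
  refine integral_betaQPi_stein r (fun w hw => ?_)
    (fun w hw => (hφ w hw).continuousAt.continuousWithinAt) (fun w hw => ?_)
  · have h1 := ((hφ w hw).differentiableAt (by norm_num)).hasFDerivAt
    have h2 : HasDerivAt (fun s => Function.update w r s) (Pi.single r 1) (w r) :=
      hasDerivAt_update w r (w r)
    have h3 : Function.update w r (w r) = w := Function.update_eq_self r w
    have h4 : HasFDerivAt φ (fderiv ℝ φ w) (Function.update w r (w r)) := by rwa [h3]
    exact h4.comp_hasDerivAt (w r) h2
  · have : ContinuousAt (fderiv ℝ φ) w :=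
      ((hφ w hw).fderiv_right (m := 0) (by norm_num)).continuousAt
    exact (this.clm_apply continuousAt_const).continuousWithinAt

section Point

variable {n : ℕ} {p : ℝ × PairSpace n} {w : Fin (n + 1) → ℝ}

theorem fderiv_slice {F : (ℝ × PairSpace n) × (Fin (n + 1) → ℝ) → ℝ}
    (hF : ContDiffAt ℝ 1 F (p, w)) (v : Fin (n + 1) → ℝ) :
    fderiv ℝ (fun w => F (p, w)) w v = fderiv ℝ F (p, w) (0, v) := by
  have h1 := (hF.differentiableAt (by norm_num)).hasFDerivAt
  have h2 := h1.comp w (hasFDerivAt_prodMk_right p w)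
  have h3 : fderiv ℝ (fun w => F (p, w)) w = _ := h2.fderiv
  rw [h3]
  simp

theorem fderiv_mul_apply {F G : (ℝ × PairSpace n) × (Fin (n + 1) → ℝ) → ℝ}
    (hF : ContDiffAt ℝ 1 F (p, w)) (hG : ContDiffAt ℝ 1 G (p, w))
    (d : (ℝ × PairSpace n) × (Fin (n + 1) → ℝ)) :
    fderiv ℝ (fun P => F P * G P) (p, w) d =
      fderiv ℝ F (p, w) d * G (p, w) + F (p, w) * fderiv ℝ G (p, w) d := by
  rw [fderiv_fun_mul (hF.differentiableAt (by norm_num)) (hG.differentiableAt (by norm_num))]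
  simp
  ring

/-- The derivative of the integrand in the moving point. -/
def gasT (P : (ℝ × PairSpace n) × (Fin (n + 1) → ℝ)) : ℝ := fderiv ℝ gas P ((1, 0), 0)

theorem contDiffAt_gasT {k : ℕ} (hp : p ∈ region n) (hw : w ∈ unitCube (n + 1)) :
    ContDiffAt ℝ k gasT (p, w) :=
  ((contDiffAt_gas (k := (k + 1 : ℕ)) hp hw).fderiv_right (by norm_num)).clm_apply contDiffAt_const

theorem gasT_eq (hp : p ∈ region n) (hw : w ∈ unitCube (n + 1)) :
    gasT (p, w) = 3 / 8 * (-moment 1 0 (p, w) + 2 * w 0 * moment 0 1 (p, w)) * gas (p, w) := by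
  rw [gasT, fderiv_gas hp hw, fderiv_energy_of_eq_zero hp hw rfl (fun _ => rfl)]
  simp

theorem fderiv_gasT (hp : p ∈ region n) (hw : w ∈ unitCube (n + 1)) :
    fderiv ℝ gasT (p, w) ((1, 0), 0) =
      (3 / 8 * (-moment 2 0 (p, w) + 2 * w 0 ^ 2 * moment 0 2 (p, w)) +
      (3 / 8 * (-moment 1 0 (p, w) + 2 * w 0 * moment 0 1 (p, w))) ^ 2) * gas (p, w) := by
  have hl := (((contDiffAt_gasT (k := 1) hp hw).differentiableAt
    (by norm_num)).hasFDerivAt.hasLineDerivAt ((1, 0), 0))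
  refine hl.unique ?_
  have h10 := (((contDiffAt_moment (m := 1) 1 0 hp hw).differentiableAt
    (by norm_num)).hasFDerivAt.hasLineDerivAt ((1, 0), 0))
  have h01 := (((contDiffAt_moment (m := 1) 0 1 hp hw).differentiableAt
    (by norm_num)).hasFDerivAt.hasLineDerivAt ((1, 0), 0))
  have hg := (((contDiffAt_gas (k := 1) hp hw).differentiableAt
    (by norm_num)).hasFDerivAt.hasLineDerivAt ((1, 0), 0))
  rw [fderiv_moment _ _ hp hw rfl (fun _ => rfl)] at h10 h01
  rw [fderiv_gas hp hw, fderiv_energy_of_eq_zero hp hw rfl (fun _ => rfl)] at hg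
  unfold HasLineDerivAt at *
  refine (((h10.neg.add (h01.const_mul (2 * w 0))).const_mul (3 / 8)).mul hg).congr_deriv ?_
    |>.congr_of_eventuallyEq ?_
  · have e0 : p + ((0 : ℝ), (0 : PairSpace n)) = p := add_zero p
    simp [e0]
    ring
  · have hc : ContinuousAt (fun ε : ℝ => p + ε • ((1, 0) : ℝ × PairSpace n)) 0 := by fun_prop
    filter_upwards [hc.eventually_mem ((isOpen_region n).mem_nhds (by simpa using hp))] with ε hε
    have := gasT_eq hε hw
    simpa using this

theorem fderiv_gas_drift (hp : p ∈ region n) (hw : w ∈ unitCube (n + 1)) :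
    2 * fderiv ℝ gas (p, w) ((0, drift p), 0) =
      3 / 4 * p.1 * (moment 2 0 (p, w) - 2 * w 0 * moment 1 1 (p, w) -
        1 / 2 * (moment 1 0 (p, w) ^ 2 - ∑ r, pairRec (p, w) r ^ 2)) * gas (p, w) +
      ∑ r : Fin n, w r.succ * (1 - w r.succ) * screenWeight r (p, w) *
        fderiv ℝ gas (p, w) (0, Pi.single r.succ 1) := by
  have hsplit : ((0, drift p), (0 : Fin (n + 1) → ℝ)) =
      (((0 : ℝ), drift p), screenVel (p, w)) + ∑ r : Fin n,
        (1 / 2 * (w r.succ * (1 - w r.succ)) * screenWeight r (p, w)) •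
          ((0 : ℝ × PairSpace n), (Pi.single r.succ 1 : Fin (n + 1) → ℝ)) := by
    have h : screenVel (p, w) + ∑ r : Fin n,
        (1 / 2 * (w r.succ * (1 - w r.succ)) * screenWeight r (p, w)) •
          (Pi.single r.succ 1 : Fin (n + 1) → ℝ) = 0 := by
      ext j
      refine Fin.cases ?_ (fun j => ?_) j
      · simp [screenVel, Finset.sum_apply]
      · simp [screenVel, Finset.sum_apply, Pi.single_apply]
    ext1
    · simp [Prod.fst_sum]
    · simpa [Prod.snd_sum] using h.symm
  rw [hsplit, map_add, map_sum, fderiv_gas hp hw (((0 : ℝ), drift p), screenVel (p, w)),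
    fderiv_energy_drift hp hw, sum_pairRec_mul]
  simp only [map_smul, smul_eq_mul, mul_add, Finset.mul_sum]
  congr 1
  · ring
  · refine Finset.sum_congr rfl fun r _ => ?_
    ring

/-- The potential of the differential equation. -/
def potential (p : ℝ × PairSpace n) : ℝ :=
  ∑ r, ((p.2.1 r - p.1)⁻¹ - (p.2.2 r - p.1)⁻¹) ^ 2

/-- The function integrated by parts over the first screening charge. -/
def firstWeight (P : (ℝ × PairSpace n) × (Fin (n + 1) → ℝ)) : ℝ :=
  -2 * (moment 0 1 P + P.1.1 * moment 1 1 P)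

theorem contDiffAt_firstWeight {k : WithTop ℕ∞} (hp : p ∈ region n)
    (hw : w ∈ unitCube (n + 1)) : ContDiffAt ℝ k firstWeight (p, w) := by
  have h0 := contDiffAt_moment (m := k) 0 1 hp hw
  have h1 := contDiffAt_moment (m := k) 1 1 hp hw
  unfold firstWeight
  fun_prop

theorem fderiv_firstWeight (hp : p ∈ region n) (hw : w ∈ unitCube (n + 1)) :
    fderiv ℝ firstWeight (p, w) (0, Pi.single 0 1) =
      -2 * (p.1 * moment 0 2 (p, w) + p.1 ^ 2 * moment 1 2 (p, w)) := by
  have hl := (((contDiffAt_firstWeight (k := 1) hp hw).differentiableAt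
    (by norm_num)).hasFDerivAt.hasLineDerivAt (0, Pi.single 0 1))
  refine hl.unique ?_
  have h11 := (((contDiffAt_moment (m := 1) 1 1 hp hw).differentiableAt
    (by norm_num)).hasFDerivAt.hasLineDerivAt (0, Pi.single 0 1))
  have h01 := (((contDiffAt_moment (m := 1) 0 1 hp hw).differentiableAt
    (by norm_num)).hasFDerivAt.hasLineDerivAt (0, Pi.single 0 1))
  rw [fderiv_moment _ _ hp hw rfl (fun r => by simp)] at h11 h01
  unfold HasLineDerivAt at *
  refine ((h01.add (h11.const_mul p.1)).const_mul (-2)).congr_deriv ?_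
    |>.congr_of_eventuallyEq (Filter.Eventually.of_forall fun ε => ?_)
  · simp
    ring
  · simp [firstWeight]

theorem gas_pointwise (hp : p ∈ region n) (hw : w ∈ unitCube (n + 1)) :
    8 / 3 * p.1 * fderiv ℝ gasT (p, w) ((1, 0), 0) + 4 / 3 * gasT (p, w) +
      2 * fderiv ℝ gas (p, w) ((0, drift p), 0) - p.1 / 8 * potential p * gas (p, w) =
    (w 0 * (1 - w 0) * fderiv ℝ (fun P => firstWeight P * gas P) (p, w) (0, Pi.single 0 1) +
      1 / 4 * (1 - 2 * w 0) * (firstWeight (p, w) * gas (p, w))) +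
    ∑ r : Fin n, (w r.succ * (1 - w r.succ) *
      fderiv ℝ (fun P => screenWeight r P * gas P) (p, w) (0, Pi.single r.succ 1) +
      1 / 4 * (1 - 2 * w r.succ) * (screenWeight r (p, w) * gas (p, w))) := by
  have e1 : ∀ r : Fin n, (w r.succ * (1 - w r.succ) *
      fderiv ℝ (fun P => screenWeight r P * gas P) (p, w) (0, Pi.single r.succ 1) +
      1 / 4 * (1 - 2 * w r.succ) * (screenWeight r (p, w) * gas (p, w))) =
      screenBracket (p, w) r * gas (p, w) + w r.succ * (1 - w r.succ) * screenWeight r (p, w) *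
        fderiv ℝ gas (p, w) (0, Pi.single r.succ 1) := fun r => by
    rw [fderiv_mul_apply (contDiffAt_screenWeight r hp hw) (contDiffAt_gas hp hw),
      ← screenBracket_eq r hp hw]
    ring
  have e2 : ∑ r, screenBracket (p, w) r = p.1 * (3 / 8 * ∑ r, pairRec (p, w) r ^ 2 -
      1 / 8 * potential p - 1 / 4 * moment 2 0 (p, w)) := by
    simp [screenBracket, potential, moment, chargeSum, ← Finset.mul_sum, Finset.sum_sub_distrib,
      recT, conf]
  have r1 := moment_sub_moment 0 0 hp hw
  have r2 := moment_sub_moment 0 1 hp hw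
  rw [Finset.sum_congr rfl fun r _ => e1 r, Finset.sum_add_distrib, ← Finset.sum_mul, e2,
    fderiv_gasT hp hw, gasT_eq hp hw, fderiv_gas_drift hp hw,
    fderiv_mul_apply (contDiffAt_firstWeight hp hw) (contDiffAt_gas hp hw),
    fderiv_firstWeight hp hw, fderiv_gas hp hw, fderiv_energy_of_eq_zero hp hw rfl
    (fun r => by simp)]
  simp only [firstWeight, zero_add] at r1 r2 ⊢
  have r3 : moment 0 2 (p, w) = moment 1 1 (p, w) - p.1 * (1 - w 0) * moment 1 2 (p, w) := by
    linarith
  rw [r1, r3]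
  simp
  ring

end Point

/-- The second order differential operator annihilating the partition functions. -/
def pdeOp {n : ℕ} (D : ℝ × PairSpace n → ℝ) (p : ℝ × PairSpace n) : ℝ :=
  8 / 3 * p.1 * fderiv ℝ (fun q => fderiv ℝ D q (1, 0)) p (1, 0) + 4 / 3 * fderiv ℝ D p (1, 0) +
    2 * fderiv ℝ D p (0, drift p) - p.1 / 8 * potential p * D p

theorem pdeOp_gasInt {n : ℕ} {p : ℝ × PairSpace n} (hp : p ∈ region n) :
    pdeOp gasInt p = 0 := by
  have d1 : ∀ q ∈ region n, ∀ v, fderiv ℝ gasInt q v =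
      ∫ w, fderiv ℝ gas (q, w) (v, 0) ∂betaQPi (n + 1) := fun q hq v =>
    fderiv_integral_betaQPi (fun p hp w hw => contDiffAt_gas hp hw) hq v
  have d2 : fderiv ℝ (fun q => fderiv ℝ (gasInt (n := n)) q (1, 0)) p (1, 0) =
      ∫ w, fderiv ℝ gasT (p, w) ((1, 0), 0) ∂betaQPi (n + 1) := by
    rw [← fderiv_integral_betaQPi (fun p hp w hw => contDiffAt_gasT (k := 1) hp hw) hp]
    congr 1
    refine Filter.EventuallyEq.fderiv_eq ?_
    filter_upwards [(isOpen_region n).mem_nhds hp] with q hq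
    exact d1 q hq _
  have hint : ∀ {F : (ℝ × PairSpace n) × (Fin (n + 1) → ℝ) → ℝ}
      (_ : ∀ w ∈ unitCube (n + 1), ContDiffAt ℝ 1 F (p, w)) (d),
      Integrable (fun w => fderiv ℝ F (p, w) d) (betaQPi (n + 1)) := fun hF d => by
    refine integrable_betaQPi fun w hw => ?_
    have : ContinuousAt (fderiv ℝ _) (p, w) :=
      ((hF w hw).fderiv_right (m := 0) (by norm_num)).continuousAt
    exact ((this.comp (f := fun w => (p, w)) (by fun_prop)).clm_apply
      continuousAt_const).continuousWithinAt
  have hint0 : ∀ {F : (ℝ × PairSpace n) × (Fin (n + 1) → ℝ) → ℝ}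
      (_ : ∀ w ∈ unitCube (n + 1), ContDiffAt ℝ 1 F (p, w)),
      ContinuousOn (fun w => F (p, w)) (unitCube (n + 1)) := fun hF w hw =>
    ((hF w hw).continuousAt.comp (f := fun w => (p, w)) (by fun_prop)).continuousWithinAt
  have hfd : ∀ {F : (ℝ × PairSpace n) × (Fin (n + 1) → ℝ) → ℝ}
      (_ : ∀ w ∈ unitCube (n + 1), ContDiffAt ℝ 1 F (p, w)) (d),
      ContinuousOn (fun w => fderiv ℝ F (p, w) d) (unitCube (n + 1)) := fun hF d w hw => by
    have : ContinuousAt (fderiv ℝ _) (p, w) :=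
      ((hF w hw).fderiv_right (m := 0) (by norm_num)).continuousAt
    exact ((this.comp (f := fun w => (p, w)) (by fun_prop)).clm_apply
      continuousAt_const).continuousWithinAt
  have stein : ∀ (j : Fin (n + 1)) {F : (ℝ × PairSpace n) × (Fin (n + 1) → ℝ) → ℝ}
      (_ : ∀ w ∈ unitCube (n + 1), ContDiffAt ℝ 1 F (p, w)),
      ∫ w, (w j * (1 - w j) * fderiv ℝ F (p, w) (0, Pi.single j 1) +
        1 / 4 * (1 - 2 * w j) * F (p, w)) ∂betaQPi (n + 1) = 0 := fun j F hF => by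
    rw [← integral_betaQPi_stein_fderiv j (φ := fun w => F (p, w))
      (fun w hw => (hF w hw).comp (f := fun w => (p, w)) w (by fun_prop))]
    refine integral_congr_ae ?_
    filter_upwards [ae_mem_unitCube (n + 1)] with w hw
    rw [fderiv_slice (hF w hw)]
  have hfirst : ∀ w ∈ unitCube (n + 1), ContDiffAt ℝ 1 (fun P => firstWeight P * gas P) (p, w) :=
    fun w hw => (contDiffAt_firstWeight hp hw).mul (contDiffAt_gas hp hw)
  have hscreen : ∀ r : Fin n, ∀ w ∈ unitCube (n + 1),
      ContDiffAt ℝ 1 (fun P => screenWeight r P * gas P) (p, w) :=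
    fun r w hw => (contDiffAt_screenWeight r hp hw).mul (contDiffAt_gas hp hw)
  have hgas : ∀ w ∈ unitCube (n + 1), ContDiffAt ℝ 1 gas (p, w) :=
    fun w hw => contDiffAt_gas hp hw
  have hgasT : ∀ w ∈ unitCube (n + 1), ContDiffAt ℝ 1 gasT (p, w) :=
    fun w hw => contDiffAt_gasT (k := 1) hp hw
  have i1 := hint hgasT ((1, 0), 0)
  have i2 : Integrable (fun w => gasT (p, w)) (betaQPi (n + 1)) := hint hgas ((1, 0), 0)
  have i3 := hint hgas ((0, drift p), 0)
  have i4 := integrable_betaQPi (hint0 hgas)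
  have hsum : ∫ w, (8 / 3 * p.1 * fderiv ℝ gasT (p, w) ((1, 0), 0) + 4 / 3 * gasT (p, w) +
      2 * fderiv ℝ gas (p, w) ((0, drift p), 0) - p.1 / 8 * potential p * gas (p, w))
        ∂betaQPi (n + 1) = 0 := by
    rw [integral_congr_ae (g := fun w => _) ((ae_mem_unitCube (n + 1)).mono
      fun w hw => gas_pointwise hp hw)]
    rw [integral_add, integral_finsetSum]
    · rw [stein 0 hfirst, zero_add]
      exact Finset.sum_eq_zero fun r _ => stein r.succ (hscreen r)
    · intro r _
      refine integrable_betaQPi ?_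
      have h1 := hfd (hscreen r) (0, Pi.single r.succ 1)
      have h2 := hint0 (hscreen r)
      fun_prop
    · refine integrable_betaQPi ?_
      have h1 := hfd hfirst (0, Pi.single 0 1)
      have h2 := hint0 hfirst
      fun_prop
    · refine integrable_finsetSum _ fun r _ => integrable_betaQPi ?_
      have h1 := hfd (hscreen r) (0, Pi.single r.succ 1)
      have h2 := hint0 (hscreen r)
      fun_prop
  have i12 : Integrable (fun w => 8 / 3 * p.1 * fderiv ℝ gasT (p, w) ((1, 0), 0) +
      4 / 3 * gasT (p, w)) (betaQPi (n + 1)) := (i1.const_mul _).add (i2.const_mul _)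
  have i123 : Integrable (fun w => 8 / 3 * p.1 * fderiv ℝ gasT (p, w) ((1, 0), 0) +
      4 / 3 * gasT (p, w) + 2 * fderiv ℝ gas (p, w) ((0, drift p), 0)) (betaQPi (n + 1)) :=
    i12.add (i3.const_mul _)
  rw [integral_sub i123 (i4.const_mul _), integral_add i12 (i3.const_mul _),
    integral_add (i1.const_mul _) (i2.const_mul _)] at hsum
  simp only [integral_const_mul] at hsum
  unfold pdeOp
  rw [d2, d1 p hp, d1 p hp]
  exact hsum

/-! ### Uniqueness for the differential equation -/

section Division

variable {X : Type} [NormedAddCommGroup X] [NormedSpace ℝ X] {H : Set (ℝ × X)}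

theorem exists_eq_fst_mul_of_eq_zero (hH : IsOpen H)
    (hstar : ∀ p ∈ H, ∀ s ∈ Set.Icc (0 : ℝ) 1, (s * p.1, p.2) ∈ H) {D : ℝ × X → ℝ}
    (hD : ∀ k : ℕ, ContDiffOn ℝ k D H) (h0 : ∀ x, (0, x) ∈ H → D (0, x) = 0) :
    ∃ R : ℝ × X → ℝ, (∀ k : ℕ, ContDiffOn ℝ k R H) ∧ ∀ p ∈ H, D p = p.1 * R p := by
  set F : (ℝ × X) × ℝ → ℝ := fun P => fderiv ℝ D (P.2 * P.1.1, P.1.2) (1, 0) with hFdef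
  have hF : ∀ k : ℕ, ∀ p ∈ H, ∀ s ∈ Set.Icc (0 : ℝ) 1, ContDiffAt ℝ k F (p, s) := by
    intro k p hp s hs
    have h1 : ContDiffAt ℝ (k + 1 : ℕ) D (s * p.1, p.2) :=
      (hD (k + 1)).contDiffAt (hH.mem_nhds (hstar p hp s hs))
    have h2 : ContDiffAt ℝ k (fderiv ℝ D) (s * p.1, p.2) := h1.fderiv_right (by norm_num)
    have h3 : ContDiffAt ℝ k (fun P : (ℝ × X) × ℝ => ((P.2 * P.1.1, P.1.2) : ℝ × X)) (p, s) := by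
      fun_prop
    exact (h2.comp (p, s) h3).clm_apply contDiffAt_const
  refine ⟨fun p => ∫ s, F (p, s) ∂(volume.restrict (Set.Icc (0 : ℝ) 1)), fun k => ?_, ?_⟩
  · exact contDiffOn_integral_of_isCompact isCompact_Icc
      (Measure.restrict_restrict_of_subset subset_rfl) continuous_id hH k (hF k)
  · intro p hp
    have hd : ∀ s ∈ Set.uIcc (0 : ℝ) 1, HasDerivAt (fun s => D (s * p.1, p.2))
        (p.1 * F (p, s)) s := by
      intro s hs
      rw [Set.uIcc_of_le zero_le_one] at hs
      have h1 : HasFDerivAt D (fderiv ℝ D (s * p.1, p.2)) (s * p.1, p.2) :=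
        (((hD 1).contDiffAt (hH.mem_nhds (hstar p hp s hs))).differentiableAt
          (by norm_num)).hasFDerivAt
      have h2 : HasDerivAt (fun s : ℝ => ((s * p.1, p.2) : ℝ × X)) (p.1, 0) s := by
        have h3 : HasDerivAt (fun s : ℝ => s * p.1) p.1 s := by
          simpa using (hasDerivAt_id s).mul_const p.1
        exact h3.prodMk (hasDerivAt_const s p.2)
      refine (h1.comp_hasDerivAt s h2).congr_deriv ?_
      have h3 : ((p.1, 0) : ℝ × X) = p.1 • (1, 0) := by simp
      rw [h3, map_smul, smul_eq_mul]
    have hc : ContinuousOn (fun s => p.1 * F (p, s)) (Set.uIcc 0 1) := by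
      intro s hs
      rw [Set.uIcc_of_le zero_le_one] at hs
      exact (continuousAt_const.mul ((hF 0 p hp s hs).continuousAt.comp
        (f := fun s => (p, s)) (by fun_prop))).continuousWithinAt
    have key := intervalIntegral.integral_eq_sub_of_hasDerivAt hd hc.intervalIntegrable
    have hz : D (0 * p.1, p.2) = 0 := by
      rw [zero_mul]
      apply h0
      simpa using hstar p hp 0 ⟨le_rfl, zero_le_one⟩
    rw [hz, one_mul, sub_zero, intervalIntegral.integral_const_mul,
      intervalIntegral.integral_of_le zero_le_one, ← integral_Icc_eq_integral_Ioc] at key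
    exact key.symm

theorem fderiv_fst_pow_mul {R : ℝ × X → ℝ} {q : ℝ × X} (hR : DifferentiableAt ℝ R q) (j : ℕ)
    (v : ℝ × X) : fderiv ℝ (fun p : ℝ × X => p.1 ^ j * R p) q v =
      j * q.1 ^ (j - 1) * v.1 * R q + q.1 ^ j * fderiv ℝ R q v := by
  have h1 : HasFDerivAt (fun p : ℝ × X => p.1 ^ j)
      ((j * q.1 ^ (j - 1)) • ContinuousLinearMap.fst ℝ ℝ X) q := by
    have := (hasFDerivAt_fst (𝕜 := ℝ) (E := ℝ) (F := X) (p := q)).pow j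
    refine this.congr_fderiv ?_
    ext <;> simp
  have h2 : fderiv ℝ (fun p : ℝ × X => p.1 ^ j * R p) q = _ := (h1.mul hR.hasFDerivAt).fderiv
  rw [h2]
  simp
  ring

end Division

theorem eventually_eq_zero_of_forall_pow_mul {f : ℝ → ℝ} (hf : AnalyticAt ℝ f 0)
    (h : ∀ m : ℕ, ∃ R : ℝ → ℝ, ContinuousAt R 0 ∧ ∀ᶠ t in 𝓝 0, f t = t ^ m * R t) :
    ∀ᶠ t in 𝓝 0, f t = 0 := by
  by_contra hne
  obtain ⟨k, g, hg, hg0, hfg⟩ := (hf.exists_eventuallyEq_pow_smul_nonzero_iff).2 hne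
  obtain ⟨R, hR, hfR⟩ := h (k + 1)
  apply hg0
  have h1 : ∀ᶠ t in 𝓝[≠] (0 : ℝ), g t = t * R t := by
    filter_upwards [nhdsWithin_le_nhds hfg, nhdsWithin_le_nhds hfR, self_mem_nhdsWithin]
      with t h1 h2 h3
    have h4 : t ^ k ≠ 0 := pow_ne_zero _ h3
    rw [h1, sub_zero, smul_eq_mul, pow_succ, mul_assoc] at h2
    exact mul_left_cancel₀ h4 h2
  have h2 : Tendsto g (𝓝[≠] 0) (𝓝 (g 0)) := hg.continuousAt.tendsto.mono_left nhdsWithin_le_nhds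
  have h3 : Tendsto (fun t => t * R t) (𝓝[≠] 0) (𝓝 (0 * R 0)) :=
    (continuousAt_id.mul hR).tendsto.mono_left nhdsWithin_le_nhds
  have := tendsto_nhds_unique (h2.congr' h1) h3
  simpa using this

theorem continuousAt_drift {n : ℕ} {p : ℝ × PairSpace n} (hp : p ∈ region n) :
    ContinuousAt (drift (n := n)) p := by
  have h1 : ∀ r, p.2.1 r - p.1 ≠ 0 := fun r => (sub_pos.2 (hp.2 r).2).ne'
  have h2 : ∀ r, p.2.2 r - p.1 ≠ 0 := fun r => (sub_pos.2 ((hp.2 r).2.trans (hp.1.1 r))).ne'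
  unfold drift
  refine ContinuousAt.prodMk ?_ ?_ <;> rw [continuousAt_pi] <;> intro r
  · exact ContinuousAt.div (by fun_prop) (by fun_prop) (h1 r)
  · exact ContinuousAt.div (by fun_prop) (by fun_prop) (h2 r)

theorem continuousAt_potential {n : ℕ} {p : ℝ × PairSpace n} (hp : p ∈ region n) :
    ContinuousAt (potential (n := n)) p := by
  have h1 : ∀ r, p.2.1 r - p.1 ≠ 0 := fun r => (sub_pos.2 (hp.2 r).2).ne'
  have h2 : ∀ r, p.2.2 r - p.1 ≠ 0 := fun r => (sub_pos.2 ((hp.2 r).2.trans (hp.1.1 r))).ne'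
  unfold potential
  refine tendsto_finsetSum _ fun r _ => ?_
  have h3 : ContinuousAt (fun p : ℝ × PairSpace n => p.2.1 r - p.1) p := by fun_prop
  have h4 : ContinuousAt (fun p : ℝ × PairSpace n => p.2.2 r - p.1) p := by fun_prop
  exact ((h3.inv₀ (h1 r)).sub (h4.inv₀ (h2 r))).pow 2

theorem region_star {n : ℕ} : ∀ p ∈ region n, ∀ s ∈ Set.Icc (0 : ℝ) 1,
    (s * p.1, p.2) ∈ region n := fun p hp s hs =>
  ⟨hp.1, fun r => ⟨(hp.2 r).1, by
    rw [mul_comm]; exact mul_lt_of_mem_Icc (hp.2 r).1 (hp.2 r).2 hs⟩⟩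

theorem eq_zero_of_pdeOp_pow_mul {n : ℕ} {D R : ℝ × PairSpace n → ℝ} {j : ℕ}
    (hR : ∀ k : ℕ, ContDiffOn ℝ k R (region n))
    (hDR : ∀ p ∈ region n, D p = p.1 ^ (j + 1) * R p) (hpde : ∀ p ∈ region n, pdeOp D p = 0)
    {x : PairSpace n} (hx : (0, x) ∈ region n) : R (0, x) = 0 := by
  have hH := isOpen_region n
  have hRat : ∀ (k : ℕ), ∀ p ∈ region n, ContDiffAt ℝ k R p := fun k p hp =>
    (hR k).contDiffAt (hH.mem_nhds hp)
  set R' : ℝ × PairSpace n → ℝ := fun p => fderiv ℝ R p (1, 0) with hR'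
  have hR'at : ∀ (k : ℕ), ∀ p ∈ region n, ContDiffAt ℝ k R' p := fun k p hp =>
    ((hRat (k + 1) p hp).fderiv_right (by norm_num)).clm_apply contDiffAt_const
  set S : ℝ × PairSpace n → ℝ := fun p => (j + 1) * R p + p.1 * R' p with hS
  have hSat : ∀ (k : ℕ), ∀ p ∈ region n, ContDiffAt ℝ k S p := fun k p hp => by
    have h1 := hRat k p hp
    have h2 := hR'at k p hp
    fun_prop
  set S' : ℝ × PairSpace n → ℝ := fun p => fderiv ℝ S p (1, 0) with hS'
  have hS'at : ∀ (k : ℕ), ∀ p ∈ region n, ContDiffAt ℝ k S' p := fun k p hp =>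
    ((hSat (k + 1) p hp).fderiv_right (by norm_num)).clm_apply contDiffAt_const
  have hdD : ∀ p ∈ region n, ∀ v, fderiv ℝ D p v =
      (j + 1) * p.1 ^ j * v.1 * R p + p.1 ^ (j + 1) * fderiv ℝ R p v := fun p hp v => by
    have h1 : D =ᶠ[𝓝 p] fun p => p.1 ^ (j + 1) * R p := by
      filter_upwards [hH.mem_nhds hp] with q hq using hDR q hq
    rw [h1.fderiv_eq, fderiv_fst_pow_mul ((hRat 1 p hp).differentiableAt (by norm_num))]
    simp
  have hdD2 : ∀ p ∈ region n, fderiv ℝ (fun q => fderiv ℝ D q (1, 0)) p (1, 0) =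
      j * p.1 ^ (j - 1) * S p + p.1 ^ j * S' p := fun p hp => by
    have h1 : (fun q => fderiv ℝ D q (1, 0)) =ᶠ[𝓝 p] fun p => p.1 ^ j * S p := by
      filter_upwards [hH.mem_nhds hp] with q hq
      rw [hdD q hq]
      simp only [hS, hR']
      ring
    rw [h1.fderiv_eq, fderiv_fst_pow_mul ((hSat 1 p hp).differentiableAt (by norm_num))]
    simp [hS']
  set B : ℝ × PairSpace n → ℝ := fun p => 8 / 3 * (j * S p + p.1 * S' p) + 4 / 3 * S p +
    2 * p.1 * fderiv ℝ R p (0, drift p) - p.1 ^ 2 / 8 * potential p * R p with hB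
  have hpow : ∀ t : ℝ, t * (j * t ^ (j - 1)) = j * t ^ j := fun t => by
    rcases j with _ | j
    · simp
    · simp only [Nat.add_sub_cancel]; ring
  have hBz : ∀ p ∈ region n, p.1 ^ j * B p = 0 := fun p hp => by
    have h1 := hpde p hp
    rw [pdeOp, hdD2 p hp, hdD p hp, hdD p hp, hDR p hp] at h1
    simp only [hB]
    have h2 : S p = (j + 1) * R p + p.1 * fderiv ℝ R p (1, 0) := rfl
    simp only [mul_zero, zero_mul, zero_add, mul_one] at h1
    linear_combination h1 - 8 / 3 * S p * hpow p.1 + 4 / 3 * p.1 ^ j * h2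
  have hBc : ContinuousAt B (0, x) := by
    have h1 := (hRat 0 _ hx).continuousAt
    have h2 := (hSat 0 _ hx).continuousAt
    have h3 := (hS'at 0 _ hx).continuousAt
    have h4 := continuousAt_potential hx
    have h5 : ContinuousAt (fun p : ℝ × PairSpace n => fderiv ℝ R p (0, drift p)) (0, x) :=
      ((hRat 1 _ hx).fderiv_right (m := 0) (by norm_num)).continuousAt.clm_apply
        (continuousAt_const.prodMk (continuousAt_drift hx))
    simp only [hB]
    fun_prop
  have hcurve : ContinuousAt (fun t : ℝ => ((t, x) : ℝ × PairSpace n)) 0 := by fun_prop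
  have hlim : Tendsto (fun t : ℝ => B (t, x)) (𝓝[≠] 0) (𝓝 (B (0, x))) :=
    (ContinuousAt.comp (f := fun t : ℝ => ((t, x) : ℝ × PairSpace n)) hBc hcurve).tendsto.mono_left
      nhdsWithin_le_nhds
  have hev : ∀ᶠ t : ℝ in 𝓝[≠] 0, B (t, x) = 0 := by
    filter_upwards [nhdsWithin_le_nhds (hcurve.eventually_mem (hH.mem_nhds hx)),
      self_mem_nhdsWithin] with t ht ht0
    exact (mul_eq_zero.1 (hBz _ ht)).resolve_left (pow_ne_zero _ ht0)
  have h0 : B (0, x) = 0 := tendsto_nhds_unique hlim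
    ((tendsto_const_nhds (x := (0 : ℝ))).congr' (hev.mono fun t ht => ht.symm))
  simp only [hB, hS] at h0
  have hj : ((8 / 3 * j + 4 / 3) * (j + 1 : ℝ)) * R (0, x) = 0 := by
    linear_combination h0
  exact (mul_eq_zero.1 hj).resolve_left (by positivity)

theorem eq_zero_of_pdeOp {n : ℕ} {D : ℝ × PairSpace n → ℝ}
    (hD : ∀ k : ℕ, ContDiffOn ℝ k D (region n)) (hpde : ∀ p ∈ region n, pdeOp D p = 0)
    (h0 : ∀ x, (0, x) ∈ region n → D (0, x) = 0)
    (han : ∀ p ∈ region n, AnalyticAt ℝ (fun t => D (t, p.2)) p.1) :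
    ∀ p ∈ region n, D p = 0 := by
  have hH := isOpen_region n
  have hdiv : ∀ m : ℕ, ∃ R : ℝ × PairSpace n → ℝ, (∀ k : ℕ, ContDiffOn ℝ k R (region n)) ∧
      ∀ p ∈ region n, D p = p.1 ^ m * R p := by
    intro m
    induction m with
    | zero => exact ⟨D, hD, fun p _ => by simp⟩
    | succ m ih =>
      obtain ⟨R, hR, hDR⟩ := ih
      have hR0 : ∀ x, (0, x) ∈ region n → R (0, x) = 0 := by
        intro x hx
        rcases m with _ | j
        · have := hDR _ hx
          rw [h0 x hx] at this
          simpa using this.symm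
        · exact eq_zero_of_pdeOp_pow_mul hR hDR hpde hx
      obtain ⟨R', hR', hRR'⟩ := exists_eq_fst_mul_of_eq_zero hH region_star hR hR0
      exact ⟨R', hR', fun p hp => by rw [hDR p hp, hRR' p hp]; ring⟩
  intro p hp
  have hp0 : (0, p.2) ∈ region n := by
    simpa using region_star p hp 0 ⟨le_rfl, zero_le_one⟩
  have hconv : Convex ℝ {t : ℝ | (t, p.2) ∈ region n} := by
    have : {t : ℝ | (t, p.2) ∈ region n} = ⋂ r, Set.Iio (p.2.1 r) := by
      ext t
      simp only [Set.mem_iInter, Set.mem_Iio]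
      exact ⟨fun h r => (h.2 r).2, fun h => ⟨hp.1, fun r => ⟨(hp.2 r).1, h r⟩⟩⟩
    rw [this]
    exact convex_iInter fun r => convex_Iio _
  have hana : AnalyticOnNhd ℝ (fun t => D (t, p.2)) {t : ℝ | (t, p.2) ∈ region n} :=
    fun t ht => han (t, p.2) ht
  have hev : ∀ᶠ t in 𝓝 (0 : ℝ), D (t, p.2) = 0 := by
    refine eventually_eq_zero_of_forall_pow_mul (hana 0 hp0) fun m => ?_
    obtain ⟨R, hR, hDR⟩ := hdiv m
    have hcurve : ContinuousAt (fun t : ℝ => ((t, p.2) : ℝ × PairSpace n)) 0 := by fun_prop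
    refine ⟨fun t => R (t, p.2), ?_, ?_⟩
    · exact ContinuousAt.comp (f := fun t : ℝ => ((t, p.2) : ℝ × PairSpace n))
        ((hR 0).contDiffAt (hH.mem_nhds hp0)).continuousAt hcurve
    · filter_upwards [hcurve.eventually_mem (hH.mem_nhds hp0)] with t ht using hDR _ ht
  exact hana.eqOn_zero_of_preconnected_of_eventuallyEq_zero hconv.isPreconnected hp0 hev
    (show p.1 ∈ {t : ℝ | (t, p.2) ∈ region n} from hp)

/-! ### Partial fractions -/

section PartialFractions

variable {ι : Type} [DecidableEq ι]

/-- The residue at `p r` of `∏ s ∈ A, (z - m s) / (z - p s)`. -/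
def residue (A : Finset ι) (p m : ι → ℝ) (r : ι) : ℝ :=
  (p r - m r) * ∏ s ∈ A.erase r, (p r - m s) / (p r - p s)

theorem residue_insert_of_mem {A : Finset ι} {p m : ι → ℝ} {q r : ι} (hq : q ∉ A) (hr : r ∈ A) :
    residue (insert q A) p m r = residue A p m r * ((p r - m q) / (p r - p q)) := by
  have hqr : q ≠ r := fun h => hq (h ▸ hr)
  rw [residue, residue, Finset.erase_insert_of_ne hqr, Finset.prod_insert (by simp [hq])]
  ring

theorem residue_insert_self {A : Finset ι} {p m : ι → ℝ} {q : ι} (hq : q ∉ A) :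
    residue (insert q A) p m q = (p q - m q) * ∏ s ∈ A, (p q - m s) / (p q - p s) := by
  rw [residue, Finset.erase_insert hq]

theorem prod_div_eq_one_add_sum_residue {p : ι → ℝ} (hp : Function.Injective p) (m : ι → ℝ)
    (A : Finset ι) {z : ℝ} (hz : ∀ r ∈ A, z ≠ p r) :
    ∏ s ∈ A, (z - m s) / (z - p s) = 1 + ∑ r ∈ A, residue A p m r / (z - p r) := by
  induction A using Finset.induction_on generalizing z with
  | empty => simp
  | insert q A hq ih =>
    have hzq : z - p q ≠ 0 := sub_ne_zero.2 (hz q (by simp))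
    have hz' : ∀ r ∈ A, z ≠ p r := fun r hr => hz r (by simp [hr])
    have hpq : ∀ r ∈ A, p q ≠ p r := fun r hr h => hq (hp h ▸ hr)
    rw [Finset.prod_insert hq, Finset.sum_insert hq, residue_insert_self hq, ih hz', ih hpq,
      Finset.sum_congr rfl fun r hr => congrArg (· / (z - p r)) (residue_insert_of_mem hq hr)]
    have key : ∀ r ∈ A, residue A p m r * ((p r - m q) / (p r - p q)) / (z - p r) =
        (z - m q) / (z - p q) * (residue A p m r / (z - p r)) -
          (p q - m q) / (z - p q) * (residue A p m r / (p q - p r)) := by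
      intro r hr
      have h1 : z - p r ≠ 0 := sub_ne_zero.2 (hz' r hr)
      have h2 : p q - p r ≠ 0 := sub_ne_zero.2 (hpq r hr)
      have h3 : p r - p q ≠ 0 := sub_ne_zero.2 (hpq r hr).symm
      field_simp
      ring
    rw [Finset.sum_congr rfl key, Finset.sum_sub_distrib, ← Finset.mul_sum, ← Finset.mul_sum]
    field_simp
    ring

theorem sum_residue {p : ι → ℝ} (hp : Function.Injective p) (m : ι → ℝ) (A : Finset ι) :
    ∑ r ∈ A, residue A p m r = ∑ r ∈ A, (p r - m r) ∧
      2 * ∑ r ∈ A, residue A p m r * p r =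
        (∑ r ∈ A, (p r - m r)) ^ 2 + ∑ r ∈ A, (p r ^ 2 - m r ^ 2) := by
  induction A using Finset.induction_on with
  | empty => simp
  | insert q A hq ih =>
    have hpq : ∀ r ∈ A, p q ≠ p r := fun r hr h => hq (hp h ▸ hr)
    simp only [Finset.sum_insert hq, residue_insert_self hq]
    rw [prod_div_eq_one_add_sum_residue hp m A hpq]
    have key : ∀ r ∈ A, residue (insert q A) p m r =
        residue A p m r - (p q - m q) * (residue A p m r / (p q - p r)) := by
      intro r hr
      rw [residue_insert_of_mem hq hr]
      have h2 : p q - p r ≠ 0 := sub_ne_zero.2 (hpq r hr)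
      have h3 : p r - p q ≠ 0 := sub_ne_zero.2 (hpq r hr).symm
      field_simp
      ring
    have key' : ∀ r ∈ A, residue (insert q A) p m r * p r =
        residue A p m r * p r + (p q - m q) * residue A p m r
          - (p q - m q) * p q * (residue A p m r / (p q - p r)) := by
      intro r hr
      rw [key r hr]
      have h2 : p q - p r ≠ 0 := sub_ne_zero.2 (hpq r hr)
      field_simp
      ring
    rw [Finset.sum_congr rfl key, Finset.sum_congr rfl key']
    simp only [Finset.sum_sub_distrib, Finset.sum_add_distrib, ← Finset.mul_sum] at ih ⊢
    refine ⟨by linear_combination ih.1, by linear_combination ih.2 + 2 * (p q - m q) * ih.1⟩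

end PartialFractions

/-! ### An identity for Ising weights -/

section Ising

variable {n : ℕ}

/-- The Ising energy with magnetic field `M` and coupling `c`. -/
def isingEnergy (M : Fin n → ℝ) (c : Fin n → Fin n → ℝ) (σ : Fin n → Bool) : ℝ :=
  1 / 4 * ∑ s, sgn (σ s) * M s + 1 / 8 * ∑ r, ∑ s, sgn (σ r) * sgn (σ s) * c r s

theorem isingEnergy_update {M : Fin n → ℝ} {c : Fin n → Fin n → ℝ} (hc : ∀ r s, c r s = c s r)
    (hc0 : ∀ r, c r r = 0) (σ : Fin n → Bool) (r : Fin n) :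
    isingEnergy M c (Function.update σ r (!σ r)) =
      isingEnergy M c σ - 1 / 2 * sgn (σ r) * (M r + ∑ s, sgn (σ s) * c r s) := by
  have h : ∀ s, sgn (Function.update σ r (!σ r) s) =
      sgn (σ s) - 2 * sgn (σ r) * (if s = r then 1 else 0) := by
    intro s
    by_cases hs : s = r
    · subst hs
      cases h : σ s <;> simp [sgn] <;> norm_num
    · simp [hs]
  simp only [isingEnergy, h]
  have h1 : ∑ s, (sgn (σ s) - 2 * sgn (σ r) * (if s = r then 1 else 0)) * M s =
      ∑ s, sgn (σ s) * M s - 2 * sgn (σ r) * M r := by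
    simp only [sub_mul, Finset.sum_sub_distrib, mul_assoc, ite_mul, one_mul, zero_mul, mul_ite,
      mul_zero, Finset.sum_ite_eq', Finset.mem_univ, if_true]
  have h2 : ∑ x, ∑ s, (sgn (σ x) - 2 * sgn (σ r) * (if x = r then 1 else 0)) *
        (sgn (σ s) - 2 * sgn (σ r) * (if s = r then 1 else 0)) * c x s =
      ∑ x, ∑ s, sgn (σ x) * sgn (σ s) * c x s - 4 * sgn (σ r) * ∑ s, sgn (σ s) * c r s := by
    have h3 : ∀ x s, (sgn (σ x) - 2 * sgn (σ r) * (if x = r then 1 else 0)) *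
        (sgn (σ s) - 2 * sgn (σ r) * (if s = r then 1 else 0)) * c x s =
        sgn (σ x) * sgn (σ s) * c x s
          - (if s = r then 2 * sgn (σ r) * (sgn (σ x) * c r x) else 0)
          - (if x = r then 2 * sgn (σ r) * (sgn (σ s) * c r s) else 0)
          + (if x = r then if s = r then 4 * sgn (σ r) ^ 2 * c r r else 0 else 0) := by
      intro x s
      by_cases hx : x = r <;> by_cases hs : s = r <;> simp [hx, hs, hc r x] <;> ring
    simp only [h3, Finset.sum_sub_distrib, Finset.sum_add_distrib, Finset.sum_ite_eq',
      Finset.mem_univ, if_true, hc0, mul_zero, ← Finset.mul_sum, ite_self, Finset.sum_const_zero]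
    rw [Finset.sum_comm (f := fun x s => if x = r then 2 * sgn (σ r) * (sgn (σ s) * c r s) else 0)]
    simp only [Finset.sum_ite_eq', Finset.mem_univ, if_true, ← Finset.mul_sum]
    ring
  rw [h1, h2]
  ring

/-- The pole attached to a spin. -/
def pole (A B : Fin n → ℝ) (σ : Fin n → Bool) (s : Fin n) : ℝ := if σ s then A s else B s

theorem sum_isingWeight_mul_residue {A B M : Fin n → ℝ} {c : Fin n → Fin n → ℝ} {t : ℝ}
    (hc : ∀ r s, c r s = c s r) (hc0 : ∀ r, c r r = 0)
    (hM : ∀ r, Real.exp (M r) * (1 + t * A r) = 1 + t * B r)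
    (hAB : ∀ r s, r ≠ s → Real.exp (c r s) * ((A r - B s) * (B r - A s)) =
      (A r - A s) * (B r - B s))
    (hA : ∀ r s, r ≠ s → A r ≠ A s) (hB : ∀ r s, r ≠ s → B r ≠ B s)
    (hne : ∀ r s, r ≠ s → A r ≠ B s) (r : Fin n) :
    ∑ P : (Fin n → Bool) × (Fin n → Bool),
      Real.exp (isingEnergy M c P.1) * Real.exp (isingEnergy M c P.2) *
        (residue Finset.univ (pole A B P.1) (pole B A P.2) r * (1 + t * pole A B P.1 r)) = 0 := by
  let e : (Fin n → Bool) ≃ (Fin n → Bool) :=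
    Function.Involutive.toPerm (fun σ => Function.update σ r (!σ r)) fun σ => by simp
  have key : ∀ P : (Fin n → Bool) × (Fin n → Bool),
      Real.exp (isingEnergy M c (e P.1)) * Real.exp (isingEnergy M c (e P.2)) *
        (residue Finset.univ (pole A B (e P.1)) (pole B A (e P.2)) r *
          (1 + t * pole A B (e P.1) r)) =
      -(Real.exp (isingEnergy M c P.1) * Real.exp (isingEnergy M c P.2) *
        (residue Finset.univ (pole A B P.1) (pole B A P.2) r * (1 + t * pole A B P.1 r))) := by
    rintro ⟨σ, τ⟩
    have he : ∀ σ, e σ = Function.update σ r (!σ r) := fun σ => rfl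
    have hne' : ∀ s ∈ Finset.univ.erase r, r ≠ s := fun s hs => (Finset.ne_of_mem_erase hs).symm
    by_cases hστ : σ r = τ r
    · have hs : ∀ s ∈ Finset.univ.erase r,
          Real.exp (-(1 / 2 * sgn (σ r) * (sgn (σ s) + sgn (τ s)) * c r s)) *
            ((pole A B (e σ) r - pole B A (e τ) s) / (pole A B (e σ) r - pole A B (e σ) s)) =
          (pole A B σ r - pole B A τ s) / (pole A B σ r - pole A B σ s) := by
        intro s hs
        have h := hne' s hs
        have h1 := sub_ne_zero.2 (hA r s h)
        have h2 := sub_ne_zero.2 (hB r s h)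
        have h3 := sub_ne_zero.2 (hne r s h)
        have h4 := sub_ne_zero.2 (hne s r h.symm).symm
        have h5 := hAB r s h
        have h6 := (Real.exp_pos (c r s)).ne'
        have h7 : Real.exp (-c r s) = (Real.exp (c r s))⁻¹ := Real.exp_neg _
        simp only [pole, he, Function.update_self, Function.update_of_ne h.symm]
        have h8 : Real.exp (2⁻¹ * (-1 + -1) * c r s) = (Real.exp (c r s))⁻¹ := by
          rw [← h7]; norm_num
        have h9 : Real.exp (2⁻¹ * (1 + 1) * c r s) = Real.exp (c r s) := by norm_num
        cases hr : σ r <;> cases hσ : σ s <;> cases hτ : τ s <;>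
          simp [sgn, h1, h2, h3, h4, h8, h9, Real.exp_neg] <;> field_simp <;>
          first | linear_combination h5 | linear_combination -h5
      have hr : Real.exp (-(sgn (σ r) * M r)) * (1 + t * pole A B (e σ) r) =
          1 + t * pole A B σ r := by
        have h1 := hM r
        have h2 := (Real.exp_pos (M r)).ne'
        simp only [pole, he, Function.update_self]
        cases hr : σ r <;> simp [sgn, Real.exp_neg] <;> field_simp <;>
          first | linear_combination h1 | linear_combination -h1
      have hd : pole A B (e σ) r - pole B A (e τ) r = -(pole A B σ r - pole B A τ r) := by
        simp only [pole, he, Function.update_self, ← hστ]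
        cases hr : σ r <;> simp
      have hexp : Real.exp (isingEnergy M c (e σ)) * Real.exp (isingEnergy M c (e τ)) =
          Real.exp (isingEnergy M c σ) * Real.exp (isingEnergy M c τ) *
            (Real.exp (-(sgn (σ r) * M r)) * ∏ s ∈ Finset.univ.erase r,
              Real.exp (-(1 / 2 * sgn (σ r) * (sgn (σ s) + sgn (τ s)) * c r s))) := by
        rw [he, he, isingEnergy_update hc hc0, isingEnergy_update hc hc0, ← Real.exp_sum,
          ← Real.exp_add, ← Real.exp_add, ← Real.exp_add, ← Real.exp_add, ← hστ,
          Finset.sum_erase _ (by simp [hc0])]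
        congr 1
        have : ∑ s, -(1 / 2 * sgn (σ r) * (sgn (σ s) + sgn (τ s)) * c r s) =
            -(1 / 2 * sgn (σ r)) * (∑ s, sgn (σ s) * c r s + ∑ s, sgn (τ s) * c r s) := by
          rw [← Finset.sum_add_distrib, Finset.mul_sum]
          exact Finset.sum_congr rfl fun s _ => by ring
        rw [this]
        ring
      simp only [residue]
      rw [hexp, ← hr, hd, ← Finset.prod_congr rfl hs, Finset.prod_mul_distrib]
      ring
    · have h1 : pole A B σ r - pole B A τ r = 0 := by
        simp only [pole]
        cases hr : σ r <;> cases hr' : τ r <;> simp_all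
      have h2 : pole A B (e σ) r - pole B A (e τ) r = 0 := by
        simp only [pole, he, Function.update_self]
        cases hr : σ r <;> cases hr' : τ r <;> simp_all
      simp only [residue, h1, h2]
      ring
  have h := Equiv.sum_comp (e.prodCongr e) fun P : (Fin n → Bool) × (Fin n → Bool) =>
    Real.exp (isingEnergy M c P.1) * Real.exp (isingEnergy M c P.2) *
      (residue Finset.univ (pole A B P.1) (pole B A P.2) r * (1 + t * pole A B P.1 r))
  simp only [Equiv.prodCongr_apply, Prod.map_apply'] at h
  rw [Finset.sum_congr rfl fun P _ => key P, Finset.sum_neg_distrib] at h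
  linarith

theorem sum_isingWeight_eq_zero {A B M : Fin n → ℝ} {c : Fin n → Fin n → ℝ} {t : ℝ}
    (hc : ∀ r s, c r s = c s r) (hc0 : ∀ r, c r r = 0)
    (hM : ∀ r, Real.exp (M r) * (1 + t * A r) = 1 + t * B r)
    (hAB : ∀ r s, r ≠ s → Real.exp (c r s) * ((A r - B s) * (B r - A s)) =
      (A r - A s) * (B r - B s))
    (hA : ∀ r s, r ≠ s → A r ≠ A s) (hB : ∀ r s, r ≠ s → B r ≠ B s)
    (hne : ∀ r s, r ≠ s → A r ≠ B s) :
    ∑ P : (Fin n → Bool) × (Fin n → Bool),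
      Real.exp (isingEnergy M c P.1) * Real.exp (isingEnergy M c P.2) *
        (t * (∑ s, (sgn (P.1 s) + sgn (P.2 s)) * (A s - B s)) ^ 2 / 4 +
          t * (∑ s, (sgn (P.1 s) + sgn (P.2 s)) * (A s ^ 2 - B s ^ 2)) / 2 +
          ∑ s, (sgn (P.1 s) + sgn (P.2 s)) * (A s - B s)) = 0 := by
  have key : ∀ P : (Fin n → Bool) × (Fin n → Bool),
      t * (∑ s, (sgn (P.1 s) + sgn (P.2 s)) * (A s - B s)) ^ 2 / 4 +
          t * (∑ s, (sgn (P.1 s) + sgn (P.2 s)) * (A s ^ 2 - B s ^ 2)) / 2 +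
          ∑ s, (sgn (P.1 s) + sgn (P.2 s)) * (A s - B s) =
      2 * ∑ r, residue Finset.univ (pole A B P.1) (pole B A P.2) r *
        (1 + t * pole A B P.1 r) := by
    rintro ⟨σ, τ⟩
    have hinj : Function.Injective (pole A B σ) := by
      intro r s h
      by_contra hrs
      have h1 := hA r s hrs
      have h2 := hB r s hrs
      have h3 := hne r s hrs
      have h4 := (hne s r (Ne.symm hrs)).symm
      revert h
      simp only [pole]
      split_ifs <;> assumption
    obtain ⟨h1, h2⟩ := sum_residue hinj (pole B A τ) Finset.univ
    have h3 : ∑ s, (pole A B σ s - pole B A τ s) =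
        (∑ s, (sgn (σ s) + sgn (τ s)) * (A s - B s)) / 2 := by
      rw [Finset.sum_div]
      refine Finset.sum_congr rfl fun s _ => ?_
      simp only [pole]
      cases σ s <;> cases τ s <;> simp [sgn] <;> ring
    have h4 : ∑ s, (pole A B σ s ^ 2 - pole B A τ s ^ 2) =
        (∑ s, (sgn (σ s) + sgn (τ s)) * (A s ^ 2 - B s ^ 2)) / 2 := by
      rw [Finset.sum_div]
      refine Finset.sum_congr rfl fun s _ => ?_
      simp only [pole]
      cases σ s <;> cases τ s <;> simp [sgn] <;> ring
    have h5 : ∑ r, residue Finset.univ (pole A B σ) (pole B A τ) r * (1 + t * pole A B σ r) =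
        ∑ r, residue Finset.univ (pole A B σ) (pole B A τ) r +
          t * ∑ r, residue Finset.univ (pole A B σ) (pole B A τ) r * pole A B σ r := by
      rw [Finset.mul_sum, ← Finset.sum_add_distrib]
      exact Finset.sum_congr rfl fun r _ => by ring
    rw [h3] at h1 h2
    rw [h4] at h2
    rw [h5]
    linear_combination -(2 * h1) - t * h2
  rw [Finset.sum_congr rfl fun P _ => congrArg _ (key P)]
  simp only [Finset.mul_sum]
  rw [Finset.sum_comm]
  refine Finset.sum_eq_zero fun r _ => ?_
  have h := sum_isingWeight_mul_residue hc hc0 hM hAB hA hB hne r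
  rw [← mul_zero (2 : ℝ), ← h, Finset.mul_sum]
  exact Finset.sum_congr rfl fun P _ => by ring

end Ising

/-! ### The Ising partition function -/

section IsingPartition

variable {n : ℕ}

theorem pairOrdered.ne {a b : Fin n → ℝ} (h : pairOrdered a b) {r s : Fin n} (hrs : r ≠ s) :
    a r ≠ a s ∧ b r ≠ b s ∧ a r ≠ b s ∧ b r ≠ a s := by
  have h1 := h.1 r
  have h2 := h.1 s
  rcases lt_or_gt_of_ne hrs with h3 | h3
  · have h4 := h.2 r s h3
    refine ⟨?_, ?_, ?_, ?_⟩ <;> intro h5 <;> linarith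
  · have h4 := h.2 s r h3
    refine ⟨?_, ?_, ?_, ?_⟩ <;> intro h5 <;> linarith

/-- The logarithm of the cross-ratio of two pairs of points. -/
def crossLog (a b : Fin n → ℝ) (r s : Fin n) : ℝ :=
  if r = s then 0 else
    Real.log (a s - a r) + Real.log (b s - b r) - Real.log (b s - a r) - Real.log (a s - b r)

theorem crossLog_comm (a b : Fin n → ℝ) (r s : Fin n) : crossLog a b r s = crossLog a b s r := by
  simp only [crossLog, eq_comm (a := r)]
  rw [← Real.log_neg_eq_log (a s - a r), ← Real.log_neg_eq_log (b s - b r),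
    ← Real.log_neg_eq_log (b s - a r), ← Real.log_neg_eq_log (a s - b r)]
  simp only [neg_sub]
  split_ifs
  · rfl
  · ring

/-- The normalized Ising partition function. -/
def isingNorm (a b : Fin n → ℝ) : ℝ :=
  √((1 / 2) ^ n * ∑ σ, Real.exp (isingEnergy 0 (crossLog a b) σ))

/-- The magnetic field induced by the pair `(p.1, 0)` on the remaining pairs. -/
def isingField (p : ℝ × PairSpace n) (s : Fin n) : ℝ :=
  Real.log (p.2.1 s - p.1) + Real.log (p.2.2 s) - Real.log (p.2.2 s - p.1) - Real.log (p.2.1 s)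

/-- The Ising energy as a function of the positions. -/
def isingPot (σ : Fin n → Bool) (p : ℝ × PairSpace n) : ℝ :=
  isingEnergy (isingField p) (crossLog p.2.1 p.2.2) σ

/-- The Ising partition function with one pair singled out. -/
def isingGas (p : ℝ × PairSpace n) : ℝ :=
  √((1 / 2) ^ n * ∑ σ, Real.exp (isingPot σ p))

theorem isingGas_zero (x : PairSpace n) : isingGas (0, x) = isingNorm x.1 x.2 := by
  have : isingField ((0, x) : ℝ × PairSpace n) = 0 := by
    funext s
    simp [isingField]
  simp only [isingGas, isingPot, this, isingNorm]

theorem region_pos {p : ℝ × PairSpace n} (hp : p ∈ region n) (s : Fin n) :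
    0 < p.2.1 s ∧ 0 < p.2.2 s ∧ 0 < p.2.1 s - p.1 ∧ 0 < p.2.2 s - p.1 := by
  have h1 := hp.1.1 s
  have h2 := hp.2 s
  refine ⟨h2.1, ?_, ?_, ?_⟩ <;> linarith

theorem contDiffAt_isingPot {k : WithTop ℕ∞} {p : ℝ × PairSpace n} (hp : p ∈ region n)
    (σ : Fin n → Bool) : ContDiffAt ℝ k (isingPot σ) p := by
  have hA : ∀ s, ContDiffAt ℝ k (fun q : ℝ × PairSpace n => q.2.1 s) p := fun s => by fun_prop
  have hB : ∀ s, ContDiffAt ℝ k (fun q : ℝ × PairSpace n => q.2.2 s) p := fun s => by fun_prop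
  have hT : ContDiffAt ℝ k (fun q : ℝ × PairSpace n => q.1) p := by fun_prop
  unfold isingPot isingEnergy
  refine (contDiffAt_const.mul (ContDiffAt.sum fun s _ => contDiffAt_const.mul ?_)).add
    (contDiffAt_const.mul (ContDiffAt.sum fun r _ => ContDiffAt.sum fun s _ =>
      contDiffAt_const.mul ?_))
  · obtain ⟨h1, h2, h3, h4⟩ := region_pos hp s
    unfold isingField
    exact (((((hA s).sub hT).log h3.ne').add ((hB s).log h2.ne')).sub
      (((hB s).sub hT).log h4.ne')).sub ((hA s).log h1.ne')
  · unfold crossLog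
    by_cases hrs : r = s
    · simp only [hrs, if_true]
      exact contDiffAt_const
    · simp only [hrs, if_false]
      obtain ⟨h1, h2, h3, h4⟩ := hp.1.ne (Ne.symm hrs)
      exact (((((hA s).sub (hA r)).log (sub_ne_zero.2 h1)).add
        (((hB s).sub (hB r)).log (sub_ne_zero.2 h2))).sub
        (((hB s).sub (hA r)).log (sub_ne_zero.2 h4))).sub
        (((hA s).sub (hB r)).log (sub_ne_zero.2 h3))

theorem isingSum_pos (p : ℝ × PairSpace n) : 0 < ∑ σ, Real.exp (isingPot σ p) :=
  Finset.sum_pos (fun _ _ => Real.exp_pos _) Finset.univ_nonempty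

theorem contDiffAt_isingGas {k : WithTop ℕ∞} {p : ℝ × PairSpace n} (hp : p ∈ region n) :
    ContDiffAt ℝ k isingGas p := by
  unfold isingGas
  refine ContDiffAt.sqrt (contDiffAt_const.mul
    (ContDiffAt.sum fun σ _ => (contDiffAt_isingPot hp σ).exp)) ?_
  have := isingSum_pos p
  positivity

theorem isingGas_sq (p : ℝ × PairSpace n) :
    isingGas p ^ 2 = (1 / 2) ^ n * ∑ σ, Real.exp (isingPot σ p) := by
  have := isingSum_pos p
  exact Real.sq_sqrt (by positivity)

theorem isingGas_pos (p : ℝ × PairSpace n) : 0 < isingGas p := by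
  have := isingSum_pos p
  exact Real.sqrt_pos.2 (by positivity)

theorem fderiv_isingPot {p : ℝ × PairSpace n} (hp : p ∈ region n) (σ : Fin n → Bool)
    (v : ℝ × PairSpace n) : fderiv ℝ (isingPot σ) p v =
      isingEnergy
        (fun s => (v.2.1 s - v.1) / (p.2.1 s - p.1) + v.2.2 s / p.2.2 s -
          (v.2.2 s - v.1) / (p.2.2 s - p.1) - v.2.1 s / p.2.1 s)
        (fun r s => if r = s then 0 else
          (v.2.1 s - v.2.1 r) / (p.2.1 s - p.2.1 r) + (v.2.2 s - v.2.2 r) / (p.2.2 s - p.2.2 r) -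
          (v.2.2 s - v.2.1 r) / (p.2.2 s - p.2.1 r) - (v.2.1 s - v.2.2 r) / (p.2.1 s - p.2.2 r))
        σ := by
  have h1 := ((contDiffAt_isingPot (k := 1) hp σ).differentiableAt
    (by norm_num)).hasFDerivAt.hasLineDerivAt v
  refine h1.unique ?_
  have h : ∀ x y : ℝ, HasDerivAt (fun ε : ℝ => x + ε * y) y 0 := fun x y => by
    simpa using ((hasDerivAt_id (0 : ℝ)).mul_const y).const_add x
  have hl : ∀ x y x' y' : ℝ, x - x' ≠ 0 → HasDerivAt
      (fun ε : ℝ => Real.log (x + ε * y - (x' + ε * y'))) ((y - y') / (x - x')) 0 :=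
    fun x y x' y' hx => by
      simpa using ((h x y).sub (h x' y')).log (by simpa using hx)
  have hl' : ∀ x y : ℝ, x ≠ 0 → HasDerivAt (fun ε : ℝ => Real.log (x + ε * y)) (y / x) 0 :=
    fun x y hx => by simpa using (h x y).log (by simpa using hx)
  unfold HasLineDerivAt isingPot isingEnergy
  refine ((HasDerivAt.fun_sum fun s _ => HasDerivAt.const_mul _ ?_).const_mul _).add
    ((HasDerivAt.fun_sum fun r _ => HasDerivAt.fun_sum fun s _ =>
      HasDerivAt.const_mul _ ?_).const_mul _)
  · obtain ⟨h1, h2, h3, h4⟩ := region_pos hp s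
    exact (((hl _ _ _ _ h3.ne').add (hl' _ _ h2.ne')).sub (hl _ _ _ _ h4.ne')).sub
      (hl' _ _ h1.ne')
  · unfold crossLog
    by_cases hrs : r = s
    · simp only [hrs, if_true]
      exact hasDerivAt_const _ _
    · simp only [hrs, if_false]
      obtain ⟨h1, h2, h3, h4⟩ := hp.1.ne (Ne.symm hrs)
      exact (((hl _ _ _ _ (sub_ne_zero.2 h1)).add (hl _ _ _ _ (sub_ne_zero.2 h2))).sub
        (hl _ _ _ _ (sub_ne_zero.2 h4))).sub (hl _ _ _ _ (sub_ne_zero.2 h3))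

/-- The derivative of `isingPot` in the direction of the first coordinate, up to sign. -/
def spinDiff (k : ℕ) (σ : Fin n → Bool) (p : ℝ × PairSpace n) : ℝ :=
  ∑ s, sgn (σ s) * ((p.2.1 s - p.1)⁻¹ ^ k - (p.2.2 s - p.1)⁻¹ ^ k)

theorem fderiv_isingPot_fst {p : ℝ × PairSpace n} (hp : p ∈ region n) (σ : Fin n → Bool) :
    fderiv ℝ (isingPot σ) p (1, 0) = -(1 / 4) * spinDiff 1 σ p := by
  rw [fderiv_isingPot hp]
  simp only [isingEnergy, spinDiff]
  simp only [Prod.fst_zero, Prod.snd_zero, Pi.zero_apply, sub_zero, zero_div, add_zero, ite_self,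
    mul_zero, Finset.sum_const_zero, zero_sub, pow_one]
  rw [neg_mul, ← mul_neg, ← Finset.sum_neg_distrib]
  congr 1
  refine Finset.sum_congr rfl fun s _ => ?_
  ring

theorem contDiffAt_spinDiff {k : WithTop ℕ∞} {p : ℝ × PairSpace n} (hp : p ∈ region n)
    (σ : Fin n → Bool) : ContDiffAt ℝ k (spinDiff 1 σ) p := by
  have hA : ∀ s, ContDiffAt ℝ k (fun q : ℝ × PairSpace n => q.2.1 s) p := fun s => by fun_prop
  have hB : ∀ s, ContDiffAt ℝ k (fun q : ℝ × PairSpace n => q.2.2 s) p := fun s => by fun_prop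
  have hT : ContDiffAt ℝ k (fun q : ℝ × PairSpace n => q.1) p := by fun_prop
  unfold spinDiff
  refine ContDiffAt.sum fun s _ => contDiffAt_const.mul ?_
  obtain ⟨h1, h2, h3, h4⟩ := region_pos hp s
  exact ((((hA s).sub hT).inv h3.ne').pow 1).sub ((((hB s).sub hT).inv h4.ne').pow 1)

theorem fderiv_spinDiff {p : ℝ × PairSpace n} (hp : p ∈ region n) (σ : Fin n → Bool) :
    fderiv ℝ (spinDiff 1 σ) p (1, 0) = spinDiff 2 σ p := by
  have h1 := ((contDiffAt_spinDiff (k := 1) hp σ).differentiableAt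
    (by norm_num)).hasFDerivAt.hasLineDerivAt (1, 0)
  refine h1.unique ?_
  have h : ∀ x : ℝ, x - p.1 ≠ 0 → HasDerivAt (fun ε : ℝ => (x + ε * 0 - (p.1 + ε * 1))⁻¹ ^ 1)
      ((x - p.1)⁻¹ ^ 2) 0 := fun x hx => by
    have h2 : HasDerivAt (fun ε : ℝ => x + ε * 0 - (p.1 + ε * 1)) (-1) 0 := by
      simpa using ((hasDerivAt_id (0 : ℝ)).const_add p.1).const_sub x
    simpa using (h2.fun_inv (by simpa using hx))
  unfold HasLineDerivAt spinDiff
  refine HasDerivAt.fun_sum fun s _ => HasDerivAt.const_mul _ ?_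
  obtain ⟨h1, h2, h3, h4⟩ := region_pos hp s
  exact (h _ h3.ne').sub (h _ h4.ne')

theorem fderiv_isingPot_drift {p : ℝ × PairSpace n} (hp : p ∈ region n) (σ : Fin n → Bool) :
    fderiv ℝ (isingPot σ) p (0, drift p) = 1 / 4 * p.1 * spinDiff 2 σ p -
      1 / 8 * p.1 * (spinDiff 1 σ p ^ 2 - potential p) := by
  rw [fderiv_isingPot hp]
  set D : Fin n → ℝ := fun s => (p.2.1 s - p.1)⁻¹ - (p.2.2 s - p.1)⁻¹ with hD
  have e1 : ∀ s, (drift p).1 s / (p.2.1 s - p.1) + (drift p).2 s / p.2.2 s -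
      (drift p).2 s / (p.2.2 s - p.1) - (drift p).1 s / p.2.1 s =
      p.1 * ((p.2.1 s - p.1)⁻¹ ^ 2 - (p.2.2 s - p.1)⁻¹ ^ 2) := by
    intro s
    obtain ⟨h1, h2, h3, h4⟩ := region_pos hp s
    have h3' := h3.ne'
    have h4' := h4.ne'
    simp only [drift]
    field_simp
    ring
  have e2 : ∀ r s, (if r = s then 0 else
      ((drift p).1 s - (drift p).1 r) / (p.2.1 s - p.2.1 r) +
        ((drift p).2 s - (drift p).2 r) / (p.2.2 s - p.2.2 r) -
        ((drift p).2 s - (drift p).1 r) / (p.2.2 s - p.2.1 r) -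
        ((drift p).1 s - (drift p).2 r) / (p.2.1 s - p.2.2 r)) =
      -p.1 * (D r * D s) + if r = s then p.1 * D r ^ 2 else 0 := by
    intro r s
    by_cases hrs : r = s
    · simp only [hrs, if_true]
      ring
    · simp only [hrs, if_false]
      have hq : ∀ x y : ℝ, x - p.1 ≠ 0 → y - p.1 ≠ 0 → x ≠ y →
          (x / (x - p.1) - y / (y - p.1)) / (x - y) = -p.1 * ((x - p.1)⁻¹ * (y - p.1)⁻¹) := by
        intro x y h1 h2 h3
        have h3' := sub_ne_zero.2 h3
        field_simp
        ring
      obtain ⟨h1, h2, h3, h4⟩ := hp.1.ne (Ne.symm hrs)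
      obtain ⟨-, -, h5, h6⟩ := region_pos hp r
      obtain ⟨-, -, h7, h8⟩ := region_pos hp s
      simp only [drift, hD]
      rw [hq _ _ h7.ne' h5.ne' h1, hq _ _ h8.ne' h6.ne' h2, hq _ _ h8.ne' h5.ne' h4,
        hq _ _ h7.ne' h6.ne' h3]
      ring
  have hs2 : ∀ b : Bool, sgn b ^ 2 = 1 := fun b => by cases b <;> simp [sgn]
  have e3 : spinDiff 1 σ p = ∑ s, sgn (σ s) * D s := by simp [spinDiff, hD]
  have e4 : potential p = ∑ s, D s ^ 2 := rfl
  have e5 : ∑ r, ∑ s, sgn (σ r) * sgn (σ s) *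
      (-p.1 * (D r * D s) + if r = s then p.1 * D r ^ 2 else 0) =
      -p.1 * (∑ s, sgn (σ s) * D s) ^ 2 + p.1 * ∑ s, D s ^ 2 := by
    simp only [mul_add, Finset.sum_add_distrib, mul_ite, mul_zero, Finset.sum_ite_eq,
      Finset.mem_univ, if_true]
    rw [sq (∑ s, _), Finset.sum_mul_sum, Finset.mul_sum, Finset.mul_sum]
    congr 1
    · refine Finset.sum_congr rfl fun r _ => ?_
      rw [Finset.mul_sum]
      exact Finset.sum_congr rfl fun s _ => by ring
    · exact Finset.sum_congr rfl fun r _ => by linear_combination p.1 * D r ^ 2 * hs2 (σ r)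
  simp only [isingEnergy, sub_zero, e1, e2]
  rw [e5, e3, e4, spinDiff]
  have e6 : ∑ s, sgn (σ s) * (p.1 * ((p.2.1 s - p.1)⁻¹ ^ 2 - (p.2.2 s - p.1)⁻¹ ^ 2)) =
      p.1 * ∑ s, sgn (σ s) * ((p.2.1 s - p.1)⁻¹ ^ 2 - (p.2.2 s - p.1)⁻¹ ^ 2) := by
    rw [Finset.mul_sum]
    exact Finset.sum_congr rfl fun s _ => by ring
  rw [e6]
  ring

end IsingPartition

section IsingEquation

variable {n : ℕ}

theorem sum_isingWeight_mul_spinDiff {p : ℝ × PairSpace n} (hp : p ∈ region n) :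
    ∑ P : (Fin n → Bool) × (Fin n → Bool), Real.exp (isingPot P.1 p) * Real.exp (isingPot P.2 p) *
      (p.1 * (spinDiff 1 P.1 p + spinDiff 1 P.2 p) ^ 2 / 4 +
        p.1 * (spinDiff 2 P.1 p + spinDiff 2 P.2 p) / 2 +
        (spinDiff 1 P.1 p + spinDiff 1 P.2 p)) = 0 := by
  have hpos := region_pos hp
  have hsub : ∀ x y : ℝ, x - p.1 ≠ 0 → y - p.1 ≠ 0 →
      (x - p.1)⁻¹ - (y - p.1)⁻¹ = (y - x) * ((x - p.1)⁻¹ * (y - p.1)⁻¹) := by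
    intro x y h1 h2
    field_simp
    ring
  have hne : ∀ x y : ℝ, x ≠ y → (x - p.1)⁻¹ ≠ (y - p.1)⁻¹ := fun x y hxy h =>
    hxy (sub_left_injective (inv_injective h))
  have key := sum_isingWeight_eq_zero (A := fun s => (p.2.1 s - p.1)⁻¹)
    (B := fun s => (p.2.2 s - p.1)⁻¹) (M := isingField p) (c := crossLog p.2.1 p.2.2) (t := p.1)
    (crossLog_comm _ _) (fun r => by simp [crossLog]) (fun r => ?_) (fun r s hrs => ?_)
    (fun r s hrs => hne _ _ (hp.1.ne hrs).1) (fun r s hrs => hne _ _ (hp.1.ne hrs).2.1)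
    (fun r s hrs => hne _ _ (hp.1.ne hrs).2.2.1)
  · rw [← key]
    refine Finset.sum_congr rfl fun P _ => ?_
    simp only [isingPot, spinDiff, ← Finset.sum_add_distrib, add_mul, pow_one]
  · obtain ⟨h1, h2, h3, h4⟩ := hpos r
    have h1' := h1.ne'
    have h2' := h2.ne'
    have h3' := h3.ne'
    have h4' := h4.ne'
    simp only [isingField]
    rw [Real.exp_sub, Real.exp_sub, Real.exp_add, Real.exp_log h1, Real.exp_log h2,
      Real.exp_log h3, Real.exp_log h4]
    field_simp
    ring
  · obtain ⟨-, -, h3, h4⟩ := hpos r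
    obtain ⟨-, -, h3', h4'⟩ := hpos s
    obtain ⟨g1, g2, g3, g4⟩ := hp.1.ne (Ne.symm hrs)
    have g1' := sub_ne_zero.2 g1
    have g2' := sub_ne_zero.2 g2
    have g3' := sub_ne_zero.2 g3
    have g4' := sub_ne_zero.2 g4
    have hlog : Real.exp (crossLog p.2.1 p.2.2 r s) * ((p.2.2 s - p.2.1 r) * (p.2.1 s - p.2.2 r)) =
        (p.2.1 s - p.2.1 r) * (p.2.2 s - p.2.2 r) := by
      have hexp : Real.exp (crossLog p.2.1 p.2.2 r s) =
          |p.2.1 s - p.2.1 r| * |p.2.2 s - p.2.2 r| /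
            (|p.2.2 s - p.2.1 r| * |p.2.1 s - p.2.2 r|) := by
        simp only [crossLog, hrs, if_false]
        rw [Real.exp_sub, Real.exp_sub, Real.exp_add, Real.exp_log_eq_abs g1',
          Real.exp_log_eq_abs g2', Real.exp_log_eq_abs g3', Real.exp_log_eq_abs g4', div_div]
      have h5 := hp.1.1 r
      have h6 := hp.1.1 s
      rw [hexp]
      rcases lt_or_gt_of_ne hrs with h | h
      · have h7 := hp.1.2 r s h
        rw [abs_of_pos (by linarith), abs_of_pos (by linarith), abs_of_pos (by linarith),
          abs_of_pos (by linarith)]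
        field_simp
      · have h7 := hp.1.2 s r h
        rw [abs_of_neg (by linarith), abs_of_neg (by linarith), abs_of_neg (by linarith),
          abs_of_neg (by linarith)]
        field_simp
    rw [hsub _ _ h3.ne' h4'.ne', hsub _ _ h4.ne' h3'.ne', hsub _ _ h3.ne' h3'.ne',
      hsub _ _ h4.ne' h4'.ne']
    linear_combination ((p.2.1 r - p.1)⁻¹ * (p.2.2 s - p.1)⁻¹ * (p.2.2 r - p.1)⁻¹ *
      (p.2.1 s - p.1)⁻¹) * hlog

theorem isingGas_mul_fderiv {q : ℝ × PairSpace n} (hq : q ∈ region n) (v : ℝ × PairSpace n) :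
    2 * (isingGas q * fderiv ℝ isingGas q v) =
      (1 / 2) ^ n * ∑ σ, Real.exp (isingPot σ q) * fderiv ℝ (isingPot σ) q v := by
  have h1 : HasFDerivAt isingGas (fderiv ℝ isingGas q) q :=
    ((contDiffAt_isingGas (k := 1) hq).differentiableAt (by norm_num)).hasFDerivAt
  have h2 : ∀ σ, HasFDerivAt (isingPot σ) (fderiv ℝ (isingPot σ) q) q := fun σ =>
    ((contDiffAt_isingPot (k := 1) hq σ).differentiableAt (by norm_num)).hasFDerivAt
  have h3 : HasFDerivAt (fun p => isingGas p ^ 2) _ q := h1.pow 2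
  have h4 : HasFDerivAt (fun p => (1 / 2 : ℝ) ^ n * ∑ σ, Real.exp (isingPot σ p)) _ q :=
    (HasFDerivAt.fun_sum fun σ (_ : σ ∈ Finset.univ) => (h2 σ).exp).const_mul ((1 / 2 : ℝ) ^ n)
  simp only [isingGas_sq] at h3
  have h5 := congrArg (fun L => L v) (h3.unique h4)
  simpa [mul_assoc] using h5

theorem isingGas_mul_fderiv_fderiv {p : ℝ × PairSpace n} (hp : p ∈ region n) :
    2 * (isingGas p * fderiv ℝ (fun q => fderiv ℝ isingGas q (1, 0)) p (1, 0) +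
      fderiv ℝ isingGas p (1, 0) ^ 2) =
    (1 / 2) ^ n * ∑ σ, Real.exp (isingPot σ p) *
      (spinDiff 1 σ p ^ 2 / 16 - spinDiff 2 σ p / 4) := by
  have h1 : HasFDerivAt isingGas (fderiv ℝ isingGas p) p :=
    ((contDiffAt_isingGas (k := 1) hp).differentiableAt (by norm_num)).hasFDerivAt
  have h1' : HasFDerivAt (fun q => fderiv ℝ isingGas q (1, 0)) _ p :=
    ((((contDiffAt_isingGas (k := 2) hp).fderiv_right (m := 1) (by norm_num)).clm_apply
      contDiffAt_const).differentiableAt (by norm_num)).hasFDerivAt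
  have h2 : ∀ σ, HasFDerivAt (isingPot σ) (fderiv ℝ (isingPot σ) p) p := fun σ =>
    ((contDiffAt_isingPot (k := 1) hp σ).differentiableAt (by norm_num)).hasFDerivAt
  have h2' : ∀ σ, HasFDerivAt (spinDiff 1 σ) (fderiv ℝ (spinDiff 1 σ) p) p := fun σ =>
    ((contDiffAt_spinDiff (k := 1) hp σ).differentiableAt (by norm_num)).hasFDerivAt
  have h3 : HasFDerivAt (fun q => 2 * (isingGas q * fderiv ℝ isingGas q (1, 0))) _ p :=
    (h1.mul h1').const_mul 2
  have h4 : HasFDerivAt (fun q => (1 / 2 : ℝ) ^ n * ∑ σ, Real.exp (isingPot σ q) *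
      (-(1 / 4) * spinDiff 1 σ q)) _ p :=
    (HasFDerivAt.fun_sum fun σ (_ : σ ∈ Finset.univ) =>
      (h2 σ).exp.mul ((h2' σ).const_mul (-(1 / 4)))).const_mul ((1 / 2 : ℝ) ^ n)
  have h5 : (fun q => 2 * (isingGas q * fderiv ℝ isingGas q (1, 0))) =ᶠ[𝓝 p]
      fun q => (1 / 2 : ℝ) ^ n * ∑ σ, Real.exp (isingPot σ q) * (-(1 / 4) * spinDiff 1 σ q) := by
    filter_upwards [(isOpen_region n).mem_nhds hp] with q hq
    rw [isingGas_mul_fderiv hq]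
    simp only [fderiv_isingPot_fst hq]
  have h6 := congrArg (fun L => L (1, 0)) (h3.unique (h4.congr_of_eventuallyEq h5))
  simp only [_root_.smul_apply, _root_.add_apply, smul_eq_mul,
    _root_.sum_apply, fderiv_isingPot_fst hp, fderiv_spinDiff hp] at h6
  have h7 : ∀ σ, Real.exp (isingPot σ p) * (spinDiff 1 σ p ^ 2 / 16 - spinDiff 2 σ p / 4) =
      Real.exp (isingPot σ p) * (-(1 / 4) * spinDiff 2 σ p) +
        -(1 / 4) * spinDiff 1 σ p * (Real.exp (isingPot σ p) * (-(1 / 4) * spinDiff 1 σ p)) :=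
    fun σ => by ring
  simp only [h7]
  linear_combination h6

theorem pdeOp_isingGas {p : ℝ × PairSpace n} (hp : p ∈ region n) : pdeOp isingGas p = 0 := by
  set e : (Fin n → Bool) → ℝ := fun σ => Real.exp (isingPot σ p) with he
  set X : (Fin n → Bool) → ℝ := fun σ => spinDiff 1 σ p with hX
  set Y : (Fin n → Bool) → ℝ := fun σ => spinDiff 2 σ p with hY
  have h0 := isingGas_sq p
  have h1 := isingGas_mul_fderiv hp (1, 0)
  have h2 := isingGas_mul_fderiv hp (0, drift p)
  have h3 := isingGas_mul_fderiv_fderiv hp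
  simp only [fderiv_isingPot_fst hp] at h1
  simp only [fderiv_isingPot_drift hp] at h2
  have h4 := sum_isingWeight_mul_spinDiff hp
  rw [Fintype.sum_prod_type] at h4
  have hmul : ∀ f g : (Fin n → Bool) → ℝ, (∑ σ, e σ * f σ) * (∑ σ, e σ * g σ) =
      ∑ σ, ∑ τ, e σ * e τ * (f σ * g τ) := fun f g => by
    rw [Finset.sum_mul_sum]
    exact Finset.sum_congr rfl fun σ _ => Finset.sum_congr rfl fun τ _ => by ring
  set S := ∑ σ, e σ with hS
  set S1 := ∑ σ, e σ * X σ with hS1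
  set S2 := ∑ σ, e σ * X σ ^ 2 with hS2
  set T := ∑ σ, e σ * Y σ with hT
  have h5 : p.1 * (2 * S2 * S + 2 * S1 ^ 2) / 4 + p.1 * (2 * T * S) / 2 + 2 * S1 * S = 0 := by
    rw [← h4]
    have g1 := hmul (fun σ => X σ ^ 2) 1
    have g2 := hmul 1 (fun σ => X σ ^ 2)
    have g3 := hmul X X
    have g4 := hmul Y 1
    have g5 := hmul 1 Y
    have g6 := hmul X 1
    have g7 := hmul 1 X
    simp only [Pi.one_apply, mul_one, one_mul, ← hS, ← hS1, ← hS2, ← hT] at g1 g2 g3 g4 g5 g6 g7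
    have g8 : ∑ σ, ∑ τ, e σ * e τ * (p.1 * (X σ + X τ) ^ 2 / 4 + p.1 * (Y σ + Y τ) / 2 +
        (X σ + X τ)) =
        p.1 / 4 * (∑ σ, ∑ τ, e σ * e τ * X σ ^ 2 + ∑ σ, ∑ τ, e σ * e τ * X τ ^ 2 +
          2 * ∑ σ, ∑ τ, e σ * e τ * (X σ * X τ)) +
        p.1 / 2 * (∑ σ, ∑ τ, e σ * e τ * Y σ + ∑ σ, ∑ τ, e σ * e τ * Y τ) +
        (∑ σ, ∑ τ, e σ * e τ * X σ + ∑ σ, ∑ τ, e σ * e τ * X τ) := by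
      simp only [Finset.mul_sum, ← Finset.sum_add_distrib]
      exact Finset.sum_congr rfl fun σ _ => Finset.sum_congr rfl fun τ _ => by ring
    rw [g8, ← g1, ← g2, ← g3, ← g4, ← g5, ← g6, ← g7]
    ring
  have k1 : ∑ σ, e σ * (-(1 / 4) * X σ) = -(1 / 4) * S1 := by
    rw [hS1, Finset.mul_sum]
    exact Finset.sum_congr rfl fun σ _ => by ring
  have k2 : ∑ σ, e σ * (1 / 4 * p.1 * Y σ - 1 / 8 * p.1 * (X σ ^ 2 - potential p)) =
      1 / 4 * p.1 * T - 1 / 8 * p.1 * (S2 - potential p * S) := by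
    simp only [hS, hS2, hT, Finset.mul_sum, ← Finset.sum_sub_distrib]
    exact Finset.sum_congr rfl fun σ _ => by ring
  have k3 : ∑ σ, e σ * (X σ ^ 2 / 16 - Y σ / 4) = S2 / 16 - T / 4 := by
    simp only [hS2, hT, Finset.sum_div, ← Finset.sum_sub_distrib]
    exact Finset.sum_congr rfl fun σ _ => by ring
  rw [k1] at h1
  rw [k2] at h2
  rw [k3] at h3
  rw [pdeOp]
  have hpos := (isingGas_pos p).ne'
  generalize (1 / 2 : ℝ) ^ n = c at *
  generalize fderiv ℝ (fun q => fderiv ℝ isingGas q (1, 0)) p (1, 0) = Ftt at *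
  generalize fderiv ℝ isingGas p (1, 0) = Ft at *
  generalize fderiv ℝ isingGas p (0, drift p) = Fv at *
  generalize potential p = Q at *
  generalize isingGas p = F at *
  refine mul_left_cancel₀ (pow_ne_zero 3 hpos) ?_
  linear_combination 4 / 3 * p.1 * F ^ 2 * h3 - 2 / 3 * p.1 * (2 * (F * Ft) - c / 4 * S1) * h1 +
    4 / 3 * p.1 * c * (S2 / 16 - T / 4) * h0 + 2 / 3 * F ^ 2 * h1 - c / 6 * S1 * h0 +
    F ^ 2 * h2 + c * (1 / 4 * p.1 * T - 1 / 8 * p.1 * (S2 - Q * S)) * h0 -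
    p.1 / 8 * Q * (F ^ 2 + c * S) * h0 - c ^ 2 / 12 * h5

end IsingEquation

/-! ### Equality of the normalized partition functions -/

section Comparison

variable {n : ℕ}

theorem gasInt_eq_cgNorm (p : ℝ × PairSpace n) :
    gasInt p = cgNorm (Fin.cons p.1 p.2.1) (Fin.cons 0 p.2.2) := rfl

theorem gasInt_zero (x : PairSpace n) : gasInt (0, x) = cgNorm x.1 x.2 := by
  unfold gasInt cgNorm
  rw [← integral_betaQPi_tail fun w => Real.exp (3 / 8 * pairSum Real.log (conf x.1 x.2 w))]
  refine integral_congr_ae (Eventually.of_forall fun w => ?_)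
  simp only [gas, energy]
  rw [pairSum_succ]
  simp only [confCons_zero, confCons_succ]
  simp only [zero_mul, sub_zero, Matrix.cons_val_zero, Matrix.cons_val_one, Matrix.cons_val_two,
    Matrix.head_cons, Matrix.tail_cons]
  congr 2
  refine add_eq_right.2 (Finset.sum_eq_zero fun s _ => Finset.sum_eq_zero fun j _ => ?_)
  ring

theorem isingEnergy_not (M : Fin n → ℝ) (c : Fin n → Fin n → ℝ) (σ : Fin n → Bool) :
    isingEnergy M c (fun s => !σ s) = isingEnergy (-M) c σ := by
  have : ∀ b, sgn (!b) = -sgn b := by intro b; cases b <;> simp [sgn]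
  simp [isingEnergy, this]

theorem isingEnergy_cons (p : ℝ × PairSpace n) (β : Bool) (σ : Fin n → Bool) :
    isingEnergy 0 (crossLog (Fin.cons p.1 p.2.1) (Fin.cons 0 p.2.2)) (Fin.cons β σ) =
      isingEnergy (fun s => sgn β * isingField p s) (crossLog p.2.1 p.2.2) σ := by
  have h1 : ∀ s : Fin n, crossLog (Fin.cons p.1 p.2.1) (Fin.cons 0 p.2.2) 0 s.succ =
      isingField p s := fun s => by
    rw [crossLog, if_neg (Fin.succ_ne_zero s).symm]
    simp [isingField]
  have h2 : ∀ s : Fin n, crossLog (Fin.cons p.1 p.2.1) (Fin.cons 0 p.2.2) s.succ 0 =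
      isingField p s := fun s => by rw [crossLog_comm, h1]
  have h3 : ∀ r s : Fin n, crossLog (Fin.cons p.1 p.2.1) (Fin.cons 0 p.2.2) r.succ s.succ =
      crossLog p.2.1 p.2.2 r s := fun r s => by simp [crossLog]
  have h4 : crossLog (Fin.cons p.1 p.2.1 : Fin (n + 1) → ℝ) (Fin.cons 0 p.2.2) 0 0 = 0 := by
    simp [crossLog]
  simp only [isingEnergy, Fin.sum_univ_succ, Fin.cons_zero, Fin.cons_succ, h1, h2, h3, h4,
    Finset.sum_add_distrib, Finset.mul_sum, Pi.zero_apply, mul_zero, Finset.sum_const_zero]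
  have e1 : ∀ s, 1 / 8 * (sgn (σ s) * sgn β * isingField p s) =
    1 / 2 * (1 / 4 * (sgn (σ s) * (sgn β * isingField p s))) := fun s => by ring
  have e2 : ∀ s, 1 / 8 * (sgn β * sgn (σ s) * isingField p s) =
    1 / 2 * (1 / 4 * (sgn (σ s) * (sgn β * isingField p s))) := fun s => by ring
  simp only [mul_add, Finset.mul_sum, e1, e2]
  simp only [← Finset.mul_sum]
  ring

theorem isingNorm_cons (p : ℝ × PairSpace n) :
    isingNorm (Fin.cons p.1 p.2.1) (Fin.cons 0 p.2.2) = isingGas p := by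
  unfold isingNorm isingGas
  congr 1
  rw [← (Fin.consEquiv fun _ => Bool).sum_comp, Fintype.sum_prod_type, Fintype.sum_bool]
  simp only [Fin.consEquiv, Equiv.coe_fn_mk, isingEnergy_cons]
  have h : ∑ σ : Fin n → Bool, Real.exp (isingEnergy (fun s => sgn false * isingField p s)
      (crossLog p.2.1 p.2.2) σ) = ∑ σ, Real.exp (isingPot σ p) := by
    rw [← (Equiv.piCongrRight fun _ : Fin n => Equiv.boolNot).sum_comp]
    refine Finset.sum_congr rfl fun σ _ => ?_
    congr 1
    refine (isingEnergy_not _ _ σ).trans ?_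
    rw [isingPot]
    congr 1
    funext s
    simp [sgn]
  rw [h]
  have h' : ∑ σ : Fin n → Bool, Real.exp (isingEnergy (fun s => sgn true * isingField p s)
      (crossLog p.2.1 p.2.2) σ) = ∑ σ, Real.exp (isingPot σ p) := by
    simp [sgn, isingPot]
  rw [h']
  ring

/-- The complexification of `gas` in the position of the moving point. -/
def gasC (x : PairSpace n) (P : ℂ × (Fin (n + 1) → ℂ)) : ℂ :=
  Complex.exp (3 / 8 * pairSum Complex.log
    (confCons P.1 (fun r => (x.1 r : ℂ)) (fun r => (x.2 r : ℂ)) P.2))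

theorem confCons_re (x : PairSpace n) (z : ℂ) (w : Fin (n + 1) → ℝ) (r : Fin (n + 1)) (i : Fin 3) :
    (confCons z (fun r => (x.1 r : ℂ)) (fun r => (x.2 r : ℂ)) (fun s => (w s : ℂ)) r i).re =
      confCons z.re x.1 x.2 w r i := by
  refine Fin.cases ?_ (fun r => ?_) r
  · simp only [confCons_zero]
    fin_cases i <;> simp
  · simp only [confCons_succ, conf, Fin.tail]
    fin_cases i <;> simp

theorem confCons_ofReal (x : PairSpace n) (t : ℝ) (w : Fin (n + 1) → ℝ) (r : Fin (n + 1))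
    (i : Fin 3) :
    confCons (t : ℂ) (fun r => (x.1 r : ℂ)) (fun r => (x.2 r : ℂ)) (fun s => (w s : ℂ)) r i =
      ((confCons t x.1 x.2 w r i : ℝ) : ℂ) := by
  refine Fin.cases ?_ (fun r => ?_) r
  · simp only [confCons_zero]
    fin_cases i <;> simp
  · simp only [confCons_succ, conf, Fin.tail]
    fin_cases i <;> simp

theorem contDiffAt_gasC {x : PairSpace n} {k : WithTop ℕ∞} {z : ℂ} (hz : (z.re, x) ∈ region n)
    {w : Fin (n + 1) → ℝ} (hw : w ∈ unitCube (n + 1)) :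
    ContDiffAt ℂ k (gasC x) (z, fun s => (w s : ℂ)) := by
  unfold gasC
  refine (contDiffAt_const.mul (ContDiffAt.pairSum (fun r i => ?_) fun r s hrs i j => ?_)).cexp
  · exact (contDiff_confCons (by fun_prop) (by fun_prop) (by fun_prop) (by fun_prop) r i).contDiffAt
  · refine Complex.contDiffAt_log (Or.inl ?_)
    rw [Complex.sub_re, confCons_re, confCons_re]
    exact sub_pos.2 (confCons_lt hz hw hrs i j)

theorem gasC_ofReal {x : PairSpace n} {t : ℝ} (ht : (t, x) ∈ region n)
    {w : Fin (n + 1) → ℝ} (hw : w ∈ unitCube (n + 1)) :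
    gasC x (t, fun s => (w s : ℂ)) = (gas ((t, x), w) : ℝ) := by
  simp only [gasC, gas, energy, pairSum]
  push_cast
  congr 2
  refine Finset.sum_congr rfl fun r _ => Finset.sum_congr rfl fun s _ => ?_
  by_cases hrs : r < s
  · simp only [hrs, if_true]
    push_cast
    refine Finset.sum_congr rfl fun i _ => Finset.sum_congr rfl fun j _ => ?_
    rw [confCons_ofReal, confCons_ofReal, ← Complex.ofReal_sub, Complex.ofReal_log]
    exact (sub_pos.2 (confCons_lt ht hw hrs i j)).le
  · simp [hrs]

theorem analyticAt_gasInt {p : ℝ × PairSpace n} (hp : p ∈ region n) :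
    AnalyticAt ℝ (fun t => gasInt (t, p.2)) p.1 := by
  obtain ⟨t, x⟩ := p
  have hH : IsOpen {z : ℂ | (z.re, x) ∈ region n} :=
    (isOpen_region n).preimage (by fun_prop)
  have hK := contDiffOn_integral_of_isCompact (𝕜 := ℂ) (isCompact_unitCube (n + 1))
    (betaQPi_restrict _) (ι := fun w : Fin (n + 1) → ℝ => fun s => (w s : ℂ)) (by fun_prop) hH 1
    (F := gasC x) fun z hz w hw => contDiffAt_gasC hz hw
  have hd := hK.differentiableOn (by norm_num)
  have ha := hd.analyticAt (hH.mem_nhds (x := (t : ℂ)) hp)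
  have hre := Complex.reCLM.analyticAt
    (∫ w, gasC x ((t : ℂ), fun s => ((w s : ℝ) : ℂ)) ∂betaQPi (n + 1))
  have h1 : AnalyticAt ℝ (fun s : ℝ =>
      (∫ w, gasC x ((s : ℂ), fun r => ((w r : ℝ) : ℂ)) ∂betaQPi (n + 1)).re) t :=
    AnalyticAt.comp (g := Complex.reCLM) hre
      ((ha.restrictScalars (𝕜 := ℝ)).comp (Complex.ofRealCLM.analyticAt t))
  refine h1.congr ?_
  have hopen : ∀ᶠ s in 𝓝 t, (s, x) ∈ region n :=
    ((isOpen_region n).preimage (f := fun s : ℝ => (s, x)) (by fun_prop)).mem_nhds hp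
  filter_upwards [hopen] with s hs
  have : ∫ w, gasC x ((s : ℂ), fun r => ((w r : ℝ) : ℂ)) ∂betaQPi (n + 1) =
      ((gasInt (s, x) : ℝ) : ℂ) := by
    rw [gasInt, ← integral_complex_ofReal]
    refine integral_congr_ae ?_
    filter_upwards [ae_mem_unitCube (n + 1)] with w hw using gasC_ofReal hs hw
  rw [this, Complex.ofReal_re]

theorem analyticAt_isingGas {p : ℝ × PairSpace n} (hp : p ∈ region n) :
    AnalyticAt ℝ (fun t => isingGas (t, p.2)) p.1 := by
  have h := (contDiffAt_isingGas (k := ⊤) hp).analyticAt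
  exact h.comp (f := fun t : ℝ => (t, p.2)) (analyticAt_id.prod analyticAt_const)

theorem pdeOp_sub {D E : ℝ × PairSpace n → ℝ} (hD : ContDiffOn ℝ 2 D (region n))
    (hE : ContDiffOn ℝ 2 E (region n)) {p : ℝ × PairSpace n} (hp : p ∈ region n) :
    pdeOp (fun q => D q - E q) p = pdeOp D p - pdeOp E p := by
  have hH := isOpen_region n
  have cd : ∀ q ∈ region n, ContDiffAt ℝ 2 D q := fun q hq => hD.contDiffAt (hH.mem_nhds hq)
  have ce : ∀ q ∈ region n, ContDiffAt ℝ 2 E q := fun q hq => hE.contDiffAt (hH.mem_nhds hq)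
  have h1 : ∀ q ∈ region n, fderiv ℝ (fun q => D q - E q) q = fderiv ℝ D q - fderiv ℝ E q :=
    fun q hq => fderiv_fun_sub ((cd q hq).differentiableAt (by norm_num))
      ((ce q hq).differentiableAt (by norm_num))
  have h2 : (fun q => fderiv ℝ (fun q => D q - E q) q (1, 0)) =ᶠ[𝓝 p]
      fun q => fderiv ℝ D q (1, 0) - fderiv ℝ E q (1, 0) := by
    filter_upwards [hH.mem_nhds hp] with q hq
    rw [h1 q hq]
    rfl
  have dd : DifferentiableAt ℝ (fun q => fderiv ℝ D q (1, 0)) p :=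
    ((((cd p hp).fderiv_right (m := 1) (by norm_num)).clm_apply
      contDiffAt_const).differentiableAt (by norm_num))
  have de : DifferentiableAt ℝ (fun q => fderiv ℝ E q (1, 0)) p :=
    ((((ce p hp).fderiv_right (m := 1) (by norm_num)).clm_apply
      contDiffAt_const).differentiableAt (by norm_num))
  unfold pdeOp
  rw [h2.fderiv_eq, fderiv_fun_sub dd de, h1 p hp]
  simp only [_root_.sub_apply]
  ring

theorem gasInt_eq_isingGas
    (ih : ∀ a b : Fin n → ℝ, pairOrdered a b → cgNorm a b = isingNorm a b)
    {p : ℝ × PairSpace n} (hp : p ∈ region n) : gasInt p = isingGas p := by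
  have hI : ∀ k : ℕ, ContDiffOn ℝ k (isingGas (n := n)) (region n) := fun k q hq =>
    (contDiffAt_isingGas hq).contDiffWithinAt
  refine sub_eq_zero.1 (eq_zero_of_pdeOp (D := fun q => gasInt q - isingGas q)
    (fun k => (contDiffOn_gasInt k).sub (hI k)) (fun q hq => ?_) (fun x hx => ?_) (fun q hq => ?_)
    p hp)
  · rw [pdeOp_sub (contDiffOn_gasInt 2) (hI 2) hq, pdeOp_gasInt hq, pdeOp_isingGas hq, sub_zero]
  · simp only [gasInt_zero, isingGas_zero, ih _ _ hx.1, sub_self]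
  · exact (analyticAt_gasInt hq).sub (analyticAt_isingGas hq)

theorem cgNorm_sub (a b : Fin n → ℝ) (c : ℝ) :
    cgNorm (fun r => a r - c) (fun r => b r - c) = cgNorm a b := by
  have h : ∀ w r i, conf (fun r => a r - c) (fun r => b r - c) w r i = conf a b w r i - c := by
    intro w r i
    fin_cases i <;> simp [conf]
    ring
  simp only [cgNorm, pairSum, h, sub_sub_sub_cancel_right]

theorem isingNorm_sub (a b : Fin n → ℝ) (c : ℝ) :
    isingNorm (fun r => a r - c) (fun r => b r - c) = isingNorm a b := by
  have h : crossLog (fun r => a r - c) (fun r => b r - c) = crossLog a b := by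
    funext r s
    simp only [crossLog, sub_sub_sub_cancel_right]
  rw [isingNorm, isingNorm, h]

theorem cgNorm_eq_isingNorm : ∀ {n : ℕ} {a b : Fin n → ℝ}, pairOrdered a b →
    cgNorm a b = isingNorm a b
  | 0, a, b, _ => by simp [cgNorm, isingNorm, pairSum, isingEnergy]
  | n + 1, a, b, h => by
    rw [← cgNorm_sub a b (b 0), ← isingNorm_sub a b (b 0)]
    have ha : (fun r => a r - b 0) = Fin.cons (a 0 - b 0) fun r : Fin n => a r.succ - b 0 := by
      funext r
      refine Fin.cases ?_ (fun r => ?_) r <;> simp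
    have hb : (fun r => b r - b 0) = Fin.cons 0 fun r : Fin n => b r.succ - b 0 := by
      funext r
      refine Fin.cases ?_ (fun r => ?_) r <;> simp
    rw [ha, hb]
    have hp : ((a 0 - b 0, (fun r : Fin n => a r.succ - b 0), fun r : Fin n => b r.succ - b 0) :
        ℝ × PairSpace n) ∈ region n := by
      refine ⟨⟨fun r => sub_lt_sub_right (h.1 r.succ) _, fun r s hrs => sub_lt_sub_right
        (h.2 r.succ s.succ (Fin.succ_lt_succ_iff.2 hrs)) _⟩, fun r => ?_⟩
      have h1 := h.2 0 r.succ (Fin.succ_pos r)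
      have h2 := h.1 0
      constructor
      · change 0 < a r.succ - b 0
        linarith
      · change a 0 - b 0 < a r.succ - b 0
        linarith
    have := gasInt_eq_isingGas (fun a b hab => cgNorm_eq_isingNorm hab) hp
    rw [gasInt_eq_cgNorm, ← isingNorm_cons] at this
    exact this

end Comparison

/-! ### Products over pairs -/

theorem prod_idx {M : Type*} [CommMonoid M] {N : ℕ} (f : Fin (2 * N) → M) :
    ∏ i, f i = ∏ r, f (idxA N r) * f (idxB N r) := by
  rw [← (finProdFinEquiv.trans (finCongr (mul_comm N 2))).prod_comp, Fintype.prod_prod_type]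
  refine Finset.prod_congr rfl fun r _ => ?_
  rw [Fin.prod_univ_two]
  congr 2
  · ext; simp [idxA]
  · ext; simp [idxB]; omega

@[to_additive]
theorem prod_prod_eq_diag_mul {M : Type*} [CommMonoid M] {N : ℕ} (f : Fin N → Fin N → M) :
    ∏ r, ∏ s, f r s = (∏ r, f r r) * ∏ r, ∏ s, if r < s then f r s * f s r else 1 := by
  have h : ∀ r s, f r s = (if r = s then f r r else 1) * ((if r < s then f r s else 1) *
      if s < r then f r s else 1) := fun r s => by
    rcases lt_trichotomy r s with h | h | h
    · simp [h, h.ne, h.not_gt]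
    · simp [h]
    · simp [h, h.ne', h.not_gt]
  rw [Finset.prod_congr rfl fun r _ => Finset.prod_congr rfl fun s _ => h r s]
  simp_rw [Finset.prod_mul_distrib]
  rw [Finset.prod_comm (f := fun r s => if s < r then f r s else 1), ← Finset.prod_mul_distrib]
  congr 1
  · simp
  · refine Finset.prod_congr rfl fun r _ => ?_
    rw [← Finset.prod_mul_distrib]
    refine Finset.prod_congr rfl fun s _ => ?_
    split_ifs <;> simp

theorem pairOrdered_of_strictMono {N : ℕ} {x : Fin (2 * N) → ℝ} (hx : StrictMono x) :
    pairOrdered (fun r => x (idxA N r)) fun r => x (idxB N r) := by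
  refine ⟨fun r => hx ?_, fun r s hrs => hx ?_⟩
  · simp [idxA, idxB]
  · have := Fin.lt_def.1 hrs
    simp only [idxA, idxB, Fin.mk_lt_mk]
    omega

/-! ### The Ising side -/

theorem Ynn_eq {N : ℕ} {x : Fin (2 * N) → ℝ} (hx : StrictMono x) :
    Ynn N x = √2 ^ N * isingNorm (fun r => x (idxA N r)) fun r => x (idxB N r) := by
  have h := pairOrdered_of_strictMono hx
  set a := fun r => x (idxA N r) with ha
  set b := fun r => x (idxB N r) with hb
  have hS : ∀ σ : Fin N → Bool, (∏ s : Fin N, ∏ t : Fin N, if s < t then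
      crossRatioR (x (idxA N s)) (x (idxA N t)) (x (idxB N t)) (x (idxB N s)) ^
        (sgn (σ s) * sgn (σ t) / 4) else 1) = Real.exp (isingEnergy 0 (crossLog a b) σ) := by
    intro σ
    have hE : isingEnergy 0 (crossLog a b) σ = ∑ s, ∑ t, if s < t then
        sgn (σ s) * sgn (σ t) / 4 * crossLog a b s t else 0 := by
      rw [isingEnergy, sum_sum_eq_diag_add]
      have h0 : ∀ r, crossLog a b r r = 0 := fun r => by simp [crossLog]
      simp only [Pi.zero_apply, mul_zero, Finset.sum_const_zero, h0, zero_add, Finset.mul_sum]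
      refine Finset.sum_congr rfl fun r _ => Finset.sum_congr rfl fun s _ => ?_
      split_ifs
      · rw [crossLog_comm a b s r]
        ring
      · simp
    rw [hE, Real.exp_sum]
    refine Finset.prod_congr rfl fun s _ => ?_
    rw [Real.exp_sum]
    refine Finset.prod_congr rfl fun t _ => ?_
    split_ifs with hst
    · have h1 := h.1 s
      have h2 := h.1 t
      have h3 := h.2 s t hst
      have p1 : 0 < a t - a s := by linarith
      have p2 : 0 < b t - b s := by linarith
      have p3 : 0 < b t - a s := by linarith
      have p4 : 0 < a t - b s := by linarith
      have e : crossRatioR (a s) (a t) (b t) (b s) = Real.exp (crossLog a b s t) := by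
        rw [crossRatioR, crossLog, if_neg hst.ne, abs_of_pos p1, abs_sub_comm, abs_of_pos p2,
          abs_of_pos p3, abs_sub_comm, abs_of_pos p4, Real.exp_sub, Real.exp_sub, Real.exp_add,
          Real.exp_log p1, Real.exp_log p2, Real.exp_log p3, Real.exp_log p4, div_div]
      change crossRatioR (a s) (a t) (b t) (b s) ^ _ = _
      rw [e, ← Real.exp_mul]
      ring_nf
    · simp
  have h2 : √2 ^ N = √(2 ^ N) := by
    rw [eq_comm, Real.sqrt_eq_iff_mul_self_eq (by positivity) (by positivity), ← mul_pow,
      Real.mul_self_sqrt two_pos.le]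
  rw [Ynn, isingNorm, ← Real.sqrt_eq_rpow, h2, ← Real.sqrt_mul (by positivity),
    ← mul_assoc, ← mul_pow]
  simp only [hS]
  norm_num

/-! ### The Coulomb gas side -/

theorem cgConst_eq : cgConst (16 / 3) = √2 * (1 / ProbabilityTheory.beta (1 / 4) (1 / 4)) := by
  have hq : qexp (16 / 3) = 2 := by
    rw [qexp, show 4 * Real.pi / (16 / 3) = Real.pi - Real.pi / 4 by ring, Real.cos_pi_sub,
      Real.cos_pi_div_four, neg_sq, div_pow, Real.sq_sqrt two_pos.le]
    norm_num
  rw [cgConst, hq, ProbabilityTheory.beta]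
  norm_num
  rw [sq]
  ring

/-- The density of the screening charge between `a` and `b`. -/
def betaDensity (a b : ℝ) : ℝ → ℝ :=
  (Set.Ioo a b).indicator fun u => 1 / ProbabilityTheory.beta (1 / 4) (1 / 4) *
    (b - a) ^ (1 / 2 : ℝ) * (u - a) ^ (-(3 / 4) : ℝ) * (b - u) ^ (-(3 / 4) : ℝ)

theorem betaDensity_nonneg (a b u : ℝ) : 0 ≤ betaDensity a b u := by
  refine Set.indicator_nonneg (fun u hu => ?_) u
  have := ProbabilityTheory.beta_pos (α := 1 / 4) (β := 1 / 4) (by norm_num) (by norm_num)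
  have h1 := sub_pos.2 hu.1
  have h2 := sub_pos.2 hu.2
  have h3 := sub_pos.2 (hu.1.trans hu.2)
  positivity

theorem measurable_betaDensity (a b : ℝ) : Measurable (betaDensity a b) :=
  Measurable.indicator (by fun_prop) measurableSet_Ioo

theorem map_betaQ {a b : ℝ} (h : a < b) : betaQ.map (fun w => b + (a - b) * w) =
    volume.withDensity fun u => ENNReal.ofReal (betaDensity a b u) := by
  have hm : Measurable fun w : ℝ => b + (a - b) * w := by fun_prop
  have hab : 0 < b - a := sub_pos.2 h
  have hinj : Function.Injective fun w : ℝ => b + (a - b) * w := fun w v hwv => by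
    have : (a - b) * (w - v) = 0 := by
      simp only at hwv
      linarith
    rcases mul_eq_zero.1 this with h1 | h1 <;> linarith
  have hsurj : Function.Surjective fun w : ℝ => b + (a - b) * w := fun u => by
    refine ⟨(u - b) / (a - b), ?_⟩
    have : a - b ≠ 0 := by linarith
    field_simp
    ring
  ext s hs
  rw [Measure.map_apply hm hs, withDensity_apply _ hs, betaQ, ProbabilityTheory.betaMeasure,
    withDensity_apply _ (hm hs)]
  conv_rhs => rw [← Set.image_preimage_eq s hsurj]
  rw [lintegral_image_eq_lintegral_abs_deriv_mul (f' := fun _ => a - b) (hm hs)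
    (fun w _ => ?_) hinj.injOn]
  · refine setLIntegral_congr_fun (hm hs) fun w _ => ?_
    simp only [ProbabilityTheory.betaPDF]
    rw [← ENNReal.ofReal_mul (abs_nonneg _), abs_sub_comm, abs_of_pos hab]
    congr 1
    by_cases hw : 0 < w ∧ w < 1
    · have h1 : b + (a - b) * w ∈ Set.Ioo a b := by
        constructor <;> nlinarith [mul_pos hab hw.1, mul_pos hab (sub_pos.2 hw.2)]
      rw [betaDensity, Set.indicator_of_mem h1, ProbabilityTheory.betaPDFReal, if_pos hw,
        show b + (a - b) * w - a = (b - a) * (1 - w) by ring,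
        show b - (b + (a - b) * w) = (b - a) * w by ring,
        Real.mul_rpow hab.le (sub_pos.2 hw.2).le, Real.mul_rpow hab.le hw.1.le]
      have h2 : (b - a) * (b - a) ^ (1 / 2 : ℝ) * (b - a) ^ (-(3 / 4) : ℝ) *
          (b - a) ^ (-(3 / 4) : ℝ) = 1 := by
        rw [← Real.rpow_one_add' hab.le (by norm_num), ← Real.rpow_add hab, ← Real.rpow_add hab]
        norm_num
      have h3 : (1 / 4 - 1 : ℝ) = -(3 / 4) := by norm_num
      rw [h3]
      linear_combination (-(1 / ProbabilityTheory.beta (1 / 4) (1 / 4) * w ^ (-(3 / 4) : ℝ) *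
        (1 - w) ^ (-(3 / 4) : ℝ))) * h2
    · have h1 : b + (a - b) * w ∉ Set.Ioo a b := fun h1 => hw
        ⟨by nlinarith [h1.2], by nlinarith [h1.1]⟩
      rw [betaDensity, Set.indicator_of_notMem h1, ProbabilityTheory.betaPDFReal, if_neg hw,
        mul_zero]
  · have h1 := ((hasDerivAt_id w).const_mul (a - b)).const_add b
    exact (h1.congr_deriv (mul_one _)).hasDerivWithinAt

theorem integrable_betaDensity {a b : ℝ} (h : a < b) : Integrable (betaDensity a b) := by
  refine ⟨(measurable_betaDensity a b).aestronglyMeasurable, ?_⟩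
  rw [hasFiniteIntegral_iff_ofReal (Eventually.of_forall (betaDensity_nonneg a b)),
    ← setLIntegral_univ, ← withDensity_apply _ MeasurableSet.univ, ← map_betaQ h]
  have : IsProbabilityMeasure betaQ :=
    ProbabilityTheory.isProbabilityMeasureBeta (by norm_num) (by norm_num)
  exact measure_lt_top _ _

theorem pi_withDensity_ofReal {n : ℕ} {k : Fin n → ℝ → ℝ} (hk0 : ∀ r u, 0 ≤ k r u)
    (hk : ∀ r, Integrable (k r)) :
    Measure.pi (fun r => volume.withDensity fun u => ENNReal.ofReal (k r u)) =
      (volume : Measure (Fin n → ℝ)).withDensity fun u => ENNReal.ofReal (∏ r, k r (u r)) := by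
  refine Measure.pi_eq fun s hs => ?_
  rw [withDensity_apply _ (MeasurableSet.univ_pi hs), volume_pi, Measure.restrict_pi_pi,
    ← ofReal_integral_eq_lintegral_ofReal, integral_fintype_prod_eq_prod,
    ENNReal.ofReal_prod_of_nonneg]
  · refine Finset.prod_congr rfl fun r _ => ?_
    rw [withDensity_apply _ (hs r), ← ofReal_integral_eq_lintegral_ofReal (hk r).integrableOn
      (Eventually.of_forall (hk0 r))]
  · exact fun r _ => integral_nonneg (hk0 r)
  · exact Integrable.fintype_prod fun r => (hk r).integrableOn
  · exact Eventually.of_forall fun u => Finset.prod_nonneg fun r _ => hk0 r (u r)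

theorem cgNorm_eq_integral {n : ℕ} {a b : Fin n → ℝ} (h : ∀ r, a r < b r) :
    cgNorm a b = ∫ u : Fin n → ℝ, (∏ r, betaDensity (a r) (b r) (u r)) *
      Real.exp (3 / 8 * pairSum Real.log fun r => ![a r, b r, u r]) := by
  have hmeas : Measurable fun u : Fin n → ℝ =>
      Real.exp (3 / 8 * pairSum Real.log fun r => ![a r, b r, u r]) := by
    have hz : ∀ r i, Measurable fun u : Fin n → ℝ => (![a r, b r, u r] : Fin 3 → ℝ) i := by
      intro r i
      fin_cases i
      · exact measurable_const
      · exact measurable_const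
      · exact measurable_pi_apply r
    unfold pairSum
    refine Real.measurable_exp.comp (measurable_const.mul
      (Finset.measurable_fun_sum _ fun r _ => Finset.measurable_fun_sum _ fun s _ => ?_))
    split_ifs
    · exact Finset.measurable_fun_sum _ fun i _ => Finset.measurable_fun_sum _ fun j _ =>
        measurable_const.mul (Real.measurable_log.comp ((hz s j).sub (hz r i)))
    · exact measurable_const
  have hmap : (betaQPi n).map (fun w r => b r + (a r - b r) * w r) =
      volume.withDensity fun u => ENNReal.ofReal (∏ r, betaDensity (a r) (b r) (u r)) := by
    rw [← pi_withDensity_ofReal (fun r => betaDensity_nonneg (a r) (b r))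
      fun r => integrable_betaDensity (h r)]
    simp_rw [fun r => (map_betaQ (h r)).symm]
    have : IsProbabilityMeasure betaQ :=
      ProbabilityTheory.isProbabilityMeasureBeta (by norm_num) (by norm_num)
    exact Measure.pi_map_pi (f := fun r w => b r + (a r - b r) * w) fun r => by fun_prop
  have h1 : cgNorm a b = ∫ u, Real.exp (3 / 8 * pairSum Real.log fun r => ![a r, b r, u r])
      ∂(betaQPi n).map (fun w r => b r + (a r - b r) * w r) := by
    rw [integral_map (measurable_pi_lambda _ fun r => by fun_prop).aemeasurable
      hmeas.aestronglyMeasurable]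
    rfl
  rw [h1, hmap, integral_withDensity_eq_integral_toReal_smul]
  · refine integral_congr_ae (Eventually.of_forall fun u => ?_)
    simp only [smul_eq_mul]
    rw [ENNReal.toReal_ofReal (Finset.prod_nonneg fun r _ => betaDensity_nonneg _ _ _)]
  · exact (Finset.measurable_fun_prod _ fun r _ =>
      (measurable_betaDensity _ _).comp (measurable_pi_apply r)).ennreal_ofReal
  · simp

theorem prod_endpoints {N : ℕ} (x : Fin (2 * N) → ℝ) (α : ℝ) :
    (∏ i : Fin (2 * N), ∏ k : Fin (2 * N), if i < k then (x k - x i) ^ α else 1) =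
      (∏ r, (x (idxB N r) - x (idxA N r)) ^ α) * ∏ r, ∏ s, if r < s then
        (x (idxA N s) - x (idxA N r)) ^ α * (x (idxB N s) - x (idxA N r)) ^ α *
        ((x (idxA N s) - x (idxB N r)) ^ α * (x (idxB N s) - x (idxB N r)) ^ α) else 1 := by
  rw [prod_idx]
  simp only [prod_idx (N := N), ← Finset.prod_mul_distrib]
  rw [prod_prod_eq_diag_mul fun r s =>
    (if idxA N r < idxA N s then (x (idxA N s) - x (idxA N r)) ^ α else 1) *
      (if idxA N r < idxB N s then (x (idxB N s) - x (idxA N r)) ^ α else 1) *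
    ((if idxB N r < idxA N s then (x (idxA N s) - x (idxB N r)) ^ α else 1) *
      if idxB N r < idxB N s then (x (idxB N s) - x (idxB N r)) ^ α else 1)]
  refine Eq.trans ?_ Finset.prod_mul_distrib.symm
  congr 1
  · refine Finset.prod_congr rfl fun r _ => ?_
    simp [idxA, idxB]
  · refine Finset.prod_congr rfl fun r _ => Finset.prod_congr rfl fun s _ => ?_
    by_cases hrs : r < s
    · rw [if_pos hrs, if_pos hrs]
      have h := Fin.lt_def.1 hrs
      have e1 : idxA N r < idxA N s := by simp only [idxA, Fin.mk_lt_mk]; omega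
      have e2 : idxA N r < idxB N s := by simp only [idxA, idxB, Fin.mk_lt_mk]; omega
      have e3 : idxB N r < idxA N s := by simp only [idxA, idxB, Fin.mk_lt_mk]; omega
      have e4 : idxB N r < idxB N s := by simp only [idxB, Fin.mk_lt_mk]; omega
      simp [e1, e2, e3, e4, e1.not_gt, e2.not_gt, e3.not_gt, e4.not_gt]
    · rw [if_neg hrs, if_neg hrs]

theorem cgIntegrand_eq {N : ℕ} {x : Fin (2 * N) → ℝ} (hx : StrictMono x) {u : Fin N → ℝ}
    (hu : u ∈ cgBox N x) :
    cgConst (16 / 3) ^ N * (∏ i : Fin (2 * N), ∏ k : Fin (2 * N),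
        if i < k then (x k - x i) ^ (2 / (16 / 3) : ℝ) else 1) * cgIntegrand (16 / 3) N x u =
      √2 ^ N * (∏ r, (x (idxB N r) - x (idxA N r)) ^ (-(1 / 8) : ℝ)) *
        ((∏ r, betaDensity (x (idxA N r)) (x (idxB N r)) (u r)) *
          Real.exp (3 / 8 * pairSum Real.log fun r => ![x (idxA N r), x (idxB N r), u r])) := by
  have h := pairOrdered_of_strictMono hx
  have hu' : ∀ r, x (idxA N r) < u r ∧ u r < x (idxB N r) := fun r => hu r trivial
  rw [cgIntegrand, prod_endpoints]
  simp only [prod_idx (N := N)]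
  rw [prod_prod_eq_diag_mul (fun r s => |u r - x (idxA N s)| ^ (-(4 / (16 / 3)) : ℝ) *
    |u r - x (idxB N s)| ^ (-(4 / (16 / 3)) : ℝ)), pairSum, Finset.mul_sum, Real.exp_sum]
  simp only [Finset.mul_sum, Real.exp_sum]
  have hpair : (∏ r, ∏ s, if r < s then
        (x (idxA N s) - x (idxA N r)) ^ (2 / (16 / 3) : ℝ) *
          (x (idxB N s) - x (idxA N r)) ^ (2 / (16 / 3) : ℝ) *
        ((x (idxA N s) - x (idxB N r)) ^ (2 / (16 / 3) : ℝ) *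
          (x (idxB N s) - x (idxB N r)) ^ (2 / (16 / 3) : ℝ)) else 1) *
      (∏ r, ∏ s, if r < s then (u s - u r) ^ (8 / (16 / 3) : ℝ) else 1) *
      (∏ r, ∏ s, if r < s then
        |u r - x (idxA N s)| ^ (-(4 / (16 / 3)) : ℝ) *
          |u r - x (idxB N s)| ^ (-(4 / (16 / 3)) : ℝ) *
        (|u s - x (idxA N r)| ^ (-(4 / (16 / 3)) : ℝ) *
          |u s - x (idxB N r)| ^ (-(4 / (16 / 3)) : ℝ)) else 1) =
      ∏ r, ∏ s, Real.exp (3 / 8 * if r < s then ∑ i, ∑ j, (chg i : ℝ) * chg j * Real.log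
        ((![x (idxA N s), x (idxB N s), u s] : Fin 3 → ℝ) j -
          (![x (idxA N r), x (idxB N r), u r] : Fin 3 → ℝ) i) else 0) := by
    simp only [← Finset.prod_mul_distrib]
    refine Finset.prod_congr rfl fun r _ => Finset.prod_congr rfl fun s _ => ?_
    split_ifs with hrs
    · have h1 := h.1 r
      have h2 := h.1 s
      have h3 := h.2 r s hrs
      have h4 := hu' r
      have h5 := hu' s
      simp only at h1 h2 h3
      rw [abs_sub_comm (u r) (x (idxA N s)), abs_sub_comm (u r) (x (idxB N s)),
        abs_of_pos (a := x (idxA N s) - u r) (by linarith),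
        abs_of_pos (a := x (idxB N s) - u r) (by linarith),
        abs_of_pos (a := u s - x (idxA N r)) (by linarith),
        abs_of_pos (a := u s - x (idxB N r)) (by linarith)]
      simp only [Fin.sum_univ_three, chg, Matrix.cons_val_zero, Matrix.cons_val_one,
        Matrix.cons_val]
      rw [Real.rpow_def_of_pos (x := x (idxA N s) - x (idxA N r)) (by linarith),
        Real.rpow_def_of_pos (x := x (idxB N s) - x (idxA N r)) (by linarith),
        Real.rpow_def_of_pos (x := x (idxA N s) - x (idxB N r)) (by linarith),
        Real.rpow_def_of_pos (x := x (idxB N s) - x (idxB N r)) (by linarith),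
        Real.rpow_def_of_pos (x := u s - u r) (by linarith),
        Real.rpow_def_of_pos (x := x (idxA N s) - u r) (by linarith),
        Real.rpow_def_of_pos (x := x (idxB N s) - u r) (by linarith),
        Real.rpow_def_of_pos (x := u s - x (idxA N r)) (by linarith),
        Real.rpow_def_of_pos (x := u s - x (idxB N r)) (by linarith)]
      simp only [← Real.exp_add]
      congr 1
      push_cast
      ring
    · simp
  rw [← hpair]
  have hdiag : cgConst (16 / 3) ^ N *
      (∏ r, (x (idxB N r) - x (idxA N r)) ^ (2 / (16 / 3) : ℝ)) *
      (∏ r, |u r - x (idxA N r)| ^ (-(4 / (16 / 3)) : ℝ) *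
        |u r - x (idxB N r)| ^ (-(4 / (16 / 3)) : ℝ)) =
      √2 ^ N * (∏ r, (x (idxB N r) - x (idxA N r)) ^ (-(1 / 8) : ℝ)) *
        ∏ r, betaDensity (x (idxA N r)) (x (idxB N r)) (u r) := by
    have hc : ∀ c : ℝ, c ^ N = ∏ _r : Fin N, c := fun c => by simp
    rw [hc, hc]
    simp only [← Finset.prod_mul_distrib]
    refine Finset.prod_congr rfl fun r _ => ?_
    have h1 := sub_pos.2 (h.1 r)
    have h2 := sub_pos.2 (hu' r).1
    have h3 := sub_pos.2 (hu' r).2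
    rw [betaDensity, Set.indicator_of_mem (show u r ∈ Set.Ioo _ _ from hu' r), cgConst_eq,
      abs_sub_comm (u r) (x (idxB N r)), abs_of_pos h2, abs_of_pos h3]
    have e : (x (idxB N r) - x (idxA N r)) ^ (2 / (16 / 3) : ℝ) =
        (x (idxB N r) - x (idxA N r)) ^ (-(1 / 8) : ℝ) *
          (x (idxB N r) - x (idxA N r)) ^ (1 / 2 : ℝ) := by
      rw [← Real.rpow_add h1]
      norm_num
    rw [e, show (-(4 / (16 / 3)) : ℝ) = -(3 / 4) by norm_num]
    ring
  linear_combination ((∏ r, ∏ s, if r < s then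
        (x (idxA N s) - x (idxA N r)) ^ (2 / (16 / 3) : ℝ) *
          (x (idxB N s) - x (idxA N r)) ^ (2 / (16 / 3) : ℝ) *
        ((x (idxA N s) - x (idxB N r)) ^ (2 / (16 / 3) : ℝ) *
          (x (idxB N s) - x (idxB N r)) ^ (2 / (16 / 3) : ℝ)) else 1) *
      (∏ r, ∏ s, if r < s then (u s - u r) ^ (8 / (16 / 3) : ℝ) else 1) *
      (∏ r, ∏ s, if r < s then
        |u r - x (idxA N s)| ^ (-(4 / (16 / 3)) : ℝ) *
          |u r - x (idxB N s)| ^ (-(4 / (16 / 3)) : ℝ) *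
        (|u s - x (idxA N r)| ^ (-(4 / (16 / 3)) : ℝ) *
          |u s - x (idxB N r)| ^ (-(4 / (16 / 3)) : ℝ)) else 1)) * hdiag

theorem cgG_eq {N : ℕ} {x : Fin (2 * N) → ℝ} (hx : StrictMono x) :
    cgG (16 / 3) N x = √2 ^ N * (∏ r, (x (idxB N r) - x (idxA N r)) ^ (-(1 / 8) : ℝ)) *
      cgNorm (fun r => x (idxA N r)) fun r => x (idxB N r) := by
  have hbox : MeasurableSet (cgBox N x) := MeasurableSet.univ_pi fun _ => measurableSet_Ioo
  rw [cgG, cgNorm_eq_integral (pairOrdered_of_strictMono hx).1, ← integral_const_mul,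
    ← integral_const_mul, ← integral_indicator hbox]
  refine integral_congr_ae (Eventually.of_forall fun u => ?_)
  by_cases hu : u ∈ cgBox N x
  · rw [Set.indicator_of_mem hu]
    exact cgIntegrand_eq hx hu
  · rw [Set.indicator_of_notMem hu]
    simp only [cgBox, Set.mem_pi, Set.mem_univ, true_implies, not_forall] at hu
    obtain ⟨r, hr⟩ := hu
    have : ∏ r, betaDensity (x (idxA N r)) (x (idxB N r)) (u r) = 0 :=
      Finset.prod_eq_zero (Finset.mem_univ r) (Set.indicator_of_notMem hr _)
    simp only [this, zero_mul, mul_zero]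

/-- at `κ = 16/3` the Coulomb gas integral `G^{(N)}` for the completely
unnested link pattern coincides with the explicit FK-Ising partition function `F_{⌢⌢}`. -/
theorem cg_eq_Fcc (N : ℕ) (hN : 1 ≤ N) (x : Fin (2 * N) → ℝ) (hx : StrictMono x) :
    cgG (16 / 3) N x
      = (∏ r : Fin N, (x (idxB N r) - x (idxA N r)) ^ (-(1 / 8) : ℝ)) * Ynn N x := by
  rw [cgG_eq hx, Ynn_eq hx, cgNorm_eq_isingNorm (pairOrdered_of_strictMono hx)]
  ring
end
end

section
/- Let N ≥ 2 and let α ∈ LP_N be a link pattern of {1,…,2N} with {1,2} ∈ α. Let j ∈ {4,6,…,2N} be an even index such that {3,4,…,j} is a union of links of α; let α_j be the perfect matching of {1,…,j−2} obtained from the links of α contained in {3,…,j} by relabeling via the order-preserving bijection {3,…,j} → {1,…,j−2}, and let α/α_j be the perfect matching of {1,…,2N−j+2} obtained from the remaining links of α by relabeling via the order-preserving bijection {1,2} ∪ {j+1,…,2N} → {1,…,2N−j+2}. Then L_{α, ⌢⌢^{(N)}} = L_{α_j, ⌢⌢^{(j/2−1)}} + L_{α/α_j, ⌢⌢^{(N−j/2+1)}},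 where ⌢⌢^{(m)} = {{1,2},{3,4},…,{2m−1,2m}}. In particular, for every q > 0, M_{α_j, ⌢⌢^{(j/2−1)}}(q) · M_{α/α_j, ⌢⌢^{(N−j/2+1)}}(q) = M_{α, ⌢⌢^{(N)}}(q). -/
noncomputable section

/-- A perfect matching of `{0, …, n-1}`, identified with a fixed-point-free involution. -/
def IsMatching {n : ℕ} (α : Equiv.Perm (Fin n)) : Prop :=
  (∀ i, α (α i) = i) ∧ ∀ i, α i ≠ i

/-- The number of loops `L_{α,β}` of the meander formed from `α` and `β`: the number of
orbits of the action on `{0, …, n-1}` of the subgroup generated by `α` and `β`. -/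
def meanderLoops {n : ℕ} (α β : Equiv.Perm (Fin n)) : ℕ :=
  Nat.card
    (Quotient (MulAction.orbitRel
      (↥(Subgroup.closure ({α, β} : Set (Equiv.Perm (Fin n))))) (Fin n)))

/-- The order-preserving embedding of `{0,…,2N-3}` into `{0,…,2N-1}` skipping the
positions `j` and `j+1`; it realizes the relabeling used in `α/{j,j+1}`. -/
def skipTwo {N : ℕ} (j : Fin (2 * N)) (i : Fin (2 * (N - 1))) : Fin (2 * N) :=
  if h : i.val < j.val then ⟨i.val, lt_trans h j.isLt⟩
  else ⟨i.val + 2, by have := i.isLt; omega⟩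

/-- Non-crossing condition for a matching: no crossing pairs `{i,k}` and `{j,l}`
with `i < j < k < l`. -/
def IsNoncrossing {n : ℕ} (α : Equiv.Perm (Fin n)) : Prop :=
  ¬∃ i j k l : Fin n, i < j ∧ j < k ∧ k < l ∧ α i = k ∧ α j = l

/-- The completely unnested matching `⌢⌢ = {{1,2},{3,4},…}`:
a matching pairing each even position (0-indexed) with its successor. -/
def IsUnnested {n : ℕ} (u : Equiv.Perm (Fin n)) : Prop :=
  IsMatching u ∧ ∀ i : Fin n, i.val % 2 = 0 → (u i).val = i.val + 1

/-- The order-preserving relabeling `{1,…,J-2} → {3,…,J}` (1-indexed),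
i.e. `i ↦ i + 2` (0-indexed). -/
def embedRight (N J : ℕ) (hJ : J ≤ 2 * N) (i : Fin (J - 2)) : Fin (2 * N) :=
  ⟨i.val + 2, by have := i.isLt; omega⟩

/-- The order-preserving relabeling `{1,…,2N-J+2} → {1,2} ∪ {J+1,…,2N}` (1-indexed). -/
def embedLeft (N J : ℕ) (hJ : 4 ≤ J ∧ J ≤ 2 * N) (i : Fin (2 * N - J + 2)) : Fin (2 * N) :=
  if h : i.val < 2 then ⟨i.val, by obtain ⟨h1, h2⟩ := hJ; omega⟩
  else ⟨i.val + (J - 2), by have := i.isLt; obtain ⟨h1, h2⟩ := hJ; omega⟩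

/-- The loops of a meander are the classes of points modulo identifying each point with its
images under the two matchings. -/
theorem meanderLoops_eq_card_quot {n : ℕ} (α β : Equiv.Perm (Fin n)) :
    meanderLoops α β = Nat.card (Quot fun x y : Fin n => y = α x ∨ y = β x) := by
  have key : ∀ g ∈ Subgroup.closure ({α, β} : Set (Equiv.Perm (Fin n))), ∀ x,
      Quot.mk (fun x y : Fin n => y = α x ∨ y = β x) (g x) = Quot.mk _ x := by
    intro g hg
    induction hg using Subgroup.closure_induction with
    | mem g hg =>
      intro x
      rcases hg with rfl | rfl
      · exact (Quot.sound (.inl rfl)).symm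
      · exact (Quot.sound (.inr rfl)).symm
    | one => exact fun _ => rfl
    | mul g h _ _ ihg ihh => exact fun x => (ihg (h x)).trans (ihh x)
    | inv g _ ih => exact fun x => by simpa using (ih (g⁻¹ x)).symm
  refine Nat.card_congr
    { toFun := Quotient.lift (fun x => Quot.mk _ x) ?_
      invFun := Quot.lift (fun x => Quotient.mk _ x) ?_
      left_inv := ?_
      right_inv := ?_ }
  · rintro x y ⟨g, rfl⟩
    exact key g.1 g.2 y
  · rintro x y (rfl | rfl)
    · refine Eq.symm (Quotient.sound ?_)
      exact ⟨⟨α, Subgroup.subset_closure (by simp)⟩, rfl⟩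
    · refine Eq.symm (Quotient.sound ?_)
      exact ⟨⟨β, Subgroup.subset_closure (by simp)⟩, rfl⟩
  · rintro ⟨x⟩
    rfl
  · rintro ⟨x⟩
    rfl

/-- If two matchings both split along a partition of the points into two parts, then the loop
counts of the two restricted meanders add up. -/
theorem meanderLoops_eq_add_of_equiv_sum {a b n : ℕ} (e : Fin a ⊕ Fin b ≃ Fin n)
    {α β : Equiv.Perm (Fin n)} {α₁ β₁ : Equiv.Perm (Fin a)} {α₂ β₂ : Equiv.Perm (Fin b)}
    (hα₁ : ∀ i, α (e (.inl i)) = e (.inl (α₁ i))) (hα₂ : ∀ i, α (e (.inr i)) = e (.inr (α₂ i)))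
    (hβ₁ : ∀ i, β (e (.inl i)) = e (.inl (β₁ i))) (hβ₂ : ∀ i, β (e (.inr i)) = e (.inr (β₂ i))) :
    meanderLoops α β = meanderLoops α₁ β₁ + meanderLoops α₂ β₂ := by
  simp only [meanderLoops_eq_card_quot]
  rw [← Nat.card_sum]
  refine Nat.card_congr
    { toFun := Quot.lift (fun x => Sum.map (Quot.mk _) (Quot.mk _) (e.symm x)) ?_
      invFun := Sum.elim
        (Quot.map (fun i => e (.inl i)) ?_) (Quot.map (fun i => e (.inr i)) ?_)
      left_inv := ?_
      right_inv := ?_ }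
  · intro x y hxy
    obtain ⟨i | i, rfl⟩ := e.surjective x
    · rcases hxy with rfl | rfl
      · simpa [hα₁] using Quot.sound (.inl rfl)
      · simpa [hβ₁] using Quot.sound (.inr rfl)
    · rcases hxy with rfl | rfl
      · simpa [hα₂] using Quot.sound (.inl rfl)
      · simpa [hβ₂] using Quot.sound (.inr rfl)
  · rintro i _ (rfl | rfl)
    exacts [.inl (hα₁ i).symm, .inr (hβ₁ i).symm]
  · rintro i _ (rfl | rfl)
    exacts [.inl (hα₂ i).symm, .inr (hβ₂ i).symm]
  · rintro ⟨x⟩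
    obtain ⟨i | i, rfl⟩ := e.surjective x <;> simp [Quot.map]
  · rintro (⟨⟨i⟩⟩ | ⟨⟨i⟩⟩) <;> simp [Quot.map]

theorem val_embedRight {N J : ℕ} (hJ : J ≤ 2 * N) (i : Fin (J - 2)) :
    (embedRight N J hJ i).val = i.val + 2 := rfl

theorem val_embedLeft {N J : ℕ} (hJ : 4 ≤ J ∧ J ≤ 2 * N) (i : Fin (2 * N - J + 2)) :
    (embedLeft N J hJ i).val = if i.val < 2 then i.val else i.val + (J - 2) := by
  unfold embedLeft
  split_ifs <;> rfl

theorem bijective_sumElim_embed {N J : ℕ} (hJ : 4 ≤ J ∧ J ≤ 2 * N) :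
    Function.Bijective (Sum.elim (embedRight N J hJ.2) (embedLeft N J hJ)) := by
  constructor
  · rintro (i | i) (k | k) h <;>
      simp only [Sum.elim_inl, Sum.elim_inr, Fin.ext_iff, val_embedRight, val_embedLeft] at h <;>
      simp only [Sum.inl.injEq, Sum.inr.injEq, reduceCtorEq, Fin.ext_iff] <;>
      grind
  · intro x
    by_cases h2 : x.val < 2
    · refine ⟨.inr ⟨x.val, by omega⟩, Fin.ext ?_⟩
      simp [val_embedLeft, h2]
    · by_cases hxJ : x.val < J
      · refine ⟨.inl ⟨x.val - 2, by omega⟩, Fin.ext ?_⟩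
        simp only [Sum.elim_inl, val_embedRight]
        omega
      · refine ⟨.inr ⟨x.val - (J - 2), by omega⟩, Fin.ext ?_⟩
        simp only [Sum.elim_inr, val_embedLeft]
        split_ifs <;> omega

/-- The unnested matching sends an odd position to its predecessor. -/
theorem IsUnnested.val_apply_of_odd {n : ℕ} {u : Equiv.Perm (Fin n)} (hu : IsUnnested u)
    {i : Fin n} (hi : i.val % 2 = 1) : (u i).val = i.val - 1 := by
  have h := hu.2 ⟨i.val - 1, by omega⟩ (by simp only; omega)
  have hk : u ⟨i.val - 1, by omega⟩ = i := Fin.ext (by rw [h]; simp only; omega)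
  rw [← hk, hu.1.1, hk]

theorem IsUnnested.val_apply {n : ℕ} {u : Equiv.Perm (Fin n)} (hu : IsUnnested u) (i : Fin n) :
    (u i).val = if i.val % 2 = 0 then i.val + 1 else i.val - 1 := by
  split_ifs with h
  · exact hu.2 i h
  · exact hu.val_apply_of_odd (by omega)

/-- for a link pattern `α` with `{1,2} ∈ α` and an even `J` such that
`{3,…,J}` is a union of links of `α`, the meander loop count against the completely
unnested pattern factorizes: `L_{α,⌢⌢^{(N)}} = L_{α_J,⌢⌢^{(J/2-1)}} + L_{α/α_J,⌢⌢^{(N-J/2+1)}}`;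
equivalently `M_{α_J,⌢⌢}(q) · M_{α/α_J,⌢⌢}(q) = M_{α,⌢⌢}(q)` for every `q > 0`.
Here `αR` encodes `α_J` (via `embedRight`), `αL` encodes `α/α_J` (via `embedLeft`),
and `u`, `uR`, `uL` are the completely unnested matchings of the respective index sets. -/
theorem meanderLoops_cascade (N : ℕ) (hN : 2 ≤ N)
    (α : Equiv.Perm (Fin (2 * N))) (hα : IsMatching α) (hαnc : IsNoncrossing α)
    (h12 : (α ⟨0, by omega⟩).val = 1)
    (J : ℕ) (hJ4 : 4 ≤ J) (hJeven : J % 2 = 0) (hJ2N : J ≤ 2 * N)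
    (hJclosed : ∀ i : Fin (2 * N), 2 ≤ i.val → i.val < J → 2 ≤ (α i).val ∧ (α i).val < J)
    (αR : Equiv.Perm (Fin (J - 2)))
    (hαR : ∀ i, α (embedRight N J hJ2N i) = embedRight N J hJ2N (αR i))
    (αL : Equiv.Perm (Fin (2 * N - J + 2)))
    (hαL : ∀ i, α (embedLeft N J ⟨hJ4, hJ2N⟩ i) = embedLeft N J ⟨hJ4, hJ2N⟩ (αL i))
    (u : Equiv.Perm (Fin (2 * N))) (hu : IsUnnested u)
    (uR : Equiv.Perm (Fin (J - 2))) (huR : IsUnnested uR)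
    (uL : Equiv.Perm (Fin (2 * N - J + 2))) (huL : IsUnnested uL) :
    meanderLoops α u = meanderLoops αR uR + meanderLoops αL uL ∧
      ∀ q : ℝ, 0 < q →
        Real.sqrt q ^ meanderLoops αR uR * Real.sqrt q ^ meanderLoops αL uL
          = Real.sqrt q ^ meanderLoops α u := by
  have hloops : meanderLoops α u = meanderLoops αR uR + meanderLoops αL uL := by
    refine meanderLoops_eq_add_of_equiv_sum
      (Equiv.ofBijective _ (bijective_sumElim_embed ⟨hJ4, hJ2N⟩)) hαR hαL ?_ ?_
    · intro i
      refine Fin.ext ?_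
      simp only [Equiv.ofBijective_apply, Sum.elim_inl, hu.val_apply, huR.val_apply,
        val_embedRight]
      grind
    · intro i
      refine Fin.ext ?_
      simp only [Equiv.ofBijective_apply, Sum.elim_inr, hu.val_apply, huL.val_apply,
        val_embedLeft]
      grind
  exact ⟨hloops, fun q _ => by rw [hloops, pow_add]⟩
end
end
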